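/- In the iterative scheme for the spherically symmetric Einstein–Vlasov–Maxwell system, for every n ∈ ℕ the functions λₙ, μₙ, fₙ, eₙ, pₙ, kₙ, Nₙ, Mₙ, λ̃ₙ are well defined and regular on [0, Tₙ) × [0,∞), the time Tₙ is strictly positive, and the inequalities μₙ + λₙ ≤ 0, λₙ ≥ 0 and μₙ ≤ 0 hold. -/

import Mathlib

/- Common definitions for the spherically symmetric Einstein–Vlasov–Maxwell system. -/

noncomputable section
open Real MeasureTheory Filter Topology Matrix intervalIntegral
open scoped Classical ENNReal

namespace EVM

/-- Euclidean 3-space. -/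
abbrev E3 : Type := EuclideanSpace ℝ (Fin 3)

/-- `√(1+|v|²)`. -/
def w (v : E3) : ℝ := Real.sqrt (1 + ‖v‖ ^ 2)

/-- Action of a 3×3 matrix on `E3`. -/
def act (A : Matrix (Fin 3) (Fin 3) ℝ) (x : E3) : E3 := WithLp.toLp 2 (fun i => ∑ j, A i j * x j)

/-- Membership in SO(3). -/
def SO3 (A : Matrix (Fin 3) (Fin 3) ℝ) : Prop := Aᵀ * A = 1 ∧ A.det = 1

/-- A function on `ℝ³ × ℝ³` is spherically symmetric if it is invariant under
simultaneous rotations of both arguments. -/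
def SphSymm (g : E3 → E3 → ℝ) : Prop :=
  ∀ A : Matrix (Fin 3) (Fin 3) ℝ, SO3 A → ∀ x v : E3, g (act A x) (act A v) = g x v

/-- The reference point of radius `r` on the first coordinate axis. -/
def pt (r : ℝ) : E3 := EuclideanSpace.single 0 r

/-- Euclidean divergence of a vector field on `ℝ³`. -/
def div3 (G : E3 → E3) (x : E3) : ℝ :=
  ∑ i : Fin 3, fderiv ℝ (fun y => G y i) x (EuclideanSpace.single i 1)

/-! ### Regularity notions -/

/-- `C²` on `I × [0,∞)`. -/
def C2On (I : Set ℝ) (g : ℝ → ℝ → ℝ) : Prop :=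
  ContDiffOn ℝ 2 (fun p : ℝ × ℝ => g p.1 p.2) (I ×ˢ Set.Ici (0:ℝ))

/-- `g(t,r) → 0` as `r → ∞`, for each `t ∈ I`. -/
def ZeroAtInfty (I : Set ℝ) (g : ℝ → ℝ → ℝ) : Prop :=
  ∀ t ∈ I, Tendsto (g t) atTop (nhds 0)

/-- Regularity of the metric pair `(λ, μ)` on `I × [0,∞)`, including the boundary
conditions `λ(t,r), μ(t,r) → 0` as `r → ∞`, `λ(t,0) = 0`, and
`λ̇(t,0) = λ′(t,0) = μ′(t,0) = 0`. -/
def RegMetric2 (I : Set ℝ) (lam mu : ℝ → ℝ → ℝ) : Prop :=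
  C2On I lam ∧ C2On I mu ∧ ZeroAtInfty I lam ∧ ZeroAtInfty I mu ∧
  (∀ t ∈ I, lam t 0 = 0) ∧
  (∀ t ∈ I, deriv (fun s => lam s 0) t = 0) ∧
  (∀ t ∈ I, deriv (lam t) 0 = 0) ∧
  (∀ t ∈ I, deriv (mu t) 0 = 0)

/-- Regularity of the triple `(λ, μ, λ̃)` on `I × [0,∞)`: additionally `λ̃` is `C²`
with `λ̃′(t,0) = 0`. -/
def RegMetric3 (I : Set ℝ) (lam mu lamT : ℝ → ℝ → ℝ) : Prop :=
  RegMetric2 I lam mu ∧ C2On I lamT ∧ (∀ t ∈ I, deriv (lamT t) 0 = 0)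

/-- Regularity of the electric field coefficient `e`: `e` and `e′` are continuous on
`I × [0,∞)`, `e(t,0) = 0` and `e(t,r) → 0` as `r → ∞`. -/
def RegField (I : Set ℝ) (e : ℝ → ℝ → ℝ) : Prop :=
  ContinuousOn (fun p : ℝ × ℝ => e p.1 p.2) (I ×ˢ Set.Ici (0:ℝ)) ∧
  ContinuousOn (fun p : ℝ × ℝ => deriv (e p.1) p.2) (I ×ˢ Set.Ici (0:ℝ)) ∧
  (∀ t ∈ I, e t 0 = 0) ∧ ZeroAtInfty I e

/-- Regularity of a distribution function: `C¹`, nonnegative, spherically symmetric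
with compact support at each time. -/
def RegDist (I : Set ℝ) (f : ℝ → E3 → E3 → ℝ) : Prop :=
  ContDiffOn ℝ 1 (fun p : ℝ × (E3 × E3) => f p.1 p.2.1 p.2.2)
    (I ×ˢ (Set.univ : Set (E3 × E3))) ∧
  (∀ t ∈ I, ∀ x v : E3, 0 ≤ f t x v) ∧
  (∀ t ∈ I, SphSymm (f t)) ∧
  (∀ t ∈ I, HasCompactSupport (fun z : E3 × E3 => f t z.1 z.2))

/-! ### The characteristic field -/

/-- Spatial part of the characteristic field. -/
def F1 (lam mu : ℝ → ℝ → ℝ) (s : ℝ) (x v : E3) : E3 :=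
  (Real.exp (mu s ‖x‖ - lam s ‖x‖) / w v) • v

/-- Momentum part of the characteristic field. -/
def F2 (q : ℝ) (lam mu lamT e : ℝ → ℝ → ℝ) (s : ℝ) (x v : E3) : E3 :=
  if x = 0 then 0 else
    (-(lamT s ‖x‖ * ((inner ℝ x v : ℝ) / ‖x‖)
        + Real.exp (mu s ‖x‖ - lam s ‖x‖) * deriv (mu s) ‖x‖ * w v
        - q * Real.exp (mu s ‖x‖ + lam s ‖x‖) * e s ‖x‖) / ‖x‖) • x

/-- The full characteristic field `F = (F₁, F₂)`. -/
def Fchar (q : ℝ) (lam mu lamT e : ℝ → ℝ → ℝ) (s : ℝ) (z : E3 × E3) : E3 × E3 :=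
  (F1 lam mu s z.1 z.2, F2 q lam mu lamT e s z.1 z.2)

/-- The (modified) Vlasov equation with time-derivative coefficient `λ̃ = lamT`. -/
def VlasovEq (q : ℝ) (I : Set ℝ) (lam mu lamT e : ℝ → ℝ → ℝ)
    (f : ℝ → E3 → E3 → ℝ) : Prop :=
  ∀ t ∈ I, ∀ x v : E3,
    deriv (fun s => f s x v) t
      + fderiv ℝ (fun y => f t y v) x (F1 lam mu t x v)
      + fderiv ℝ (fun u => f t x u) v (F2 q lam mu lamT e t x v) = 0

/-! ### Source terms (as functions of `(t,r)`, evaluated along the first axis) -/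

/-- Energy density `ρ`. -/
def rho (lam e : ℝ → ℝ → ℝ) (f : ℝ → E3 → E3 → ℝ) (t r : ℝ) : ℝ :=
  (∫ v : E3, w v * f t (pt r) v) + (1/2) * Real.exp (2 * lam t r) * (e t r) ^ 2

/-- Radial pressure `p`. -/
def prs (lam e : ℝ → ℝ → ℝ) (f : ℝ → E3 → E3 → ℝ) (t r : ℝ) : ℝ :=
  (∫ v : E3, (v 0) ^ 2 / w v * f t (pt r) v) - (1/2) * Real.exp (2 * lam t r) * (e t r) ^ 2

/-- Momentum density `k`. -/
def kk (f : ℝ → E3 → E3 → ℝ) (t r : ℝ) : ℝ := ∫ v : E3, (v 0) * f t (pt r) v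

/-- Tangential pressure term `q̄`. -/
def qbar (lam e : ℝ → ℝ → ℝ) (f : ℝ → E3 → E3 → ℝ) (t r : ℝ) : ℝ :=
  (∫ v : E3, (‖v‖ ^ 2 - (v 0) ^ 2) / w v * f t (pt r) v)
    + Real.exp (2 * lam t r) * (e t r) ^ 2

/-- Charge density `M`. -/
def Mch (f : ℝ → E3 → E3 → ℝ) (t r : ℝ) : ℝ := ∫ v : E3, f t (pt r) v

/-- Current term `N`. -/
def Ncur (f : ℝ → E3 → E3 → ℝ) (t r : ℝ) : ℝ := ∫ v : E3, (r * v 0) / w v * f t (pt r) v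

/-- Quasi-local mass `m(t,r) = 4π ∫₀ʳ s² ρ(t,s) ds`. -/
def mqm (lam e : ℝ → ℝ → ℝ) (f : ℝ → E3 → E3 → ℝ) (t r : ℝ) : ℝ :=
  4 * π * ∫ s in (0:ℝ)..r, s ^ 2 * rho lam e f t s

/-! ### The field equations -/

/-- Einstein equation (2.6): `e^{−2λ}(2rλ′ − 1) + 1 = 8πr²ρ`. -/
def Eq2_6 (I : Set ℝ) (lam e : ℝ → ℝ → ℝ) (f : ℝ → E3 → E3 → ℝ) : Prop :=
  ∀ t ∈ I, ∀ r : ℝ, 0 ≤ r →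
    Real.exp (-2 * lam t r) * (2 * r * deriv (lam t) r - 1) + 1
      = 8 * π * r ^ 2 * rho lam e f t r

/-- Einstein equation (2.7): `λ̇ = −4πr e^{λ+μ} k`. -/
def Eq2_7 (I : Set ℝ) (lam mu : ℝ → ℝ → ℝ) (f : ℝ → E3 → E3 → ℝ) : Prop :=
  ∀ t ∈ I, ∀ r : ℝ, 0 ≤ r →
    deriv (fun s => lam s r) t
      = -(4 * π) * r * Real.exp (lam t r + mu t r) * kk f t r

/-- Einstein equation (2.8) in the form `e^{−2λ}(2rμ′ + 1) − 1 = 8πr²p`. -/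
def Eq2_8 (I : Set ℝ) (lam mu e : ℝ → ℝ → ℝ) (f : ℝ → E3 → E3 → ℝ) : Prop :=
  ∀ t ∈ I, ∀ r : ℝ, 0 ≤ r →
    Real.exp (-2 * lam t r) * (2 * r * deriv (mu t) r + 1) - 1
      = 8 * π * r ^ 2 * prs lam e f t r

/-- Einstein equation (2.9) (second order). -/
def Eq2_9 (I : Set ℝ) (lam mu e : ℝ → ℝ → ℝ) (f : ℝ → E3 → E3 → ℝ) : Prop :=
  ∀ t ∈ I, ∀ r : ℝ, 0 < r →
    Real.exp (-2 * lam t r) *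
        (deriv (deriv (mu t)) r
          + (deriv (mu t) r - deriv (lam t) r) * (deriv (mu t) r + 1 / r))
      - Real.exp (-2 * mu t r) *
        (deriv (fun s => deriv (fun τ => lam τ r) s) t
          + deriv (fun s => lam s r) t
            * (deriv (fun s => lam s r) t - deriv (fun s => mu s r) t))
      = 4 * π * qbar lam e f t r

/-- Maxwell equation (2.11): `∂ᵣ(r² e^{λ} e) = q r² e^{λ} M`. -/
def Max2_11 (q : ℝ) (I : Set ℝ) (lam e : ℝ → ℝ → ℝ) (f : ℝ → E3 → E3 → ℝ) : Prop :=
  ∀ t ∈ I, ∀ r : ℝ, 0 ≤ r →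
    deriv (fun s => s ^ 2 * Real.exp (lam t s) * e t s) r
      = q * r ^ 2 * Real.exp (lam t r) * Mch f t r

/-- Maxwell equation (2.12): `∂ₜ(e^{λ} e) = −(q/r) e^{μ} N`. -/
def Max2_12 (q : ℝ) (I : Set ℝ) (lam mu e : ℝ → ℝ → ℝ) (f : ℝ → E3 → E3 → ℝ) : Prop :=
  ∀ t ∈ I, ∀ r : ℝ, 0 < r →
    deriv (fun s => Real.exp (lam s r) * e s r) t
      = -(q / r) * Real.exp (mu t r) * Ncur f t r

/-- The full spherically symmetric Einstein–Vlasov–Maxwell system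
(2.6)–(2.12), the Vlasov equation taken with `λ̃ = λ̇`. -/
def FullSystem (q : ℝ) (I : Set ℝ) (lam mu e : ℝ → ℝ → ℝ) (f : ℝ → E3 → E3 → ℝ) : Prop :=
  Eq2_6 I lam e f ∧ Eq2_7 I lam mu f ∧ Eq2_8 I lam mu e f ∧ Eq2_9 I lam mu e f ∧
  VlasovEq q I lam mu (fun t r => deriv (fun s => lam s r) t) e f ∧
  Max2_11 q I lam e f ∧ Max2_12 q I lam mu e f

/-- A regular solution of the full system on `I` (regularity includes the
asymptotically flat boundary conditions). -/
def RegularSolution (q : ℝ) (I : Set ℝ) (lam mu e : ℝ → ℝ → ℝ)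
    (f : ℝ → E3 → E3 → ℝ) : Prop :=
  RegMetric2 I lam mu ∧ RegField I e ∧ RegDist I f ∧ FullSystem q I lam mu e f



/-- The half-open interval `[0, T)` of real times below an extended real `T`. -/
def Iv (T : ℝ≥0∞) : Set ℝ := {t : ℝ | 0 ≤ t ∧ (ENNReal.ofReal t) < T}

/-- The initial data for the iterative scheme: a smooth, nonnegative, compactly
supported, spherically symmetric `f̊` satisfying the smallness condition (4.1),
and a smooth regular solution `(λ̊, μ̊, e̊)` of the constraint equations
(3.17), (3.18), (3.19). -/
def InitialData (q : ℝ) (f0 : E3 → E3 → ℝ) (lam0 mu0 e0 : ℝ → ℝ) : Prop :=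
  ContDiff ℝ (⊤ : ℕ∞) (fun z : E3 × E3 => f0 z.1 z.2) ∧
  (∀ x v : E3, 0 ≤ f0 x v) ∧
  HasCompactSupport (fun z : E3 × E3 => f0 z.1 z.2) ∧ SphSymm f0 ∧
  (∀ r : ℝ, 0 < r →
    8 * π * (∫ s in (0:ℝ)..r, s ^ 2 * ∫ v : E3, w v * f0 (pt s) v) < r) ∧
  ContDiff ℝ (⊤ : ℕ∞) lam0 ∧ ContDiff ℝ (⊤ : ℕ∞) mu0 ∧ ContDiff ℝ (⊤ : ℕ∞) e0 ∧
  lam0 0 = 0 ∧ e0 0 = 0 ∧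
  Tendsto lam0 atTop (nhds 0) ∧ Tendsto mu0 atTop (nhds 0) ∧
  Tendsto e0 atTop (nhds 0) ∧
  (∀ r : ℝ, 0 < r →
    Real.exp (-2 * lam0 r) * (2 * r * deriv lam0 r - 1) + 1
      = 8 * π * r ^ 2 * ((∫ v : E3, w v * f0 (pt r) v)
          + 1/2 * Real.exp (2 * lam0 r) * (e0 r) ^ 2)) ∧
  (∀ r : ℝ, 0 < r →
    Real.exp (-2 * lam0 r) * (2 * r * deriv mu0 r + 1) - 1
      = 8 * π * r ^ 2 * ((∫ v : E3, (v 0) ^ 2 / w v * f0 (pt r) v)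
          - 1/2 * Real.exp (2 * lam0 r) * (e0 r) ^ 2)) ∧
  (∀ r : ℝ, 0 < r →
    deriv (fun s => s ^ 2 * Real.exp (lam0 s) * e0 s) r
      = q * r ^ 2 * Real.exp (lam0 r) * ∫ v : E3, f0 (pt r) v)

/-- The iterative scheme of Section 4.1: the sequences
`(fₙ, λₙ, μₙ, λ̃ₙ, eₙ, Tₙ, Zₙ)` satisfy the defining relations of the iterates. -/
def IsScheme (q : ℝ) (f0 : E3 → E3 → ℝ) (lam0 mu0 e0 : ℝ → ℝ)
    (fI : ℕ → ℝ → E3 → E3 → ℝ) (lamI muI lamTI eI : ℕ → ℝ → ℝ → ℝ)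
    (T : ℕ → ℝ≥0∞) (Z : ℕ → ℝ → ℝ → E3 × E3 → E3 × E3) : Prop :=
  -- zeroth iterates
  (∀ t : ℝ, ∀ x v : E3, fI 0 t x v = f0 x v) ∧
  (∀ t r : ℝ, lamI 0 t r = lam0 r) ∧ (∀ t r : ℝ, muI 0 t r = mu0 r) ∧
  (∀ t r : ℝ, eI 0 t r = e0 r) ∧ T 0 = ⊤ ∧
  -- λ̃ₙ from (4.15)
  (∀ n : ℕ, ∀ t r : ℝ,
    lamTI n t r = -(4 * π) * r * Real.exp (lamI n t r + muI n t r) * kk (fI n) t r) ∧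
  -- Zₙ₊₁ is the flow of the characteristic field built from the n-th iterates
  (∀ n : ℕ, ∀ t ∈ Iv (T n), ∀ z : E3 × E3, Z (n + 1) t t z = z) ∧
  (∀ n : ℕ, ∀ t ∈ Iv (T n), ∀ z : E3 × E3, ∀ s ∈ Iv (T n),
    HasDerivAt (fun τ => Z (n + 1) τ t z)
      (Fchar q (lamI n) (muI n) (lamTI n) (eI n) s (Z (n + 1) s t z)) s) ∧
  -- fₙ₊₁(t,z) = f̊(Zₙ₊₁(0,t,z))
  (∀ n : ℕ, ∀ t ∈ Iv (T n), ∀ x v : E3,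
    fI (n + 1) t x v = f0 (Z (n + 1) 0 t (x, v)).1 (Z (n + 1) 0 t (x, v)).2) ∧
  -- Tₙ₊₁ from (4.11)
  (∀ n : ℕ, T (n + 1) = sSup {τ : ℝ≥0∞ | ∃ t : ℝ, τ = ENNReal.ofReal t ∧
      t ∈ Iv (T n) ∧ ∀ s ∈ Set.Icc (0:ℝ) t, ∀ r : ℝ, 0 < r →
        2 * mqm (lamI n) (eI n) (fI (n + 1)) s r < r}) ∧
  -- λₙ₊₁ from (4.12)
  (∀ n : ℕ, ∀ t ∈ Iv (T (n + 1)), ∀ r : ℝ, 0 < r →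
    Real.exp (-2 * lamI (n + 1) t r)
      = 1 - 2 * mqm (lamI n) (eI n) (fI (n + 1)) t r / r) ∧
  (∀ n : ℕ, ∀ t ∈ Iv (T (n + 1)), lamI (n + 1) t 0 = 0) ∧
  -- μₙ₊₁ from (4.13), (4.14)
  (∀ n : ℕ, ∀ t ∈ Iv (T (n + 1)), ∀ r : ℝ, 0 < r →
    deriv (muI (n + 1) t) r = Real.exp (2 * lamI (n + 1) t r) *
      (mqm (lamI n) (eI n) (fI (n + 1)) t r / r ^ 2
        + 4 * π * r * prs (lamI n) (eI n) (fI (n + 1)) t r)) ∧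
  (∀ n : ℕ, ∀ t ∈ Iv (T (n + 1)), ∀ r : ℝ, 0 ≤ r →
    muI (n + 1) t r = -∫ s in Set.Ioi r, deriv (muI (n + 1) t) s) ∧
  -- eₙ₊₁ from (4.16)
  (∀ n : ℕ, ∀ t ∈ Iv (T (n + 1)), ∀ r : ℝ, 0 < r →
    eI (n + 1) t r = q / r ^ 2 * Real.exp (-(lamI (n + 1) t r)) *
      ∫ s in (0:ℝ)..r, s ^ 2 * Real.exp (lamI (n + 1) t s) * Mch (fI (n + 1)) t s) ∧
  (∀ n : ℕ, ∀ t ∈ Iv (T (n + 1)), eI (n + 1) t 0 = 0)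

/-- Maximal momentum `Pₙ(t)` in the support of `fₙ` up to time `t`. -/
def Pmax (fI : ℕ → ℝ → E3 → E3 → ℝ) (n : ℕ) (t : ℝ) : ℝ :=
  sSup {c : ℝ | ∃ s ∈ Set.Icc (0:ℝ) t, ∃ x v : E3, fI n s x v ≠ 0 ∧ c = ‖v‖}

/-- `Qₙ(t) = sup {e^{2λₙ(s,r)} : r ≥ 0, 0 ≤ s ≤ t}`. -/
def Qmax (lamI : ℕ → ℝ → ℝ → ℝ) (n : ℕ) (t : ℝ) : ℝ :=
  sSup {c : ℝ | ∃ s ∈ Set.Icc (0:ℝ) t, ∃ r : ℝ, 0 ≤ r ∧ c = Real.exp (2 * lamI n s r)}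

/-- `u₀`: maximal momentum in the support of the initial datum. -/
def suppMom (f0 : E3 → E3 → ℝ) : ℝ :=
  sSup {c : ℝ | ∃ x v : E3, f0 x v ≠ 0 ∧ c = ‖v‖}

/-- `r₀`: maximal radius in the support of the initial datum. -/
def suppRad (f0 : E3 → E3 → ℝ) : ℝ :=
  sSup {c : ℝ | ∃ x v : E3, f0 x v ≠ 0 ∧ c = ‖x‖}

/-- `q₀ = sup {e^{2λ̊(r)} : r ≥ 0}`. -/
def q0max (lam0 : ℝ → ℝ) : ℝ :=
  sSup {c : ℝ | ∃ r : ℝ, 0 ≤ r ∧ c = Real.exp (2 * lam0 r)}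

/-- The supremum norm of the initial datum. -/
def supNorm (f0 : E3 → E3 → ℝ) : ℝ := ⨆ z : E3 × E3, |f0 z.1 z.2|

/-- The supremum norm of the full gradient of the initial datum. -/
def gradSupNorm (f0 : E3 → E3 → ℝ) : ℝ :=
  ⨆ z : E3 × E3, ‖fderiv ℝ (fun p : E3 × E3 => f0 p.1 p.2) z‖

/-- Sup norm of the spatial gradient of `fₙ(t)`. -/
def gradxSup (fI : ℕ → ℝ → E3 → E3 → ℝ) (n : ℕ) (t : ℝ) : ℝ :=
  ⨆ x : E3, ⨆ v : E3, ‖fderiv ℝ (fun y => fI n t y v) x‖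

section ODE

abbrev I01 : Type := Set.Icc (0:ℝ) 1

variable {E F : Type} [NormedAddCommGroup E] [NormedSpace ℝ E] [NormedAddCommGroup F] [NormedSpace ℝ F]

/-- Pointwise application of a continuous family of linear maps. -/
def applyFam : C(I01, E →L[ℝ] F) →L[ℝ] C(I01, E) →L[ℝ] C(I01, F) :=
  LinearMap.mkContinuous₂
    (LinearMap.mk₂ ℝ (fun (A : C(I01, E →L[ℝ] F)) (u : C(I01, E)) =>
        (⟨fun s => A s (u s), A.continuous.clm_apply u.continuous⟩ : C(I01, F)))
      (by intros; ext; simp) (by intros; ext; simp) (by intros; ext; simp) (by intros; ext; simp)) 1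
    (by
      intro A u
      rw [one_mul]
      refine (ContinuousMap.norm_le _ (by positivity)).2 fun s => ?_
      refine ((A s).le_opNorm (u s)).trans ?_
      exact mul_le_mul (A.norm_coe_le_norm s) (u.norm_coe_le_norm s) (norm_nonneg _) (norm_nonneg A))

lemma applyFam_apply (A : C(I01, E →L[ℝ] F)) (u : C(I01, E)) (s : I01) :
    applyFam A u s = A s (u s) := rfl

/-- The superposition operator. -/
def compOp (G : E → F) (hG : Continuous G) (u : C(I01, E)) : C(I01, F) :=
  ⟨fun s => G (u s), hG.comp u.continuous⟩

lemma compOp_hasFDerivAt (G : E → F) (hG : ContDiff ℝ 1 G) (u : C(I01, E)) :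
    HasFDerivAt (compOp G hG.continuous)
      (applyFam (compOp (fderiv ℝ G) (hG.continuous_fderiv one_ne_zero) u)) u := by
  rw [hasFDerivAt_iff_isLittleO_nhds_zero, Asymptotics.isLittleO_iff]
  intro c hc
  have hcont := hG.continuous_fderiv one_ne_zero
  have hK : IsCompact (Set.range u) := isCompact_range u.continuous
  have := hK.uniformContinuousAt_of_continuousAt (fderiv ℝ G)
    (fun a _ => hcont.continuousAt) (Metric.dist_mem_uniformity hc)
  obtain ⟨δ, hδ, hd⟩ := Metric.mem_uniformity_dist.1 this
  filter_upwards [Metric.ball_mem_nhds (0 : C(I01, E)) hδ] with h hh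
  rw [mem_ball_zero_iff] at hh
  refine (ContinuousMap.norm_le _ (by positivity)).2 fun s => ?_
  have hs : ‖h s‖ ≤ ‖h‖ := h.norm_coe_le_norm s
  have key : ‖G (u s + h s) - G (u s) - fderiv ℝ G (u s) (u s + h s - u s)‖ ≤ c * ‖u s + h s - u s‖ := by
    refine (convex_ball (u s) δ).norm_image_sub_le_of_norm_hasFDerivWithin_le'
      (f' := fun y => fderiv ℝ G y) ?_ ?_ (Metric.mem_ball_self hδ) ?_
    · intro y _
      exact ((hG.differentiable one_ne_zero) y).hasFDerivAt.hasFDerivWithinAt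
    · intro y hy
      have h1 : dist (u s) y < δ := by rw [dist_comm]; exact hy
      have := hd h1 ⟨s, rfl⟩
      rw [Set.mem_setOf_eq, dist_comm, dist_eq_norm] at this
      exact this.le
    · rw [Metric.mem_ball, dist_eq_norm]
      simpa using hs.trans_lt hh
  have e1 : u s + h s - u s = h s := by abel
  rw [e1] at key
  exact key.trans (by gcongr)

lemma compOp_contDiff (n : ℕ) : ∀ {F : Type} [NormedAddCommGroup F] [NormedSpace ℝ F]
    (G : E → F) (hG : ContDiff ℝ n G), ContDiff ℝ n (compOp G hG.continuous) := by
  induction n with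
  | zero =>
    intro F _ _ G hG
    have : Continuous (compOp G hG.continuous) :=
      ContinuousMap.continuous_postcomp ⟨G, hG.continuous⟩
    exact_mod_cast contDiff_zero.2 this
  | succ n ih =>
    intro F _ _ G hG
    have h1 : ContDiff ℝ 1 G := hG.of_le (by norm_cast; omega)
    have hG' : ContDiff ℝ n (fderiv ℝ G) := hG.fderiv_right (by norm_cast)
    push_cast
    rw [contDiff_succ_iff_hasFDerivAt]
    refine ⟨fun u => applyFam (compOp (fderiv ℝ G) hG'.continuous u), ?_, ?_⟩
    · have hc : ContDiff ℝ n (fun A : C(I01, E →L[ℝ] F) => applyFam (E := E) (F := F) A) := by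
        fun_prop
      exact hc.comp (ih (fderiv ℝ G) hG')
    · exact fun u => compOp_hasFDerivAt G h1 u

variable [CompleteSpace E]

/-- Volterra integration operator. -/
def volt : C(I01, E) →L[ℝ] C(I01, E) :=
  LinearMap.mkContinuous
    { toFun := fun u => ⟨fun s => ∫ τ in (0:ℝ)..(s:ℝ), u (Set.projIcc 0 1 zero_le_one τ), by
        have : Continuous fun x : ℝ => ∫ τ in (0:ℝ)..x, u (Set.projIcc 0 1 zero_le_one τ) :=
          intervalIntegral.continuous_primitive (fun a b => (u.continuous.comp
            continuous_projIcc).intervalIntegrable a b) 0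
        exact this.comp continuous_subtype_val⟩
      map_add' := by
        intro u v
        ext s
        simp only [ContinuousMap.add_apply, ContinuousMap.coe_mk]
        rw [intervalIntegral.integral_add] <;>
          exact (ContinuousMap.continuous _ |>.comp continuous_projIcc).intervalIntegrable _ _
      map_smul' := by
        intro c u
        ext s
        simp }
    1 (by
      intro u
      rw [one_mul]
      refine (ContinuousMap.norm_le _ (by positivity)).2 fun s => ?_
      have := intervalIntegral.norm_integral_le_of_norm_le_const (a := 0) (b := (s:ℝ))
        (f := fun τ => u (Set.projIcc 0 1 zero_le_one τ)) (C := ‖u‖)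
        (fun x _ => u.norm_coe_le_norm _)
      refine this.trans ?_
      have h1 : |(s:ℝ) - 0| ≤ 1 := by
        rw [sub_zero, abs_of_nonneg s.2.1]; exact s.2.2
      nlinarith [norm_nonneg u])

lemma volt_apply (u : C(I01, E)) (s : I01) :
    volt u s = ∫ τ in (0:ℝ)..(s:ℝ), u (Set.projIcc 0 1 zero_le_one τ) := rfl

lemma volt_norm : ‖(volt : C(I01, E) →L[ℝ] C(I01, E))‖ ≤ 1 :=
  LinearMap.mkContinuous_norm_le _ zero_le_one _

end ODE

section ODE2

variable {E : Type} [NormedAddCommGroup E] [NormedSpace ℝ E] [CompleteSpace E]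

lemma isInvertible_id_sub {X : Type} [NormedAddCommGroup X] [NormedSpace ℝ X] [CompleteSpace X]
    (A : X →L[ℝ] X) (hA : ‖A‖ < 1) : (ContinuousLinearMap.id ℝ X - A).IsInvertible := by
  obtain ⟨U, hU⟩ := isUnit_one_sub_of_norm_lt_one hA
  refine ⟨ContinuousLinearEquiv.unitsEquiv ℝ X U, ?_⟩
  ext x
  simp [hU]

lemma volt_le (u : C(I01, E)) : ‖volt u‖ ≤ ‖u‖ := by
  have h := ContinuousLinearMap.le_opNorm (volt : C(I01, E) →L[ℝ] C(I01, E)) u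
  have h2 := volt_norm (E := E)
  have h3 := norm_nonneg u
  nlinarith

/-- A complete flow of the autonomous field `G`. -/
def IsFlow (G : E → E) (φ : ℝ → E → E) : Prop :=
  (∀ z, φ 0 z = z) ∧ ∀ z s, HasDerivAt (fun τ => φ τ z) (G (φ s z)) s

def constCLM : E →L[ℝ] C(I01, E) :=
  LinearMap.mkContinuous
    { toFun := fun z => ContinuousMap.const I01 z
      map_add' := by intros; rfl
      map_smul' := by intros; rfl } 1 (by
        intro z
        rw [one_mul]
        exact (ContinuousMap.norm_le _ (by positivity)).2 fun s => le_rfl)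

def curveOf (φ : ℝ → E → E) (hc : ∀ z, Continuous fun s => φ s z) (p : ℝ × E) : C(I01, E) :=
  ⟨fun σ => φ (p.1 * σ) p.2, (hc p.2).comp (by fun_prop)⟩

def PhiOp (G : E → E) (hG : Continuous G) (q : (ℝ × E) × C(I01, E)) : C(I01, E) :=
  q.2 - constCLM q.1.2 - q.1.1 • volt (compOp G hG q.2)

lemma curveOf_solves {G : E → E} (hG : Continuous G) {φ : ℝ → E → E} (hφ : IsFlow G φ)
    (hc : ∀ z, Continuous fun s => φ s z) (p : ℝ × E) :
    PhiOp G hG (p, curveOf φ hc p) = 0 := by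
  obtain ⟨s, z⟩ := p
  ext σ
  have key : ∫ τ in (0:ℝ)..(σ:ℝ), s • G (φ (s * τ) z) = φ (s * σ) z - φ (s * 0) z := by
    refine intervalIntegral.integral_eq_sub_of_hasDerivAt
      (f := fun τ => φ (s * τ) z) (f' := fun τ => s • G (φ (s * τ) z)) (fun x _ => ?_) ?_
    · have h1 := hφ.2 z (s * x)
      have h2 : HasDerivAt (fun τ : ℝ => s * τ) s x := by
        simpa using (hasDerivAt_id x).const_mul s
      exact h1.scomp x h2
    · refine Continuous.intervalIntegrable ?_ _ _
      exact (hG.comp ((hc z).comp (continuous_const.mul continuous_id))).const_smul s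
  have e2 : volt (compOp G hG (curveOf φ hc (s, z))) σ = ∫ τ in (0:ℝ)..(σ:ℝ), G (φ (s * τ) z) := by
    rw [volt_apply]
    refine intervalIntegral.integral_congr fun τ hτ => ?_
    rw [Set.uIcc_of_le σ.2.1] at hτ
    have : τ ∈ Set.Icc (0:ℝ) 1 := ⟨hτ.1, hτ.2.trans σ.2.2⟩
    simp [compOp, curveOf, Set.projIcc_of_mem zero_le_one this]
  show curveOf φ hc (s, z) σ - z - s • volt (compOp G hG (curveOf φ hc (s, z))) σ = 0
  rw [e2, ← intervalIntegral.integral_smul, key]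
  simp [curveOf, hφ.1]

lemma PhiOp_unique {G : E → E} {K : NNReal} (hG : LipschitzWith K G) (p : ℝ × E)
    (hp : |p.1| * K < 1) (u u' : C(I01, E)) (h : PhiOp G hG.continuous (p, u) = 0)
    (h' : PhiOp G hG.continuous (p, u') = 0) : u = u' := by
  have e : u - u' = p.1 • volt (compOp G hG.continuous u - compOp G hG.continuous u') := by
    simp only [PhiOp] at h h'
    rw [map_sub, smul_sub]
    have h1 := sub_eq_zero.1 h
    have h2 := sub_eq_zero.1 h'
    rw [← h1, ← h2]; abel
  have hn : ‖compOp G hG.continuous u - compOp G hG.continuous u'‖ ≤ K * ‖u - u'‖ := by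
    refine (ContinuousMap.norm_le _ (by positivity)).2 fun s => ?_
    have := hG.dist_le_mul (u s) (u' s)
    rw [dist_eq_norm, dist_eq_norm] at this
    refine this.trans ?_
    have := (u - u').norm_coe_le_norm s
    gcongr
    exact this
  have h3 : ‖u - u'‖ ≤ |p.1| * (K * ‖u - u'‖) := by
    calc ‖u - u'‖ = |p.1| * ‖volt (compOp G hG.continuous u - compOp G hG.continuous u')‖ := by
          conv_lhs => rw [e]
          rw [norm_smul, Real.norm_eq_abs]
      _ ≤ |p.1| * (K * ‖u - u'‖) := by
          gcongr
          exact (volt_le _).trans (by assumption)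
      _ = _ := by ring
  have h4 : ‖u - u'‖ = 0 := by
    by_contra hne
    have : 0 < ‖u - u'‖ := lt_of_le_of_ne (norm_nonneg (u - u')) (Ne.symm hne)
    nlinarith
  exact sub_eq_zero.1 (norm_eq_zero.1 h4)

lemma PhiOp_contDiff {G : E → E} {n : ℕ} (hG : ContDiff ℝ n G) :
    ContDiff ℝ n (PhiOp G hG.continuous) := by
  have h1 := compOp_contDiff n G hG
  have h2 : ContDiff ℝ n (fun q : (ℝ × E) × C(I01, E) => compOp G hG.continuous q.2) :=
    h1.comp contDiff_snd
  unfold PhiOp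
  have h3 : ContDiff ℝ n (fun q : (ℝ × E) × C(I01, E) => volt (compOp G hG.continuous q.2)) := by
    fun_prop
  have h4 : ContDiff ℝ n (fun q : (ℝ × E) × C(I01, E) => constCLM q.1.2) := by fun_prop
  exact (contDiff_snd.sub h4).sub ((contDiff_fst.comp contDiff_fst).smul h3)

lemma flow_contDiffAt_local {G : E → E} {n : ℕ} (hn : n ≠ 0) (hG : ContDiff ℝ n G) {K : NNReal}
    (hK : LipschitzWith K G) {φ : ℝ → E → E} (hφ : IsFlow G φ) (p : ℝ × E)
    (hp : |p.1| * K < 1) : ContDiffAt ℝ n (fun q : ℝ × E => φ q.1 q.2) p := by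
  have hc : ∀ z, Continuous fun s => φ s z := fun z =>
    continuous_iff_continuousAt.2 fun s => (hφ.2 z s).continuousAt
  have hG1 : ContDiff ℝ 1 G := hG.of_le (by norm_cast; omega)
  have hcd := (PhiOp_contDiff hG).contDiffAt (x := (p, curveOf φ hc p))
  have hn' : (n : WithTop ℕ∞) ≠ 0 := by exact_mod_cast hn
  set u0 := curveOf φ hc p with hu0
  let A : C(I01, E) →L[ℝ] C(I01, E) := p.1 • (volt.comp
    (applyFam (compOp (fderiv ℝ G) (hG1.continuous_fderiv one_ne_zero) u0)))
  have hA : HasFDerivAt (fun u => PhiOp G hG.continuous (p, u))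
      (ContinuousLinearMap.id ℝ _ - A) u0 := by
    have h1 := compOp_hasFDerivAt G hG1 u0
    have h2 := (volt.hasFDerivAt.comp u0 h1).const_smul p.1
    exact ((hasFDerivAt_id u0).sub_const (constCLM p.2)).sub h2
  have hcomp : fderiv ℝ (PhiOp G hG.continuous) (p, u0) ∘L .inr ℝ (ℝ × E) C(I01, E)
      = ContinuousLinearMap.id ℝ _ - A := by
    have h1 := (hcd.differentiableAt hn').hasFDerivAt
    exact (h1.comp u0 (hasFDerivAt_prodMk_right p u0)).unique hA
  have hAn : ‖A‖ < 1 := by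
    refine lt_of_le_of_lt ?_ hp
    refine ContinuousLinearMap.opNorm_le_bound _ (by positivity) fun h => ?_
    have h1 : ‖applyFam (compOp (fderiv ℝ G) (hG1.continuous_fderiv one_ne_zero) u0) h‖ ≤ K * ‖h‖ := by
      refine (ContinuousMap.norm_le _ (by positivity)).2 fun s => ?_
      rw [applyFam_apply]
      refine (ContinuousLinearMap.le_opNorm _ _).trans ?_
      have h5 : ‖fderiv ℝ G (u0 s)‖ ≤ K := norm_fderiv_le_of_lipschitz ℝ hK
      exact mul_le_mul h5 (h.norm_coe_le_norm s) (norm_nonneg _) K.2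
    calc ‖A h‖ = |p.1| * ‖volt (applyFam (compOp (fderiv ℝ G) (hG1.continuous_fderiv one_ne_zero) u0) h)‖ := by
          show ‖p.1 • volt _‖ = _
          rw [norm_smul, Real.norm_eq_abs]
          rfl
      _ ≤ |p.1| * (K * ‖h‖) := by
          gcongr
          exact (volt_le _).trans (by assumption)
      _ = _ := by ring
  have hinv : (fderiv ℝ (PhiOp G hG.continuous) (p, u0) ∘L .inr ℝ (ℝ × E) C(I01, E)).IsInvertible := by
    rw [hcomp]
    exact isInvertible_id_sub A hAn
  have hψ := hcd.contDiffAt_implicitFunction hn' hinv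
  have hev := hcd.eventually_apply_implicitFunction hn' hinv
  have hsm : ∀ᶠ q : ℝ × E in 𝓝 p, |q.1| * K < 1 := by
    have : Continuous fun q : ℝ × E => |q.1| * (K:ℝ) := by fun_prop
    exact this.continuousAt.eventually_lt continuousAt_const hp
  have heq : (fun q : ℝ × E => φ q.1 q.2) =ᶠ[𝓝 p]
      fun q => (hcd.implicitFunction hn' hinv q) (1 : I01) := by
    filter_upwards [hev, hsm] with q hq hqs
    rw [curveOf_solves hG.continuous hφ hc p] at hq
    have := PhiOp_unique hK q hqs _ _ hq (curveOf_solves hG.continuous hφ hc q)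
    rw [this]
    simp [curveOf]
  refine ContDiffAt.congr_of_eventuallyEq ?_ heq
  have hev1 : ContDiff ℝ n (fun u : C(I01, E) =>
      ContinuousMap.evalCLM ℝ (1 : I01) u) := by fun_prop
  exact hev1.contDiffAt.comp p hψ

end ODE2

section ODE3

variable {E : Type} [NormedAddCommGroup E] [NormedSpace ℝ E] [CompleteSpace E]

lemma flow_unique {G : E → E} {K : NNReal} (hK : LipschitzWith K G) {f g : ℝ → E}
    (hf : ∀ s, HasDerivAt f (G (f s)) s) (hg : ∀ s, HasDerivAt g (G (g s)) s) (t : ℝ)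
    (h : f t = g t) : f = g :=
  ODE_solution_unique_univ (v := fun _ => G) (s := fun _ => Set.univ) (K := K) (t₀ := t)
    (fun _ => hK.lipschitzOnWith) (fun s => ⟨hf s, trivial⟩) (fun s => ⟨hg s, trivial⟩) h

lemma exists_flow_curve {G : E → E} {K : NNReal} (hK : LipschitzWith K G) {M : NNReal}
    (hM : ∀ z, ‖G z‖ ≤ M) (z : E) : ∃ f : ℝ → E, f 0 = z ∧ ∀ s, HasDerivAt f (G (f s)) s := by
  have hloc : ∀ N : ℕ, ∃ f : ℝ → E, f 0 = z ∧
      ∀ s ∈ Set.Ioo (-(N:ℝ)) N, HasDerivAt f (G (f s)) s := by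
    intro N
    have h0 : (0:ℝ) ∈ Set.Icc (-(N:ℝ)) N := by simp
    have hPL : IsPicardLindelof (fun _ => G) (⟨0, h0⟩ : Set.Icc (-(N:ℝ)) N) z (M * N) 0 M K := by
      refine IsPicardLindelof.of_time_independent (fun x _ => hM x) hK.lipschitzOnWith ?_
      simp
    obtain ⟨f, hf0, hf⟩ := hPL.exists_eq_forall_mem_Icc_hasDerivWithinAt₀
    refine ⟨f, hf0, fun s hs => (hf s (Set.Ioo_subset_Icc_self hs)).hasDerivAt (Icc_mem_nhds hs.1 hs.2)⟩
  choose f hf0 hf using hloc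
  have hagree : ∀ N M : ℕ, N ≤ M → ∀ s ∈ Set.Ioo (-(N:ℝ)) N, f N s = f M s := by
    intro N M hNM s hs
    have hN : (N:ℝ) ≤ M := by exact_mod_cast hNM
    have h0 : (0:ℝ) ∈ Set.Ioo (-(N:ℝ)) N := by
      constructor <;> linarith [hs.1, hs.2]
    exact ODE_solution_unique_of_mem_Ioo (v := fun _ => G) (s := fun _ => Set.univ) (K := K)
      (fun t _ => hK.lipschitzOnWith) h0 (fun t ht => ⟨hf N t ht, trivial⟩)
      (fun t ht => ⟨hf M t ⟨by linarith [ht.1], by linarith [ht.2]⟩, trivial⟩)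
      (by rw [hf0, hf0]) hs
  refine ⟨fun s => f (⌈|s|⌉₊ + 1) s, by simp [hf0], fun s => ?_⟩
  set N := ⌈|s|⌉₊ + 2 with hN
  have hs1 : |s| ≤ ⌈|s|⌉₊ := Nat.le_ceil _
  have hev : (fun s => f (⌈|s|⌉₊ + 1) s) =ᶠ[𝓝 s] f N := by
    have : ∀ᶠ u : ℝ in 𝓝 s, |u| < (⌈|s|⌉₊ : ℝ) + 1 :=
      (continuous_abs.tendsto s).eventually_lt_const (by linarith)
    filter_upwards [this] with u hu
    refine hagree _ _ ?_ u ?_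
    · have : ⌈|u|⌉₊ ≤ ⌈|s|⌉₊ + 1 := Nat.ceil_le.2 (by push_cast; linarith)
      omega
    · have h1 := Nat.le_ceil |u|
      have := abs_le.1 h1
      push_cast
      constructor <;> linarith [this.1, this.2]
  have hmem : s ∈ Set.Ioo (-(N:ℝ)) N := by
    have := abs_le.1 hs1
    rw [hN]; push_cast
    constructor <;> linarith [this.1, this.2]
  have he := hev.eq_of_nhds
  simp only at he ⊢
  rw [he]
  exact (hf N s hmem).congr_of_eventuallyEq hev

lemma exists_flow {G : E → E} {K : NNReal} (hK : LipschitzWith K G) {M : NNReal}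
    (hM : ∀ z, ‖G z‖ ≤ M) : ∃ φ : ℝ → E → E, IsFlow G φ := by
  choose f hf0 hf using exists_flow_curve hK hM
  exact ⟨fun s z => f z s, hf0, fun z s => hf z s⟩

lemma flow_add {G : E → E} {K : NNReal} (hK : LipschitzWith K G) {φ : ℝ → E → E}
    (hφ : IsFlow G φ) (s t : ℝ) (z : E) : φ (s + t) z = φ s (φ t z) := by
  have := flow_unique hK (f := fun s => φ (s + t) z) (g := fun s => φ s (φ t z))
    (fun s => by
      have := (hφ.2 z (s + t)).scomp s ((hasDerivAt_id s).add_const t)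
      simpa [Function.comp_def] using this)
    (fun s => hφ.2 _ s) 0 (by simp [hφ.1])
  exact congrFun this s

lemma flow_contDiff {G : E → E} {n : ℕ} (hn : n ≠ 0) (hG : ContDiff ℝ n G) {K : NNReal}
    (hK : LipschitzWith K G) {φ : ℝ → E → E} (hφ : IsFlow G φ) :
    ContDiff ℝ n (fun q : ℝ × E => φ q.1 q.2) := by
  have key : ∀ N : ℕ, ∀ p : ℝ × E, |p.1| * K < N + 1 →
      ContDiffAt ℝ n (fun q : ℝ × E => φ q.1 q.2) p := by
    intro N
    induction N with
    | zero => intro p hp; exact flow_contDiffAt_local hn hG hK hφ p (by simpa using hp)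
    | succ N ih =>
      intro p hp
      have heq : (fun q : ℝ × E => φ q.1 q.2) =
          fun q : ℝ × E => φ (q.1 / (N + 2)) (φ (q.1 * ((N + 1) / (N + 2))) q.2) := by
        funext q
        rw [← flow_add hK hφ]
        congr 1
        field_simp
        ring
      rw [heq]
      have hNp : (0:ℝ) < N + 2 := by positivity
      push_cast at hp
      have h1 : ContDiffAt ℝ n (fun q : ℝ × E => φ q.1 q.2) (p.1 * ((N + 1) / (N + 2)), p.2) := by
        apply ih
        simp only [abs_mul, abs_div]
        rw [abs_of_pos (show (0:ℝ) < N + 1 by positivity), abs_of_pos hNp]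
        have : |p.1| * ((N + 1) / (N + 2)) * K = (|p.1| * K) * (N + 1) / (N + 2) := by ring
        rw [this, div_lt_iff₀ hNp]
        nlinarith [show (0:ℝ) ≤ N by positivity]
      have h2 : ContDiffAt ℝ n (fun q : ℝ × E => φ q.1 q.2)
          (p.1 / (N + 2), φ (p.1 * ((N + 1) / (N + 2))) p.2) := by
        apply flow_contDiffAt_local hn hG hK hφ
        simp only [abs_div]
        rw [abs_of_pos hNp, div_mul_eq_mul_div, div_lt_one hNp]
        linarith
      have h3 : ContDiffAt ℝ n (fun q : ℝ × E => φ (q.1 * ((N + 1) / (N + 2))) q.2) p :=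
        h1.comp p (f := fun q : ℝ × E => (q.1 * (((N:ℝ) + 1) / (N + 2)), q.2)) (by fun_prop)
      exact h2.comp p (f := fun q : ℝ × E => (q.1 / ((N:ℝ) + 2), φ (q.1 * ((N + 1) / (N + 2))) q.2))
        ((by fun_prop : ContDiffAt ℝ n (fun q : ℝ × E => q.1 / ((N:ℝ) + 2)) p).prodMk h3)
  rw [contDiff_iff_contDiffAt]
  intro p
  obtain ⟨N, hN⟩ := exists_nat_gt (|p.1| * K)
  exact key N p (by linarith)

end ODE3

section ODE4

variable {E : Type} [NormedAddCommGroup E] [NormedSpace ℝ E] [FiniteDimensional ℝ E]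

lemma exists_cutoff {J : Set ℝ} (hJo : IsOpen J) (hJc : J.OrdConnected) {F : ℝ → E → E}
    (hF : ContDiffOn ℝ 2 (fun p : ℝ × E => F p.1 p.2) (J ×ˢ Set.univ)) {a b : ℝ}
    (hab : a ≤ b) (ha : a ∈ J) (hb : b ∈ J) (R : ℝ) :
    ∃ χ : ℝ → E → ℝ, (∀ t z, 0 ≤ χ t z ∧ χ t z ≤ 1) ∧
      (∀ t ∈ Set.Icc a b, ∀ z, ‖z‖ ≤ R → χ t z = 1) ∧
      ContDiff ℝ 2 (fun p : ℝ × E => χ p.1 p.2 • F p.1 p.2) ∧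
      HasCompactSupport (fun p : ℝ × E => χ p.1 p.2 • F p.1 p.2) := by
  have hIcc : Set.Icc a b ⊆ J := hJc.out ha hb
  obtain ⟨δ, hδ, hδJ⟩ : ∃ δ > 0, Metric.cthickening δ (Set.Icc a b) ⊆ J :=
    isCompact_Icc.exists_cthickening_subset_open hJo hIcc
  let c : ℝ := (a + b) / 2
  let β : ContDiffBump c := ⟨(b - a) / 2 + δ / 3, (b - a) / 2 + δ / 2, by linarith, by linarith⟩
  let ζ : ContDiffBump (0 : E) := ⟨|R| + 1, |R| + 2, by positivity, by linarith⟩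
  have hβJ : tsupport β ⊆ J := by
    rw [β.tsupport_eq]
    refine subset_trans ?_ hδJ
    intro t ht
    rw [Metric.mem_closedBall, Real.dist_eq, abs_le] at ht
    simp only [c, β] at ht
    have : dist t (max a (min t b)) ≤ δ := by
      rw [Real.dist_eq, abs_le]
      rcases le_total t b with h | h
      · rw [min_eq_left h]
        rcases le_total a t with h' | h'
        · rw [max_eq_right h']; constructor <;> linarith
        · rw [max_eq_left h']; constructor <;> linarith
      · rw [min_eq_right h, max_eq_right hab]; constructor <;> linarith
    exact Metric.mem_cthickening_of_dist_le _ _ _ _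
      (by constructor; exact le_max_left _ _; exact max_le hab (min_le_right _ _)) this
  have hcompact : HasCompactSupport (fun p : ℝ × E => β p.1 * ζ p.2) := by
    refine HasCompactSupport.of_support_subset_isCompact
      (β.hasCompactSupport.isCompact.prod ζ.hasCompactSupport.isCompact) ?_
    intro p hp
    rw [Function.mem_support] at hp
    exact ⟨subset_tsupport _ (left_ne_zero_of_mul hp), subset_tsupport _ (right_ne_zero_of_mul hp)⟩
  refine ⟨fun t z => β t * ζ z, fun t z => ⟨mul_nonneg β.nonneg ζ.nonneg,
    mul_le_one₀ β.le_one ζ.nonneg ζ.le_one⟩, ?_, ?_, hcompact.smul_right⟩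
  · intro t ht z hz
    have h1 : β t = 1 := by
      apply β.one_of_mem_closedBall
      rw [Metric.mem_closedBall, Real.dist_eq, abs_le]
      simp only [c, β]
      constructor <;> linarith [ht.1, ht.2]
    have h2 : ζ z = 1 := by
      apply ζ.one_of_mem_closedBall
      simp only [mem_closedBall_zero_iff, ζ]
      linarith [le_abs_self R]
    simp [h1, h2]
  · rw [contDiff_iff_contDiffAt]
    intro p
    by_cases hp : p.1 ∈ J
    · have h1 : ContDiffAt ℝ 2 (fun p : ℝ × E => β p.1 * ζ p.2) p :=
        ((β.contDiff.comp contDiff_fst).mul (ζ.contDiff.comp contDiff_snd)).contDiffAt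
      exact h1.smul (hF.contDiffAt ((hJo.prod isOpen_univ).mem_nhds ⟨hp, trivial⟩))
    · have : (fun p : ℝ × E => (β p.1 * ζ p.2) • F p.1 p.2) =ᶠ[𝓝 p] fun _ => 0 := by
        have hc : (tsupport β)ᶜ ∈ 𝓝 p.1 :=
          (isClosed_tsupport _).isOpen_compl.mem_nhds (fun h => hp (hβJ h))
        filter_upwards [continuousAt_fst.preimage_mem_nhds hc] with u hu
        have : β u.1 = 0 := image_eq_zero_of_notMem_tsupport hu
        simp [this]
      exact contDiffAt_const.congr_of_eventuallyEq this

/-- A priori bounds for (damped) integral curves. -/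
def APriori (J : Set ℝ) (F : ℝ → E → E) : Prop :=
  ∀ a ∈ J, ∀ b ∈ J, ∀ r : ℝ, ∃ R : ℝ, ∀ (γ : ℝ → E) (c : ℝ → ℝ), ∀ t₀ ∈ Set.Icc a b,
    (∀ s ∈ Set.Icc a b, 0 ≤ c s ∧ c s ≤ 1 ∧ HasDerivAt γ (c s • F s (γ s)) s) →
    ‖γ t₀‖ ≤ r → ∀ s ∈ Set.Icc a b, ‖γ s‖ ≤ R

lemma curve_unique {J : Set ℝ} (hJo : IsOpen J) (hJc : J.OrdConnected) {F : ℝ → E → E}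
    (hF : ContDiffOn ℝ 2 (fun p : ℝ × E => F p.1 p.2) (J ×ˢ Set.univ)) {a b : ℝ}
    (ha : a ∈ J) (hb : b ∈ J) {f g : ℝ → E} {t : ℝ} (ht : t ∈ Set.Icc a b)
    (hf : ∀ s ∈ Set.Icc a b, HasDerivAt f (F s (f s)) s)
    (hg : ∀ s ∈ Set.Icc a b, HasDerivAt g (F s (g s)) s) (h : f t = g t) :
    ∀ s ∈ Set.Icc a b, f s = g s := by
  have hfc : ContinuousOn f (Set.Icc a b) := fun s hs => (hf s hs).continuousAt.continuousWithinAt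
  have hgc : ContinuousOn g (Set.Icc a b) := fun s hs => (hg s hs).continuousAt.continuousWithinAt
  obtain ⟨R1, hR1⟩ := isCompact_Icc.exists_bound_of_continuousOn hfc
  obtain ⟨R2, hR2⟩ := isCompact_Icc.exists_bound_of_continuousOn hgc
  obtain ⟨χ, -, hχ1, hH, hHc⟩ := exists_cutoff hJo hJc hF (ht.1.trans ht.2) ha hb (max R1 R2)
  obtain ⟨K, hK⟩ := ContDiff.lipschitzWith_of_hasCompactSupport hHc hH (by norm_num)
  have hlip : ∀ t, LipschitzOnWith K (fun z => χ t z • F t z) Set.univ := by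
    intro t
    have := hK.comp (LipschitzWith.prodMk_left t)
    rw [mul_one] at this
    exact LipschitzWith.lipschitzOnWith (f := fun z => χ t z • F t z) this
  have hf' : ∀ s ∈ Set.Icc a b, HasDerivAt f (χ s (f s) • F s (f s)) s := by
    intro s hs
    rw [hχ1 s hs _ ((hR1 s hs).trans (le_max_left _ _)), one_smul]; exact hf s hs
  have hg' : ∀ s ∈ Set.Icc a b, HasDerivAt g (χ s (g s) • F s (g s)) s := by
    intro s hs
    rw [hχ1 s hs _ ((hR2 s hs).trans (le_max_right _ _)), one_smul]; exact hg s hs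
  have hsub1 : Set.Icc a t ⊆ Set.Icc a b := Set.Icc_subset_Icc_right ht.2
  have hsub2 : Set.Icc t b ⊆ Set.Icc a b := Set.Icc_subset_Icc_left ht.1
  intro s hs
  rcases le_total s t with hst | hst
  · exact ODE_solution_unique_of_mem_Icc_left (v := fun t z => χ t z • F t z)
      (s := fun _ => Set.univ) (fun t _ => hlip t) (hfc.mono hsub1)
      (fun u hu => (hf' u (hsub1 (Set.Ioc_subset_Icc_self hu))).hasDerivWithinAt) (fun _ _ => trivial)
      (hgc.mono hsub1)
      (fun u hu => (hg' u (hsub1 (Set.Ioc_subset_Icc_self hu))).hasDerivWithinAt) (fun _ _ => trivial)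
      h ⟨hs.1, hst⟩
  · exact ODE_solution_unique_of_mem_Icc_right (v := fun t z => χ t z • F t z)
      (s := fun _ => Set.univ) (fun t _ => hlip t) (hfc.mono hsub2)
      (fun u hu => (hf' u (hsub2 (Set.Ico_subset_Icc_self hu))).hasDerivWithinAt) (fun _ _ => trivial)
      (hgc.mono hsub2)
      (fun u hu => (hg' u (hsub2 (Set.Ico_subset_Icc_self hu))).hasDerivWithinAt) (fun _ _ => trivial)
      h ⟨hst, hs.2⟩

lemma local_flow {J : Set ℝ} (hJo : IsOpen J) (hJc : J.OrdConnected) {F : ℝ → E → E}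
    (hF : ContDiffOn ℝ 2 (fun p : ℝ × E => F p.1 p.2) (J ×ˢ Set.univ)) (hA : APriori J F) {a b : ℝ}
    (hab : a ≤ b) (ha : a ∈ J) (hb : b ∈ J) (r : ℝ) :
    ∃ W : ℝ → ℝ → E → E, (∀ t z, W t t z = z) ∧
      ContDiff ℝ 2 (fun p : ℝ × ℝ × E => W p.1 p.2.1 p.2.2) ∧
      ∀ t ∈ Set.Icc a b, ∀ z, ‖z‖ ≤ r → ∀ s ∈ Set.Icc a b,
        HasDerivAt (fun τ => W τ t z) (F s (W s t z)) s := by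
  obtain ⟨R, hR⟩ := hA a ha b hb r
  obtain ⟨χ, hχ0, hχ1, hH, hHc⟩ := exists_cutoff hJo hJc hF hab ha hb R
  obtain ⟨K, hK⟩ := ContDiff.lipschitzWith_of_hasCompactSupport hHc hH (by norm_num)
  obtain ⟨B, hB⟩ := hHc.exists_bound_of_continuous hH.continuous
  let G : ℝ × E → ℝ × E := fun p => (1, χ p.1 p.2 • F p.1 p.2)
  have hG : ContDiff ℝ (2:ℕ) G := contDiff_const.prodMk (by exact_mod_cast hH)
  have hGK : LipschitzWith (max 0 K) G := (LipschitzWith.const (1:ℝ)).prodMk hK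
  have hGB : ∀ p, ‖G p‖ ≤ (max 1 (Real.toNNReal B) : NNReal) := by
    intro p
    simp only [G, Prod.norm_def]
    push_cast
    refine max_le (by simp) ((hB p).trans ((le_coe_toNNReal B).trans (le_max_right _ _)))
  obtain ⟨φ, hφ⟩ := exists_flow hGK hGB
  have hφC := flow_contDiff (by norm_num) hG hGK hφ
  have hfst : ∀ s p, (φ s p).1 = p.1 + s := by
    intro s p
    have h1 : ∀ s, HasDerivAt (fun τ => (φ τ p).1 - τ) 0 s := by
      intro s
      have h0 : HasDerivAt (fun τ => (φ τ p).1) 1 s :=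
        (ContinuousLinearMap.fst ℝ ℝ E).hasFDerivAt.comp_hasDerivAt s (hφ.2 p s)
      have h1 := h0.sub (hasDerivAt_id' s)
      rw [sub_self] at h1
      exact h1
    have h2 := is_const_of_deriv_eq_zero (fun s => (h1 s).differentiableAt) (fun s => (h1 s).deriv) s 0
    simp only [hφ.1, sub_zero] at h2
    linarith
  refine ⟨fun s t z => (φ (s - t) (t, z)).2, fun t z => by simp [hφ.1], ?_, ?_⟩
  · have := hφC.comp (f := fun p : ℝ × ℝ × E => (p.1 - p.2.1, (p.2.1, p.2.2)))
      (g := fun q : ℝ × (ℝ × E) => φ q.1 q.2) (by fun_prop)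
    exact_mod_cast contDiff_snd.comp this
  · intro t ht z hz
    have hd : ∀ s, HasDerivAt (fun τ => (φ (τ - t) (t, z)).2)
        (χ s (φ (s - t) (t, z)).2 • F s (φ (s - t) (t, z)).2) s := by
      intro s
      have h0 : HasDerivAt (fun τ => φ (τ - t) (t, z)) (G (φ (s - t) (t, z))) s :=
        (hφ.2 (t, z) (s - t)).comp_sub_const s t
      have h1 : HasDerivAt (fun τ => (φ (τ - t) (t, z)).2) (G (φ (s - t) (t, z))).2 s :=
        (ContinuousLinearMap.snd ℝ ℝ E).hasFDerivAt.comp_hasDerivAt s h0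
      simpa [G, hfst] using h1
    intro s hs
    have hb := hR (fun τ => (φ (τ - t) (t, z)).2) (fun s => χ s (φ (s - t) (t, z)).2) t ht
      (fun s _ => ⟨(hχ0 _ _).1, (hχ0 _ _).2, hd s⟩) (by simpa [hφ.1] using hz) s hs
    have := hd s
    rwa [hχ1 s hs _ hb, one_smul] at this

theorem exists_td_flow {J : Set ℝ} (hJo : IsOpen J) (hJc : J.OrdConnected) {F : ℝ → E → E}
    (hF : ContDiffOn ℝ 2 (fun p : ℝ × E => F p.1 p.2) (J ×ˢ Set.univ)) (hA : APriori J F) :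
    ∃ Z : ℝ → ℝ → E → E, (∀ t z, Z t t z = z) ∧
      (∀ t ∈ J, ∀ z, ∀ s ∈ J, HasDerivAt (fun τ => Z τ t z) (F s (Z s t z)) s) ∧
      (∀ s ∈ J, ContDiffOn ℝ 2 (fun p : ℝ × E => Z s p.1 p.2) (J ×ˢ Set.univ)) := by
  have hch : ∀ (a b r : ℝ), ∃ W : ℝ → ℝ → E → E, (∀ t z, W t t z = z) ∧ (a ≤ b → a ∈ J → b ∈ J →
      ContDiff ℝ 2 (fun p : ℝ × ℝ × E => W p.1 p.2.1 p.2.2) ∧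
      ∀ t ∈ Set.Icc a b, ∀ z, ‖z‖ ≤ r → ∀ s ∈ Set.Icc a b,
        HasDerivAt (fun τ => W τ t z) (F s (W s t z)) s) := by
    intro a b r
    by_cases h : a ≤ b ∧ a ∈ J ∧ b ∈ J
    · obtain ⟨W, h1, h2, h3⟩ := local_flow hJo hJc hF hA h.1 h.2.1 h.2.2 r
      exact ⟨W, h1, fun _ _ _ => ⟨h2, h3⟩⟩
    · exact ⟨fun _ _ z => z, fun _ _ => rfl, fun h1 h2 h3 => absurd ⟨h1, h2, h3⟩ h⟩
  choose W hW0 hW using hch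
  let Z : ℝ → ℝ → E → E := fun s t z => W (min s t) (max s t) ‖z‖ s t z
  have hagree : ∀ a ∈ J, ∀ b ∈ J, ∀ r, ∀ t ∈ Set.Icc a b, ∀ z, ‖z‖ ≤ r → ∀ s ∈ Set.Icc a b,
      Z s t z = W a b r s t z := by
    intro a ha b hb r t ht z hz s hs
    have hsJ : s ∈ J := hJc.out ha hb hs
    have htJ : t ∈ J := hJc.out ha hb ht
    have hm : min s t ∈ J := by rcases min_choice s t with h | h <;> rw [h] <;> assumption
    have hM : max s t ∈ J := by rcases max_choice s t with h | h <;> rw [h] <;> assumption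
    have htm : t ∈ Set.Icc (min s t) (max s t) := ⟨min_le_right _ _, le_max_right _ _⟩
    have hsm : s ∈ Set.Icc (min s t) (max s t) := ⟨min_le_left _ _, le_max_left _ _⟩
    have hsub : Set.Icc (min s t) (max s t) ⊆ Set.Icc a b :=
      Set.Icc_subset_Icc (le_min hs.1 ht.1) (max_le hs.2 ht.2)
    exact curve_unique hJo hJc hF hm hM (f := fun τ => W (min s t) (max s t) ‖z‖ τ t z)
      (g := fun τ => W a b r τ t z) htm
      ((hW _ _ _ min_le_max hm hM).2 t htm z le_rfl)
      (fun u hu => (hW a b r (ht.1.trans ht.2) ha hb).2 t ht z hz u (hsub hu)) (by simp only [hW0]) s hsm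
  have hnb : ∀ u ∈ J, ∀ v ∈ J, ∃ a ∈ J, ∃ b ∈ J, a < b ∧ Set.Icc a b ∈ 𝓝 u ∧ v ∈ Set.Icc a b := by
    intro u hu v hv
    obtain ⟨ε, hε, hεJ⟩ := Metric.isOpen_iff.1 hJo u hu
    have h1 : u - ε / 2 ∈ J := hεJ (by rw [Metric.mem_ball, Real.dist_eq, abs_lt]; constructor <;> linarith)
    have h2 : u + ε / 2 ∈ J := hεJ (by rw [Metric.mem_ball, Real.dist_eq, abs_lt]; constructor <;> linarith)
    refine ⟨min (u - ε/2) v, ?_, max (u + ε/2) v, ?_, ?_, Icc_mem_nhds ?_ ?_, min_le_right _ _, le_max_right _ _⟩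
    · rcases min_choice (u - ε/2) v with h | h <;> rw [h] <;> assumption
    · rcases max_choice (u + ε/2) v with h | h <;> rw [h] <;> assumption
    · exact (min_le_left _ _).trans_lt (lt_of_lt_of_le (by linarith) (le_max_left _ _))
    · exact (min_le_left _ _).trans_lt (by linarith)
    · exact lt_of_lt_of_le (by linarith) (le_max_left _ _)
  refine ⟨Z, fun t z => hW0 _ _ _ _ _, ?_, ?_⟩
  · intro t ht z s hs
    obtain ⟨a, ha, b, hb, hab, hn, hv⟩ := hnb s hs t ht
    have hev : (fun τ => Z τ t z) =ᶠ[𝓝 s] fun τ => W a b ‖z‖ τ t z := by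
      filter_upwards [hn] with u hu
      exact hagree a ha b hb _ t hv z le_rfl u hu
    have := (hW a b ‖z‖ hab.le ha hb).2 t hv z le_rfl s (mem_of_mem_nhds hn)
    rw [show Z s t z = W a b ‖z‖ s t z from hev.eq_of_nhds]
    exact this.congr_of_eventuallyEq hev
  · intro s hs p hp
    obtain ⟨a, ha, b, hb, hab, hn, hv⟩ := hnb p.1 hp.1 s hs
    have hev : (fun q : ℝ × E => Z s q.1 q.2) =ᶠ[𝓝 p] fun q => W a b (‖p.2‖ + 1) s q.1 q.2 := by
      have h2 : ∀ᶠ q : ℝ × E in 𝓝 p, ‖q.2‖ < ‖p.2‖ + 1 :=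
        (continuous_snd.norm.tendsto p).eventually_lt_const (by linarith)
      filter_upwards [continuousAt_fst.preimage_mem_nhds hn, h2] with q hq1 hq2
      exact hagree a ha b hb _ _ hq1 _ hq2.le s hv
    have h3 : ContDiff ℝ 2 (fun q : ℝ × E => W a b (‖p.2‖ + 1) s q.1 q.2) :=
      (hW a b (‖p.2‖ + 1) hab.le ha hb).1.comp (f := fun q : ℝ × E => (s, q.1, q.2)) (by fun_prop)
    exact (h3.contDiffAt.congr_of_eventuallyEq hev).contDiffWithinAt

end ODE4

section ParamInt

variable {P G F : Type} [NormedAddCommGroup P] [NormedSpace ℝ P] [NormedAddCommGroup G]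
  [NormedSpace ℝ G] [MeasurableSpace G] [BorelSpace G] [NormedAddCommGroup F] [NormedSpace ℝ F]
  [CompleteSpace F]

lemma contDiffOn_param_integral {μ : Measure G} {h : G → ℝ} (hh : LocallyIntegrable h μ)
    {s : Set P} (hs : IsOpen s) {g : P → G → F}
    (hg : ContDiffOn ℝ 2 (fun q : P × G => g q.1 q.2) (s ×ˢ Set.univ))
    (hK : ∀ p ∈ s, ∃ U ∈ 𝓝 p, ∃ K : Set G, IsCompact K ∧ ∀ p' ∈ U, ∀ x, x ∉ K → g p' x = 0) :
    ContDiffOn ℝ 2 (fun p => ∫ x, h x • g p x ∂μ) s := by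
  intro p hp
  obtain ⟨U, hU, K, hKc, hKz⟩ := hK p hp
  obtain ⟨U', hU'U, hU'o, hpU'⟩ := mem_nhds_iff.1 hU
  have hso : IsOpen (s ∩ U') := hs.inter hU'o
  have hg' : ContDiffOn ℝ ((2 : ℕ∞)) (fun q : P × G => g q.1 (-q.2)) ((s ∩ U') ×ˢ Set.univ) := by
    have := hg.comp (f := fun q : P × G => (q.1, -q.2)) (s := (s ∩ U') ×ˢ Set.univ) (by fun_prop)
      (fun q hq => ⟨hq.1.1, trivial⟩)
    exact_mod_cast this
  have hc := contDiffOn_convolution_right_with_param_comp (μ := μ) (f := h)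
    (ContinuousLinearMap.lsmul ℝ ℝ : ℝ →L[ℝ] F →L[ℝ] F)
    (v := fun _ : P => (0 : G)) (g := fun p x => g p (-x)) contDiffOn_const hso (k := -K) hKc.neg
    (fun p x hp hx => hKz p (hU'U hp.2) _ (by simpa using hx)) hh hg'
  have heq : (fun x => (MeasureTheory.convolution h (fun y => g x (-y))
      (ContinuousLinearMap.lsmul ℝ ℝ : ℝ →L[ℝ] F →L[ℝ] F) μ) 0) =
      fun p => ∫ x, h x • g p x ∂μ := by
    funext x
    simp [MeasureTheory.convolution_def]
  have hc' : ContDiffOn ℝ 2 (fun p => ∫ x, h x • g p x ∂μ) (s ∩ U') := by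
    rw [← heq]; exact_mod_cast hc
  exact (hc'.contDiffAt (hso.mem_nhds ⟨hp, hpU'⟩)).contDiffWithinAt

lemma contDiffOn_integral_of_compact {μ : Measure G} [IsLocallyFiniteMeasure μ]
    {s : Set P} (hs : IsOpen s) {g : P → G → F}
    (hg : ContDiffOn ℝ 2 (fun q : P × G => g q.1 q.2) (s ×ˢ Set.univ))
    (hK : ∀ p ∈ s, ∃ U ∈ 𝓝 p, ∃ K : Set G, IsCompact K ∧ ∀ p' ∈ U, ∀ x, x ∉ K → g p' x = 0) :
    ContDiffOn ℝ 2 (fun p => ∫ x, g p x ∂μ) s := by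
  have := contDiffOn_param_integral (μ := μ) (h := fun _ => (1:ℝ))
    (locallyIntegrable_const 1) hs hg hK
  simpa using this

lemma contDiffOn_unit_integral {s : Set P} (hs : IsOpen s) {g : P → ℝ → F}
    (hg : ContDiffOn ℝ 2 (fun q : P × ℝ => g q.1 q.2) (s ×ˢ Set.univ)) :
    ContDiffOn ℝ 2 (fun p => ∫ σ in (0:ℝ)..1, g p σ) s := by
  let β : ContDiffBump (0:ℝ) := ⟨2, 3, by norm_num, by norm_num⟩
  have h1 := contDiffOn_param_integral (μ := volume)
    (h := (Set.Ioc (0:ℝ) 1).indicator (fun _ => (1:ℝ)))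
    (((integrableOn_const (by simp) (by simp)).integrable_indicator measurableSet_Ioc).locallyIntegrable)
    hs (g := fun p σ => β σ • g p σ)
    (ContDiffOn.smul (β.contDiff.comp contDiff_snd).contDiffOn hg)
    (fun p _ => ⟨Set.univ, univ_mem, tsupport β, β.hasCompactSupport, fun p' _ x hx => by
      rw [image_eq_zero_of_notMem_tsupport hx, zero_smul]⟩)
  refine h1.congr (fun p hp => ?_)
  rw [intervalIntegral.integral_of_le zero_le_one, ← MeasureTheory.integral_indicator measurableSet_Ioc]
  congr 1
  funext σ
  by_cases hσ : σ ∈ Set.Ioc (0:ℝ) 1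
  · rw [Set.indicator_of_mem hσ, Set.indicator_of_mem hσ, one_smul, β.one_of_mem_closedBall, one_smul]
    simp only [mem_closedBall_zero_iff, Real.norm_eq_abs, β]
    rw [abs_of_pos hσ.1]; linarith [hσ.2]
  · rw [Set.indicator_of_notMem hσ, Set.indicator_of_notMem hσ, zero_smul]

end ParamInt

section Geometry

lemma act_inner {A : Matrix (Fin 3) (Fin 3) ℝ} (hA : SO3 A) (x y : E3) :
    (inner ℝ (act A x) (act A y) : ℝ) = inner ℝ x y := by
  have h := hA.1
  have e : ∀ i j, ∑ k, A k i * A k j = if i = j then 1 else 0 := by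
    intro i j
    have := congrFun (congrFun h i) j
    simpa [Matrix.mul_apply, Matrix.one_apply] using this
  have e00 := e 0 0; have e01 := e 0 1; have e02 := e 0 2
  have e11 := e 1 1; have e12 := e 1 2; have e22 := e 2 2
  simp [Fin.sum_univ_three] at e00 e01 e02 e11 e12 e22
  simp only [act, PiLp.inner_apply, Fin.sum_univ_three, RCLike.inner_apply, conj_trivial]
  linear_combination (x 0 * y 0) * e00 + (x 0 * y 1 + x 1 * y 0) * e01 +
    (x 0 * y 2 + x 2 * y 0) * e02 + (x 1 * y 1) * e11 + (x 1 * y 2 + x 2 * y 1) * e12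
    + (x 2 * y 2) * e22

def actL (A : Matrix (Fin 3) (Fin 3) ℝ) : E3 →ₗ[ℝ] E3 where
  toFun := act A
  map_add' x y := by
    ext i; simp [act, mul_add, Finset.sum_add_distrib]
  map_smul' c x := by
    ext i; simp [act, Finset.mul_sum, mul_left_comm]

def rotI (A : Matrix (Fin 3) (Fin 3) ℝ) (hA : SO3 A) : E3 →ₗᵢ[ℝ] E3 where
  toLinearMap := actL A
  norm_map' x := by
    have := act_inner hA x x
    rw [real_inner_self_eq_norm_sq, real_inner_self_eq_norm_sq] at this
    exact (pow_left_inj₀ (norm_nonneg _) (norm_nonneg _) two_ne_zero).1 this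

def rot (A : Matrix (Fin 3) (Fin 3) ℝ) (hA : SO3 A) : E3 ≃ₗᵢ[ℝ] E3 :=
  (rotI A hA).toLinearIsometryEquiv rfl

@[simp] lemma rot_apply {A : Matrix (Fin 3) (Fin 3) ℝ} (hA : SO3 A) (x : E3) :
    rot A hA x = act A x := rfl

lemma act_norm {A : Matrix (Fin 3) (Fin 3) ℝ} (hA : SO3 A) (x : E3) : ‖act A x‖ = ‖x‖ := by
  rw [← rot_apply hA]; exact (rot A hA).norm_map x

lemma act_smul (A : Matrix (Fin 3) (Fin 3) ℝ) (c : ℝ) (x : E3) : act A (c • x) = c • act A x :=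
  (actL A).map_smul c x

lemma act_add (A : Matrix (Fin 3) (Fin 3) ℝ) (x y : E3) : act A (x + y) = act A x + act A y :=
  (actL A).map_add x y

lemma act_zero (A : Matrix (Fin 3) (Fin 3) ℝ) : act A 0 = 0 := (actL A).map_zero

lemma act_eq_zero {A : Matrix (Fin 3) (Fin 3) ℝ} (hA : SO3 A) (x : E3) : act A x = 0 ↔ x = 0 := by
  rw [← norm_eq_zero, act_norm hA, norm_eq_zero]

lemma w_act {A : Matrix (Fin 3) (Fin 3) ℝ} (hA : SO3 A) (x : E3) : w (act A x) = w x := by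
  simp [w, act_norm hA]

lemma integral_act {F : Type} [NormedAddCommGroup F] [NormedSpace ℝ F]
    {A : Matrix (Fin 3) (Fin 3) ℝ} (hA : SO3 A) (g : E3 → F) :
    ∫ v, g (act A v) = ∫ v, g v :=
  (rot A hA).measurePreserving.integral_comp (rot A hA).toHomeomorph.measurableEmbedding g

lemma act_integral {A : Matrix (Fin 3) (Fin 3) ℝ} (hA : SO3 A) (g : E3 → E3) :
    ∫ v, act A (g v) = act A (∫ v, g v) :=
  (rot A hA).toContinuousLinearEquiv.integral_comp_comm g

lemma so3_d1 : SO3 (!![1, 0, 0; 0, -1, 0; 0, 0, -1] : Matrix (Fin 3) (Fin 3) ℝ) := by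
  refine ⟨?_, by simp [Matrix.det_fin_three]⟩
  ext i j; fin_cases i <;> fin_cases j <;> simp [Matrix.mul_apply, Fin.sum_univ_three]

lemma so3_d2 : SO3 (!![-1, 0, 0; 0, -1, 0; 0, 0, 1] : Matrix (Fin 3) (Fin 3) ℝ) := by
  refine ⟨?_, by simp [Matrix.det_fin_three]⟩
  ext i j; fin_cases i <;> fin_cases j <;> simp [Matrix.mul_apply, Fin.sum_univ_three]

lemma so3_one : SO3 (1 : Matrix (Fin 3) (Fin 3) ℝ) := by
  refine ⟨by simp, by simp⟩

lemma act_d1_pt (r : ℝ) : act !![1, 0, 0; 0, -1, 0; 0, 0, -1] (pt r) = pt r := by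
  ext i; fin_cases i <;> simp [act, pt, Fin.sum_univ_three]

lemma act_d2_pt (r : ℝ) : act !![-1, 0, 0; 0, -1, 0; 0, 0, 1] (pt r) = pt (-r) := by
  ext i; fin_cases i <;> simp [act, pt, Fin.sum_univ_three]

lemma norm_pt (r : ℝ) : ‖pt r‖ = |r| := by simp [pt]

lemma pt_zero : pt 0 = 0 := by simp [pt]

lemma pt_smul (c r : ℝ) : c • pt r = pt (c * r) := by
  ext i; fin_cases i <;> simp [pt]

lemma pt_apply_zero (r : ℝ) : pt r 0 = r := by simp [pt]

lemma inner_pt (r : ℝ) (v : E3) : (inner ℝ (pt r) v : ℝ) = r * v 0 := by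
  simp [pt, PiLp.inner_apply, Fin.sum_univ_three, mul_comm]

lemma contDiff_pt {n : WithTop ℕ∞} : ContDiff ℝ n pt := by
  have : pt = fun r : ℝ => r • pt 1 := by funext r; rw [pt_smul, mul_one]
  rw [this]; fun_prop

lemma exists_rot (x : E3) : ∃ A, SO3 A ∧ act A (pt ‖x‖) = x := by
  by_cases hx : x = 0
  · subst hx; exact ⟨1, so3_one, by rw [norm_zero, pt_zero, act_zero]⟩
  have hr : 0 < ‖x‖ := norm_pos_iff.2 hx
  have hr2 : ‖x‖ ^ 2 = x 0 ^ 2 + x 1 ^ 2 + x 2 ^ 2 := by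
    rw [EuclideanSpace.norm_sq_eq]; simp [Fin.sum_univ_three]
  set r := ‖x‖ with hrdef
  set a := x 0 with ha
  set b := x 1 with hb
  set c := x 2 with hc
  by_cases hd : b ^ 2 + c ^ 2 = 0
  · have hb0 : b = 0 := by nlinarith [sq_nonneg b, sq_nonneg c]
    have hc0 : c = 0 := by nlinarith [sq_nonneg b, sq_nonneg c]
    have : (a - r) * (a + r) = 0 := by rw [hb0, hc0] at hr2; nlinarith
    rcases mul_eq_zero.1 this with h | h
    · refine ⟨1, so3_one, ?_⟩
      ext i
      fin_cases i
      · simp [act, pt]; linarith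
      · simp [act, pt]; linarith
      · simp [act, pt]; linarith
    · refine ⟨_, so3_d2, ?_⟩
      rw [act_d2_pt]
      ext i
      fin_cases i
      · simp [pt]; linarith
      · simp [pt]; linarith
      · simp [pt]; linarith
  · have hdp : 0 < b ^ 2 + c ^ 2 := lt_of_le_of_ne (by positivity) (Ne.symm hd)
    set d := Real.sqrt (b ^ 2 + c ^ 2) with hdd
    have hd0 : 0 < d := Real.sqrt_pos.2 hdp
    have hd2 : d ^ 2 = b ^ 2 + c ^ 2 := Real.sq_sqrt hdp.le
    have hr2' : r ^ 2 = a ^ 2 + d ^ 2 := by rw [hd2]; linarith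
    have hc2 : c ^ 2 = d ^ 2 - b ^ 2 := by linarith
    have ha2 : a ^ 2 = r ^ 2 - d ^ 2 := by linarith
    refine ⟨!![a / r, 0, d / r; b / r, -c / d, -(a * b) / (r * d); c / r, b / d, -(a * c) / (r * d)],
      ⟨?_, ?_⟩, ?_⟩
    · have hr0 := hr.ne'
      have hd0' := hd0.ne'
      ext i j
      fin_cases i <;> fin_cases j <;>
        simp [Matrix.mul_apply, Fin.sum_univ_three, Matrix.one_apply] <;> field_simp <;>
        first | (ring; done) | (ring_nf; simp only [hc2, ha2]; ring)
    · rw [Matrix.det_fin_three]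
      have hr0 := hr.ne'
      have hd0' := hd0.ne'
      simp
      field_simp
      linear_combination (a^2 + d^2) * hd2.symm - d^2 * hr2'
    · have hr0 := hr.ne'
      ext i; fin_cases i <;> simp [act, pt, Fin.sum_univ_three] <;> field_simp <;> rfl

lemma invariant_radial {F : Type} (g : E3 → F) (hg : ∀ A, SO3 A → ∀ x, g (act A x) = g x) (x : E3) :
    g x = g (pt ‖x‖) := by
  obtain ⟨A, hA, h⟩ := exists_rot x
  conv_lhs => rw [← h]
  exact hg A hA _

lemma equivariant_pt (V : E3 → E3) (hV : ∀ A, SO3 A → ∀ x, V (act A x) = act A (V x)) (r : ℝ) :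
    V (pt r) = pt (V (pt r) 0) := by
  have h := hV _ so3_d1 (pt r)
  rw [act_d1_pt] at h
  have h1 := congrArg (fun y : E3 => y 1) h
  have h2 := congrArg (fun y : E3 => y 2) h
  simp [act, Fin.sum_univ_three] at h1 h2
  ext i; fin_cases i
  · exact (pt_apply_zero _).symm
  · have : V (pt r) 1 = 0 := by linarith
    simpa [pt] using this
  · have : V (pt r) 2 = 0 := by linarith
    simpa [pt] using this

lemma equivariant_neg (V : E3 → E3) (hV : ∀ A, SO3 A → ∀ x, V (act A x) = act A (V x)) (r : ℝ) :
    V (pt (-r)) 0 = - V (pt r) 0 := by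
  have h := hV _ so3_d2 (pt r)
  rw [act_d2_pt, equivariant_pt V hV r, act_d2_pt] at h
  rw [h, pt_apply_zero]

lemma equivariant_radial (V : E3 → E3) (hV : ∀ A, SO3 A → ∀ x, V (act A x) = act A (V x)) (x : E3) :
    V x = (V (pt ‖x‖) 0 / ‖x‖) • x := by
  obtain ⟨A, hA, h⟩ := exists_rot x
  have h1 := hV A hA (pt ‖x‖)
  rw [h, equivariant_pt V hV] at h1
  rw [h1]
  by_cases hx : x = 0
  · subst hx
    have h0 := equivariant_neg V hV 0
    simp only [neg_zero] at h0
    have : V (pt ‖(0:E3)‖) 0 = 0 := by rw [norm_zero]; linarith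
    rw [this, pt_zero, act_zero, smul_zero]
  · have hr : ‖x‖ ≠ 0 := norm_ne_zero_iff.2 hx
    have h2 : (V (pt ‖x‖) 0 / ‖x‖) • x = (V (pt ‖x‖) 0 / ‖x‖) • act A (pt ‖x‖) := by rw [h]
    rw [h2, ← act_smul, pt_smul, div_mul_cancel₀ _ hr]

end Geometry

section Moments

lemma w_pos (v : E3) : 0 < w v := Real.sqrt_pos.2 (by positivity)

lemma w_contDiff {n : WithTop ℕ∞} : ContDiff ℝ n w := by
  unfold w
  exact ContDiff.sqrt (contDiff_const.add (contDiff_norm_sq ℝ)) (fun v => by positivity)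

lemma one_le_w (v : E3) : 1 ≤ w v := by
  unfold w; rw [Real.one_le_sqrt]; nlinarith [sq_nonneg ‖v‖]

lemma norm_le_w (v : E3) : ‖v‖ ≤ w v := by
  unfold w; apply Real.le_sqrt_of_sq_le; linarith

lemma w_le (v : E3) : w v ≤ 1 + ‖v‖ := by
  unfold w; rw [Real.sqrt_le_left (by positivity)]; nlinarith [norm_nonneg v]

/-- `C²` in `(t,x)` on `J × ℝ³`. -/
def CJ {F : Type} [NormedAddCommGroup F] [NormedSpace ℝ F] (J : Set ℝ) (g : ℝ → E3 → F) : Prop :=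
  ContDiffOn ℝ 2 (fun p : ℝ × E3 => g p.1 p.2) (J ×ˢ Set.univ)

structure GoodF (J : Set ℝ) (f : ℝ → E3 → E3 → ℝ) : Prop where
  smooth : ContDiffOn ℝ 2 (fun p : ℝ × (E3 × E3) => f p.1 p.2.1 p.2.2) (J ×ˢ Set.univ)
  nonneg : ∀ t ∈ J, ∀ x v, 0 ≤ f t x v
  sym : ∀ t ∈ J, SphSymm (f t)
  supp : ∀ t ∈ J, ∃ U ∈ 𝓝 t, ∃ R : ℝ, 0 < R ∧ ∀ t' ∈ U, ∀ x v, (R ≤ ‖x‖ ∨ R ≤ ‖v‖) → f t' x v = 0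

variable {J : Set ℝ} {f : ℝ → E3 → E3 → ℝ}

lemma GoodF.moment (hf : GoodF J f) (hJ : IsOpen J) {F : Type} [NormedAddCommGroup F]
    [NormedSpace ℝ F] [CompleteSpace F] {c : E3 → E3 → F}
    (hc : ContDiff ℝ 2 (fun q : E3 × E3 => c q.1 q.2)) :
    CJ J (fun t x => ∫ v, f t x v • c x v) := by
  unfold CJ
  refine contDiffOn_integral_of_compact (μ := volume)
    (g := fun (p : ℝ × E3) v => f p.1 p.2 v • c p.2 v) (hJ.prod isOpen_univ) ?_ ?_
  · have h1 : ContDiffOn ℝ 2 (fun q : (ℝ × E3) × E3 => f q.1.1 q.1.2 q.2)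
        ((J ×ˢ Set.univ) ×ˢ Set.univ) :=
      hf.smooth.comp (f := fun q : (ℝ × E3) × E3 => (q.1.1, (q.1.2, q.2))) (by fun_prop)
        (fun q hq => ⟨hq.1.1, trivial⟩)
    have h2 : ContDiff ℝ 2 (fun q : (ℝ × E3) × E3 => c q.1.2 q.2) :=
      hc.comp (f := fun q : (ℝ × E3) × E3 => (q.1.2, q.2)) (by fun_prop)
    exact h1.smul h2.contDiffOn
  · rintro ⟨t, x⟩ hp
    obtain ⟨U, hU, R, hR, h⟩ := hf.supp t hp.1
    refine ⟨Prod.fst ⁻¹' U, continuousAt_fst.preimage_mem_nhds hU, Metric.closedBall 0 R,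
      isCompact_closedBall _ _, fun p' hp' v hv => ?_⟩
    rw [h p'.1 hp' _ _ (Or.inr ?_), zero_smul]
    rw [mem_closedBall_zero_iff, not_le] at hv
    exact hv.le

lemma GoodF.integrable (hf : GoodF J f) {F : Type} [NormedAddCommGroup F]
    [NormedSpace ℝ F] {t : ℝ} (ht : t ∈ J) (x : E3) {c : E3 → F} (hc : Continuous c) :
    Integrable (fun v => f t x v • c v) := by
  have h1 : Continuous (fun v => f t x v) := by
    rw [← continuousOn_univ]
    exact hf.smooth.continuousOn.comp (f := fun v : E3 => (t, (x, v))) (by fun_prop)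
      (fun v _ => ⟨ht, trivial⟩)
  apply (h1.smul hc).integrable_of_hasCompactSupport
  obtain ⟨U, hU, R, hR, h⟩ := hf.supp t ht
  refine HasCompactSupport.of_support_subset_isCompact (isCompact_closedBall (0:E3) R) ?_
  intro v hv
  rw [mem_closedBall_zero_iff]
  by_contra hv'
  exact hv (by simp [h t (mem_of_mem_nhds hU) x v (Or.inr (not_le.1 hv').le)])

def Rm (f : ℝ → E3 → E3 → ℝ) (t : ℝ) (x : E3) : ℝ := ∫ v, f t x v • w v
def Mm (f : ℝ → E3 → E3 → ℝ) (t : ℝ) (x : E3) : ℝ := ∫ v, f t x v • (1:ℝ)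
def Kv (f : ℝ → E3 → E3 → ℝ) (t : ℝ) (x : E3) : E3 := ∫ v, f t x v • v
def Pv (f : ℝ → E3 → E3 → ℝ) (t : ℝ) (x : E3) : E3 :=
  ∫ v, f t x v • (((inner ℝ x v : ℝ) / w v) • v)
/-- matter part of the pressure -/
def pf (f : ℝ → E3 → E3 → ℝ) (t r : ℝ) : ℝ := ∫ v : E3, (v 0) ^ 2 / w v * f t (pt r) v

lemma GoodF.CJ_Rm (hf : GoodF J f) (hJ : IsOpen J) : CJ J (Rm f) :=
  hf.moment hJ (c := fun x v => w v) (w_contDiff.comp contDiff_snd)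
lemma GoodF.CJ_Mm (hf : GoodF J f) (hJ : IsOpen J) : CJ J (Mm f) :=
  hf.moment hJ (c := fun x v => 1) contDiff_const
lemma GoodF.CJ_Kv (hf : GoodF J f) (hJ : IsOpen J) : CJ J (Kv f) :=
  hf.moment hJ (c := fun x v => v) contDiff_snd
lemma GoodF.CJ_Pv (hf : GoodF J f) (hJ : IsOpen J) : CJ J (Pv f) :=
  hf.moment hJ (c := fun x v => ((inner ℝ x v : ℝ) / w v) • v)
    (ContDiff.smul (ContDiff.div (contDiff_fst.inner ℝ contDiff_snd) (w_contDiff.comp contDiff_snd)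
      (fun q => (w_pos _).ne')) contDiff_snd)

lemma GoodF.inv_of (hf : GoodF J f) {t : ℝ} (ht : t ∈ J) {c : E3 → ℝ}
    (hc : ∀ A, SO3 A → ∀ v, c (act A v) = c v) (A) (hA : SO3 A) (x : E3) :
    ∫ v, f t (act A x) v • c v = ∫ v, f t x v • c v := by
  rw [← integral_act hA]
  simp only [hf.sym t ht A hA, hc A hA]

lemma GoodF.Rm_inv (hf : GoodF J f) {t : ℝ} (ht : t ∈ J) (x : E3) : Rm f t x = Rm f t (pt ‖x‖) :=
  invariant_radial (Rm f t) (fun A hA x => hf.inv_of ht (fun A hA v => w_act hA v) A hA x) x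

lemma GoodF.Mm_inv (hf : GoodF J f) {t : ℝ} (ht : t ∈ J) (x : E3) : Mm f t x = Mm f t (pt ‖x‖) :=
  invariant_radial (Mm f t) (fun A hA x => hf.inv_of ht (fun A hA v => rfl) A hA x) x

lemma GoodF.Kv_eqv (hf : GoodF J f) {t : ℝ} (ht : t ∈ J) (A) (hA : SO3 A) (x : E3) :
    Kv f t (act A x) = act A (Kv f t x) := by
  unfold Kv
  rw [← act_integral hA, ← integral_act hA]
  simp only [hf.sym t ht A hA, act_smul]

lemma GoodF.Pv_eqv (hf : GoodF J f) {t : ℝ} (ht : t ∈ J) (A) (hA : SO3 A) (x : E3) :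
    Pv f t (act A x) = act A (Pv f t x) := by
  unfold Pv
  rw [← act_integral hA, ← integral_act hA]
  simp only [hf.sym t ht A hA, act_smul, act_inner hA, w_act hA]

lemma coord_integral {g : E3 → E3} (hg : Integrable g) : (∫ v, g v) 0 = ∫ v, g v 0 :=
  ((EuclideanSpace.proj (0 : Fin 3) : E3 →L[ℝ] ℝ).integral_comp_comm hg).symm

lemma GoodF.Kv_pt (hf : GoodF J f) {t : ℝ} (ht : t ∈ J) (r : ℝ) : Kv f t (pt r) 0 = kk f t r := by
  unfold Kv kk
  rw [coord_integral (hf.integrable ht _ (c := fun v => v) continuous_id)]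
  simp [mul_comm]

lemma GoodF.Pv_pt (hf : GoodF J f) {t : ℝ} (ht : t ∈ J) (r : ℝ) :
    Pv f t (pt r) 0 = r * pf f t r := by
  unfold Pv pf
  rw [coord_integral (hf.integrable ht _ (c := fun v => ((inner ℝ (pt r) v : ℝ) / w v) • v)
    (Continuous.smul (Continuous.div (by fun_prop) (w_contDiff (n := 0)).continuous
      (fun q => (w_pos _).ne')) continuous_id)), ← MeasureTheory.integral_const_mul]
  congr 1; funext v
  simp [inner_pt]; ring

lemma GoodF.Kv_radial (hf : GoodF J f) {t : ℝ} (ht : t ∈ J) (x : E3) :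
    Kv f t x = (kk f t ‖x‖ / ‖x‖) • x := by
  rw [equivariant_radial (Kv f t) (hf.Kv_eqv ht) x, hf.Kv_pt ht]

lemma GoodF.Pv_radial (hf : GoodF J f) {t : ℝ} (ht : t ∈ J) (x : E3) :
    Pv f t x = pf f t ‖x‖ • x := by
  by_cases hx : x = 0
  · subst hx; simp [Pv]
  rw [equivariant_radial (Pv f t) (hf.Pv_eqv ht) x, hf.Pv_pt ht,
    mul_div_cancel_left₀ _ (norm_ne_zero_iff.2 hx)]

lemma GoodF.kk_neg (hf : GoodF J f) {t : ℝ} (ht : t ∈ J) (r : ℝ) : kk f t (-r) = - kk f t r := by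
  rw [← hf.Kv_pt ht, ← hf.Kv_pt ht, equivariant_neg _ (hf.Kv_eqv ht)]

lemma GoodF.Rm_nonneg (hf : GoodF J f) {t : ℝ} (ht : t ∈ J) (x : E3) : 0 ≤ Rm f t x :=
  integral_nonneg (fun v => mul_nonneg (hf.nonneg t ht x v) (w_pos v).le)

lemma GoodF.Mm_nonneg (hf : GoodF J f) {t : ℝ} (ht : t ∈ J) (x : E3) : 0 ≤ Mm f t x :=
  integral_nonneg (fun v => mul_nonneg (hf.nonneg t ht x v) zero_le_one)

lemma GoodF.pf_nonneg (hf : GoodF J f) {t : ℝ} (ht : t ∈ J) (r : ℝ) : 0 ≤ pf f t r :=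
  integral_nonneg (fun v => mul_nonneg (div_nonneg (sq_nonneg _) (w_pos v).le) (hf.nonneg t ht _ v))

lemma GoodF.moments_zero (hf : GoodF J f) {t : ℝ} (ht : t ∈ J) : ∃ U ∈ 𝓝 t, ∃ R : ℝ, 0 < R ∧
    (∀ t' ∈ U, ∀ x, R ≤ ‖x‖ → Rm f t' x = 0 ∧ Mm f t' x = 0 ∧ Kv f t' x = 0 ∧ Pv f t' x = 0) ∧
    (∀ t' ∈ U, ∀ r, R ≤ r → pf f t' r = 0 ∧ kk f t' r = 0) := by
  obtain ⟨U, hU, R, hR, h⟩ := hf.supp t ht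
  refine ⟨U, hU, R, hR, ?_, ?_⟩
  · intro t' ht' x hx
    have : ∀ v, f t' x v = 0 := fun v => h t' ht' x v (Or.inl hx)
    simp [Rm, Mm, Kv, Pv, this]
  · intro t' ht' r hr
    have : ∀ v, f t' (pt r) v = 0 := fun v => h t' ht' _ v (Or.inl (by
      rw [norm_pt]; exact hr.trans (le_abs_self r)))
    simp [pf, kk, this]

lemma rho_eq (lam e : ℝ → ℝ → ℝ) (t r : ℝ) :
    rho lam e f t r = Rm f t (pt r) + 1/2 * Real.exp (2 * lam t r) * (e t r) ^ 2 := by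
  simp [rho, Rm, mul_comm]

lemma prs_eq (lam e : ℝ → ℝ → ℝ) (t r : ℝ) :
    prs lam e f t r = pf f t r - 1/2 * Real.exp (2 * lam t r) * (e t r) ^ 2 := rfl

lemma Mch_eq (t r : ℝ) : Mch f t r = Mm f t (pt r) := by
  simp [Mch, Mm]

lemma GoodF.regDist (hf : GoodF J f) {I : Set ℝ} (hI : I ⊆ J) : RegDist I f := by
  refine ⟨(hf.smooth.mono (Set.prod_mono_left hI)).of_le (by norm_num),
    fun t ht => hf.nonneg t (hI ht), fun t ht => hf.sym t (hI ht), fun t ht => ?_⟩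
  obtain ⟨U, hU, R, hR, h⟩ := hf.supp t (hI ht)
  refine HasCompactSupport.of_support_subset_isCompact (isCompact_closedBall (0:E3 × E3) R) ?_
  intro z hz
  rw [mem_closedBall_zero_iff]
  by_contra hz'
  apply hz
  apply h t (mem_of_mem_nhds hU)
  rw [Prod.norm_def, not_le, lt_max_iff] at hz'
  exact hz'.imp le_of_lt le_of_lt

end Moments

section Step1

variable {J : Set ℝ}

def avg (g : ℝ → E3 → ℝ) (t : ℝ) (x : E3) : ℝ := ∫ σ in (0:ℝ)..1, σ ^ 2 * g t (σ • x)

def RadialOn {F : Type} (J : Set ℝ) (g : ℝ → E3 → F) : Prop := ∀ t ∈ J, ∀ x, g t x = g t (pt ‖x‖)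

lemma RadialOn.congr_norm {F : Type} {g : ℝ → E3 → F} (h : RadialOn J g) {t : ℝ} (ht : t ∈ J) {x y : E3}
    (hxy : ‖x‖ = ‖y‖) : g t x = g t y := by
  rw [h t ht x, h t ht y, hxy]

section
variable {F : Type} [NormedAddCommGroup F] [NormedSpace ℝ F]

lemma CJ.comp_smul {g : ℝ → E3 → F} (hg : CJ J g) :
    ContDiffOn ℝ 2 (fun q : (ℝ × E3) × ℝ => g q.1.1 (q.2 • q.1.2)) ((J ×ˢ Set.univ) ×ˢ Set.univ) :=
  ContDiffOn.comp hg (f := fun q : (ℝ × E3) × ℝ => (q.1.1, q.2 • q.1.2)) (by fun_prop)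
    (fun q hq => ⟨hq.1.1, trivial⟩)

lemma CJ.mono {g : ℝ → E3 → F} (hg : CJ J g) {J' : Set ℝ} (h : J' ⊆ J) : CJ J' g :=
  ContDiffOn.mono hg (Set.prod_mono_left h)

lemma CJ.pt2 {g : ℝ → E3 → F} (hg : CJ J g) :
    ContDiffOn ℝ 2 (fun p : ℝ × ℝ => g p.1 (pt p.2)) (J ×ˢ Set.univ) :=
  ContDiffOn.comp hg (f := fun q : ℝ × ℝ => (q.1, pt q.2))
    (contDiff_fst.prodMk (contDiff_pt.comp contDiff_snd)).contDiffOn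
    (fun q hq => ⟨hq.1, trivial⟩)

lemma CJ.slice {g : ℝ → E3 → F} (hg : CJ J g) {t : ℝ} (ht : t ∈ J) : ContDiff ℝ 2 (g t) := by
  rw [← contDiffOn_univ]
  exact ContDiffOn.comp hg (f := fun x : E3 => (t, x)) (by fun_prop) (fun q hq => ⟨ht, trivial⟩)

lemma CJ.slice_pt {g : ℝ → E3 → F} (hg : CJ J g) {t : ℝ} (ht : t ∈ J) :
    ContDiff ℝ 2 (fun r => g t (pt r)) := (hg.slice ht).comp contDiff_pt

lemma CJ.slice_t {g : ℝ → E3 → F} (hg : CJ J g) (x : E3) : ContDiffOn ℝ 2 (fun t => g t x) J :=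
  ContDiffOn.comp hg (f := fun t : ℝ => (t, x)) (by fun_prop) (fun q hq => ⟨hq, trivial⟩)

lemma CJ.congr {g h : ℝ → E3 → F} (hg : CJ J g) (e : ∀ t ∈ J, ∀ x, h t x = g t x) : CJ J h :=
  ContDiffOn.congr hg (fun p hp => e p.1 hp.1 p.2)

lemma CJ.smul {g : ℝ → E3 → F} {c : ℝ → E3 → ℝ} (hc : CJ J c) (hg : CJ J g) :
    CJ J (fun t x => c t x • g t x) := ContDiffOn.smul hc hg
lemma CJ.add {g h : ℝ → E3 → F} (hg : CJ J g) (hh : CJ J h) :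
    CJ J (fun t x => g t x + h t x) := ContDiffOn.add hg hh
lemma CJ.sub {g h : ℝ → E3 → F} (hg : CJ J g) (hh : CJ J h) :
    CJ J (fun t x => g t x - h t x) := ContDiffOn.sub hg hh
lemma CJ.mul {g h : ℝ → E3 → ℝ} (hg : CJ J g) (hh : CJ J h) :
    CJ J (fun t x => g t x * h t x) := ContDiffOn.mul hg hh
lemma CJ.exp {g : ℝ → E3 → ℝ} (hg : CJ J g) : CJ J (fun t x => Real.exp (g t x)) := ContDiffOn.exp hg
lemma CJ.const (c : F) : CJ J (fun _ _ => c) := contDiffOn_const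
lemma CJ.id : CJ J (fun _ x => x) := contDiffOn_snd
lemma CJ.normSq : CJ J (fun _ x => ‖x‖ ^ 2) :=
  ((contDiff_norm_sq ℝ).comp contDiff_snd).contDiffOn
end

lemma CJ.avg {g : ℝ → E3 → ℝ} (hJ : IsOpen J) (hg : CJ J g) : CJ J (avg g) := by
  unfold CJ EVM.avg
  refine contDiffOn_unit_integral (g := fun (p : ℝ × E3) σ => σ ^ 2 * g p.1 (σ • p.2))
    (hJ.prod isOpen_univ) ?_
  exact ContDiffOn.mul (by fun_prop) hg.comp_smul

lemma unit_integral_pt (h : ℝ → ℝ) (r : ℝ) : r * ∫ σ in (0:ℝ)..1, h (r * σ) = ∫ s in (0:ℝ)..r, h s := by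
  have := intervalIntegral.smul_integral_comp_mul_left (a := 0) (b := 1) h r
  simpa using this

lemma avg_pt (g : ℝ → E3 → ℝ) (t r : ℝ) :
    r ^ 3 * avg g t (pt r) = ∫ s in (0:ℝ)..r, s ^ 2 * g t (pt s) := by
  rw [← unit_integral_pt, avg, show r ^ 3 = r * r ^ 2 by ring, mul_assoc,
    ← intervalIntegral.integral_const_mul]
  congr 1
  apply intervalIntegral.integral_congr
  intro σ _
  simp only [pt_smul]
  rw [mul_comm σ r]; ring

lemma RadialOn.avg {g : ℝ → E3 → ℝ} (hg : RadialOn J g) : RadialOn J (avg g) := by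
  intro t ht x
  unfold EVM.avg
  apply intervalIntegral.integral_congr
  intro σ _
  simp only
  rw [hg.congr_norm ht (x := σ • x) (y := σ • pt ‖x‖)]
  rw [norm_smul, norm_smul, norm_pt, abs_norm]

lemma avg_nonneg {g : ℝ → E3 → ℝ} {t : ℝ} (hg : ∀ x, 0 ≤ g t x) (x : E3) : 0 ≤ avg g t x :=
  intervalIntegral.integral_nonneg zero_le_one (fun σ _ => mul_nonneg (sq_nonneg _) (hg _))

/-- derivative of the integral form -/
lemma hasDerivAt_integral_pt {h : ℝ → ℝ} (hh : Continuous h) (r : ℝ) :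
    HasDerivAt (fun r => ∫ s in (0:ℝ)..r, h s) (h r) r :=
  intervalIntegral.integral_hasDerivAt_right (hh.intervalIntegrable _ _)
    (hh.stronglyMeasurableAtFilter _ _) hh.continuousAt

/-- the exterior decay of the Maxwell variable -/
def ExtBd (J : Set ℝ) (D : ℝ → E3 → ℝ) : Prop :=
  ∀ t ∈ J, ∃ U ∈ 𝓝 t, ∃ R : ℝ, 0 < R ∧ ∃ C : ℝ, 0 ≤ C ∧ ∀ t' ∈ U, ∀ r, R ≤ r → |D t' (pt r)| * r ^ 3 ≤ C

lemma avg_ext {g : ℝ → E3 → ℝ} (hJ : IsOpen J) (hg : CJ J g)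
    (hz : ∀ t ∈ J, ∃ U ∈ 𝓝 t, ∃ R : ℝ, 0 < R ∧ ∀ t' ∈ U, ∀ r, R ≤ r → g t' (pt r) = 0) :
    ExtBd J (avg g) := by
  intro t ht
  obtain ⟨U, hU, R, hR, h⟩ := hz t ht
  have hcont : ContinuousAt (fun t' => |avg g t' (pt R)| * R ^ 3) t :=
    (((hg.avg hJ).slice_t (pt R)).continuousOn.continuousAt (hJ.mem_nhds ht)).abs.mul continuousAt_const
  have hev := hcont.eventually_lt_const (lt_add_one _)
  refine ⟨U ∩ J ∩ {t' | _}, inter_mem (inter_mem hU (hJ.mem_nhds ht)) hev, R, hR,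
    |avg g t (pt R)| * R ^ 3 + 1, by positivity, ?_⟩
  rintro t' ⟨⟨htU, htJ⟩, ht'⟩ r hr
  have hr0 : 0 < r := hR.trans_le hr
  have hc : Continuous fun s => s ^ 2 * g t' (pt s) :=
    (continuous_pow 2).mul (hg.slice_pt htJ).continuous
  have e : r ^ 3 * avg g t' (pt r) = R ^ 3 * avg g t' (pt R) := by
    rw [avg_pt, avg_pt, ← intervalIntegral.integral_add_adjacent_intervals
      (hc.intervalIntegrable 0 R) (hc.intervalIntegrable R r)]
    have : ∫ s in R..r, s ^ 2 * g t' (pt s) = 0 := by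
      rw [intervalIntegral.integral_congr (g := fun _ => (0:ℝ))]
      · simp
      · intro s hs
        rw [Set.uIcc_of_le hr] at hs
        simp [h t' htU s hs.1]
    rw [this, add_zero]
  have e2 : |avg g t' (pt r)| * r ^ 3 = |avg g t' (pt R)| * R ^ 3 := by
    rw [← abs_of_pos (pow_pos hr0 3), ← abs_of_pos (pow_pos hR 3), ← abs_mul, ← abs_mul,
      mul_comm, e, mul_comm]
  rw [e2]
  exact le_of_lt ht'

end Step1

section Step2

variable {J : Set ℝ} {f : ℝ → E3 → E3 → ℝ} {D : ℝ → E3 → ℝ}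

def Rho (f : ℝ → E3 → E3 → ℝ) (D : ℝ → E3 → ℝ) (t : ℝ) (x : E3) : ℝ :=
  Rm f t x + 1/2 * (‖x‖ ^ 2 * (D t x * D t x))
def AA (f : ℝ → E3 → E3 → ℝ) (D : ℝ → E3 → ℝ) (t : ℝ) (x : E3) : ℝ := 4 * π * avg (Rho f D) t x
def Lam (f : ℝ → E3 → E3 → ℝ) (D : ℝ → E3 → ℝ) (t : ℝ) (x : E3) : ℝ :=
  -(1/2) * Real.log (1 - 2 * (‖x‖ ^ 2 * AA f D t x))
def Yv (f : ℝ → E3 → E3 → ℝ) (D : ℝ → E3 → ℝ) (t : ℝ) (x : E3) : E3 :=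
  (4 * π * Real.exp (2 * Lam f D t x)) • (Rm f t x • x + Pv f t x)
def Vv (f : ℝ → E3 → E3 → ℝ) (D : ℝ → E3 → ℝ) (t : ℝ) (x : E3) : ℝ :=
  ∫ σ in (0:ℝ)..1, (inner ℝ (Yv f D t (σ • x)) x : ℝ)
def W0 (f : ℝ → E3 → E3 → ℝ) (D : ℝ → E3 → ℝ) (t : ℝ) : ℝ := limUnder atTop (fun r => Vv f D t (pt r))
def Muf (f : ℝ → E3 → E3 → ℝ) (D : ℝ → E3 → ℝ) (t : ℝ) (x : E3) : ℝ :=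
  -Lam f D t x - W0 f D t + Vv f D t x

/-- input of the metric step -/
structure MIn (J : Set ℝ) (f : ℝ → E3 → E3 → ℝ) (D : ℝ → E3 → ℝ) : Prop where
  open_ : IsOpen J
  f_ : GoodF J f
  D_ : CJ J D
  rad : RadialOn J D
  ext : ExtBd J D

/-- positivity of `1 - 2m/r` -/
def PosOn (J : Set ℝ) (f : ℝ → E3 → E3 → ℝ) (D : ℝ → E3 → ℝ) : Prop :=
  ∀ t ∈ J, ∀ x, 2 * (‖x‖ ^ 2 * AA f D t x) < 1

lemma norm_pt_sq (r : ℝ) : ‖pt r‖ ^ 2 = r ^ 2 := by rw [norm_pt, sq_abs]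

lemma MIn.CJ_Rho (h : MIn J f D) : CJ J (Rho f D) :=
  (h.f_.CJ_Rm h.open_).add ((CJ.const (1/2)).mul (CJ.normSq.mul (h.D_.mul h.D_)))

lemma MIn.CJ_AA (h : MIn J f D) : CJ J (AA f D) := (CJ.const _).mul (h.CJ_Rho.avg h.open_)

lemma MIn.CJ_Lam (h : MIn J f D) (hp : PosOn J f D) : CJ J (Lam f D) := by
  refine (CJ.const (-(1/2))).mul ?_
  refine ContDiffOn.log ((CJ.const 1).sub ((CJ.const 2).mul (CJ.normSq.mul h.CJ_AA))) ?_
  rintro ⟨t, x⟩ ⟨ht, -⟩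
  have := hp t ht x
  simp only
  linarith

lemma MIn.CJ_Yv (h : MIn J f D) (hp : PosOn J f D) : CJ J (Yv f D) :=
  ((CJ.const (4*π)).mul ((CJ.const 2).mul (h.CJ_Lam hp)).exp).smul
    (((h.f_.CJ_Rm h.open_).smul CJ.id).add (h.f_.CJ_Pv h.open_))

lemma MIn.CJ_Vv (h : MIn J f D) (hp : PosOn J f D) : CJ J (Vv f D) := by
  unfold CJ Vv
  refine contDiffOn_unit_integral (g := fun (p : ℝ × E3) σ => (inner ℝ (Yv f D p.1 (σ • p.2)) p.2 : ℝ))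
    (h.open_.prod isOpen_univ) ?_
  exact ContDiffOn.inner ℝ (h.CJ_Yv hp).comp_smul (by fun_prop)

lemma MIn.rad_Rho (h : MIn J f D) : RadialOn J (Rho f D) := by
  intro t ht x
  unfold Rho
  rw [h.f_.Rm_inv ht, h.rad t ht x, norm_pt, abs_norm]

lemma MIn.rad_AA (h : MIn J f D) : RadialOn J (AA f D) := by
  intro t ht x
  unfold AA
  rw [h.rad_Rho.avg t ht x]

lemma MIn.rad_Lam (h : MIn J f D) : RadialOn J (Lam f D) := by
  intro t ht x
  unfold Lam
  rw [h.rad_AA t ht x, norm_pt, abs_norm]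

lemma MIn.Yv_radial (h : MIn J f D) {t : ℝ} (ht : t ∈ J) (x : E3) :
    Yv f D t x = (4 * π * Real.exp (2 * Lam f D t x) * (Rm f t x + pf f t ‖x‖)) • x := by
  unfold Yv
  rw [h.f_.Pv_radial ht, ← add_smul, smul_smul]

lemma MIn.rad_Vv (h : MIn J f D) : RadialOn J (Vv f D) := by
  intro t ht x
  unfold Vv
  apply intervalIntegral.integral_congr
  intro σ _
  simp only
  have hn : ‖σ • x‖ = ‖σ • pt ‖x‖‖ := by rw [norm_smul, norm_smul, norm_pt, abs_norm]
  have hR : RadialOn J (Rm f) := fun t ht x => h.f_.Rm_inv ht x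
  rw [h.Yv_radial ht, h.Yv_radial ht, h.rad_Lam.congr_norm ht hn, hR.congr_norm ht hn, hn,
    inner_smul_left, inner_smul_left, inner_smul_left, inner_smul_left,
    real_inner_self_eq_norm_sq, real_inner_self_eq_norm_sq, norm_pt, abs_norm]

lemma MIn.Yv_pt (h : MIn J f D) {t : ℝ} (ht : t ∈ J) (r : ℝ) :
    Yv f D t (pt r) 0 = 4 * π * Real.exp (2 * Lam f D t (pt r)) * (r * (Rm f t (pt r) + pf f t r)) := by
  unfold Yv
  simp [h.f_.Pv_pt ht, pt_apply_zero]; ring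

lemma Vv_pt (t r : ℝ) : Vv f D t (pt r) = ∫ s in (0:ℝ)..r, Yv f D t (pt s) 0 := by
  rw [← unit_integral_pt, ← intervalIntegral.integral_const_mul]
  unfold Vv
  apply intervalIntegral.integral_congr
  intro σ _
  simp only
  rw [real_inner_comm, inner_pt, pt_smul, mul_comm σ r]

lemma MIn.hasDerivAt_Vv (h : MIn J f D) (hp : PosOn J f D) {t : ℝ} (ht : t ∈ J) (r : ℝ) :
    HasDerivAt (fun r => Vv f D t (pt r))
      (4 * π * Real.exp (2 * Lam f D t (pt r)) * (r * (Rm f t (pt r) + pf f t r))) r := by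
  simp only [Vv_pt]
  rw [← h.Yv_pt ht]
  refine hasDerivAt_integral_pt (h := fun s => Yv f D t (pt s) 0) ?_ r
  have := ((h.CJ_Yv hp).slice_pt ht).continuous
  exact (EuclideanSpace.proj (0 : Fin 3) : E3 →L[ℝ] ℝ).continuous.comp this

lemma mass_eq (t r : ℝ) : r ^ 3 * AA f D t (pt r) = 4 * π * ∫ s in (0:ℝ)..r, s ^ 2 * Rho f D t (pt s) := by
  rw [← avg_pt]; unfold AA; ring

lemma MIn.hasDerivAt_mass (h : MIn J f D) {t : ℝ} (ht : t ∈ J) (r : ℝ) :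
    HasDerivAt (fun r => r ^ 3 * AA f D t (pt r)) (4 * π * (r ^ 2 * Rho f D t (pt r))) r := by
  simp only [mass_eq]
  exact (hasDerivAt_integral_pt (h := fun s => s ^ 2 * Rho f D t (pt s))
    ((continuous_pow 2).mul (h.CJ_Rho.slice_pt ht).continuous) r).const_mul _

lemma MIn.hasDerivAt_qm (h : MIn J f D) {t : ℝ} (ht : t ∈ J) (r : ℝ) :
    HasDerivAt (fun r => r ^ 2 * AA f D t (pt r)) (r * (4 * π * Rho f D t (pt r) - AA f D t (pt r))) r := by
  have h1 : HasDerivAt (fun r => AA f D t (pt r)) (deriv (fun r => AA f D t (pt r)) r) r :=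
    (((h.CJ_AA.slice_pt ht).differentiable (by norm_num)) r).hasDerivAt
  set a := deriv (fun r => AA f D t (pt r)) r
  have h2 := (hasDerivAt_pow 3 r).mul h1
  have h3 := h2.unique (h.hasDerivAt_mass ht r)
  have h4 := (hasDerivAt_pow 2 r).mul h1
  have : r * (4 * π * Rho f D t (pt r) - AA f D t (pt r)) = (2:ℕ) * r ^ (2-1) * AA f D t (pt r) + r ^ 2 * a := by
    by_cases hr : r = 0
    · simp [hr]
    · have : r ^ 2 ≠ 0 := pow_ne_zero _ hr
      apply mul_left_cancel₀ hr
      simp only [Nat.cast_ofNat, Nat.add_one_sub_one, pow_one, show 3 - 1 = 2 from rfl, show 2 - 1 = 1 from rfl] at h3 ⊢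
      linear_combination -h3
  rw [this]; exact h4

lemma PosOn.pt (hp : PosOn J f D) {t : ℝ} (ht : t ∈ J) (r : ℝ) : 0 < 1 - 2 * (r ^ 2 * AA f D t (pt r)) := by
  have := hp t ht (EVM.pt r)
  rw [norm_pt_sq] at this
  linarith

lemma PosOn.exp_Lam (hp : PosOn J f D) {t : ℝ} (ht : t ∈ J) (r : ℝ) :
    Real.exp (-2 * Lam f D t (EVM.pt r)) = 1 - 2 * (r ^ 2 * AA f D t (EVM.pt r)) := by
  unfold Lam
  rw [norm_pt_sq, show ∀ y : ℝ, -2 * (-(1/2) * y) = y by intro y; ring, Real.exp_log (hp.pt ht r)]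

lemma PosOn.exp_Lam2 (hp : PosOn J f D) {t : ℝ} (ht : t ∈ J) (r : ℝ) :
    Real.exp (2 * Lam f D t (EVM.pt r)) = (1 - 2 * (r ^ 2 * AA f D t (EVM.pt r)))⁻¹ := by
  rw [← hp.exp_Lam ht, ← Real.exp_neg]; congr 1; ring

lemma MIn.hasDerivAt_Lam (h : MIn J f D) (hp : PosOn J f D) {t : ℝ} (ht : t ∈ J) (r : ℝ) :
    HasDerivAt (fun r => Lam f D t (pt r))
      (Real.exp (2 * Lam f D t (pt r)) * (r * (4 * π * Rho f D t (pt r) - AA f D t (pt r)))) r := by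
  have h1 := (((h.hasDerivAt_qm ht r).const_mul 2).const_sub 1).log (hp.pt ht r).ne'
  have h2 := h1.const_mul (-(1/2))
  rw [hp.exp_Lam2 ht]
  have : (fun r => Lam f D t (EVM.pt r)) = fun r => -(1/2) * Real.log (1 - 2 * (r ^ 2 * AA f D t (pt r))) := by
    funext r; unfold Lam; rw [norm_pt_sq]
  rw [this]
  refine h2.congr_deriv ?_
  rw [div_eq_inv_mul]; ring

lemma MIn.hasDerivAt_Mu (h : MIn J f D) (hp : PosOn J f D) {t : ℝ} (ht : t ∈ J) (r : ℝ) :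
    HasDerivAt (fun r => Muf f D t (pt r))
      (Real.exp (2 * Lam f D t (pt r)) * (r * AA f D t (pt r) +
        4 * π * r * (pf f t r - 1/2 * (r ^ 2 * (D t (pt r) * D t (pt r)))))) r := by
  have h1 := (((h.hasDerivAt_Lam hp ht r).neg.sub_const (W0 f D t))).add (h.hasDerivAt_Vv hp ht r)
  have h2 : HasDerivAt (fun r => Muf f D t (pt r)) _ r := h1
  refine h2.congr_deriv ?_
  unfold Rho
  rw [norm_pt_sq]
  ring

lemma MIn.Rho_nonneg (h : MIn J f D) {t : ℝ} (ht : t ∈ J) (x : E3) : 0 ≤ Rho f D t x :=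
  add_nonneg (h.f_.Rm_nonneg ht x) (mul_nonneg (by norm_num) (mul_nonneg (sq_nonneg _) (mul_self_nonneg _)))

lemma MIn.AA_nonneg (h : MIn J f D) {t : ℝ} (ht : t ∈ J) (x : E3) : 0 ≤ AA f D t x :=
  mul_nonneg (by positivity) (avg_nonneg (fun x => h.Rho_nonneg ht x) x)

lemma MIn.Lam_nonneg (h : MIn J f D) (hp : PosOn J f D) {t : ℝ} (ht : t ∈ J) (x : E3) : 0 ≤ Lam f D t x := by
  unfold Lam
  have h1 := hp t ht x
  have h2 : 0 ≤ ‖x‖ ^ 2 * AA f D t x := mul_nonneg (sq_nonneg _) (h.AA_nonneg ht x)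
  have := Real.log_nonpos (x := 1 - 2 * (‖x‖ ^ 2 * AA f D t x)) (by linarith) (by linarith)
  linarith

lemma Lam_zero (t : ℝ) : Lam f D t 0 = 0 := by simp [Lam]

lemma MIn.Vv_mono (h : MIn J f D) (hp : PosOn J f D) {t : ℝ} (ht : t ∈ J) :
    MonotoneOn (fun r => Vv f D t (pt r)) (Set.Ici 0) := by
  apply monotoneOn_of_deriv_nonneg (convex_Ici 0)
  · exact fun r _ => (h.hasDerivAt_Vv hp ht r).continuousAt.continuousWithinAt
  · exact fun r _ => (h.hasDerivAt_Vv hp ht r).differentiableAt.differentiableWithinAt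
  · intro r hr
    rw [interior_Ici] at hr
    rw [(h.hasDerivAt_Vv hp ht r).deriv]
    have := h.f_.Rm_nonneg ht (EVM.pt r)
    have := h.f_.pf_nonneg ht r
    have : 0 ≤ r := le_of_lt hr
    positivity

/-- `V` is constant outside the support -/
lemma MIn.Vv_const (h : MIn J f D) (hp : PosOn J f D) {t : ℝ} (ht : t ∈ J) :
    ∃ U ∈ 𝓝 t, ∃ R : ℝ, 0 < R ∧ ∀ t' ∈ U, (∀ r, R ≤ r → Vv f D t' (pt r) = Vv f D t' (pt R)) ∧
      W0 f D t' = Vv f D t' (pt R) := by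
  obtain ⟨U, hU, R, hR, hm, hm2⟩ := h.f_.moments_zero ht
  refine ⟨U ∩ J, inter_mem hU (h.open_.mem_nhds ht), R, hR, ?_⟩
  rintro t' ⟨htU, htJ⟩
  have key : ∀ r, R ≤ r → Vv f D t' (pt r) = Vv f D t' (pt R) := by
    intro r hr
    have hc : Continuous fun s => Yv f D t' (pt s) 0 :=
      (EuclideanSpace.proj (0 : Fin 3) : E3 →L[ℝ] ℝ).continuous.comp ((h.CJ_Yv hp).slice_pt htJ).continuous
    rw [Vv_pt, Vv_pt, ← intervalIntegral.integral_add_adjacent_intervals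
      (hc.intervalIntegrable 0 R) (hc.intervalIntegrable R r)]
    have : ∫ s in R..r, Yv f D t' (pt s) 0 = 0 := by
      rw [intervalIntegral.integral_congr (g := fun _ => (0:ℝ))]
      · simp
      · intro s hs
        rw [Set.uIcc_of_le hr] at hs
        have hs0 : R ≤ ‖pt s‖ := by rw [norm_pt]; exact hs.1.trans (le_abs_self s)
        simp only
        rw [h.Yv_pt htJ, (hm t' htU (pt s) hs0).1, (hm2 t' htU s hs.1).1]
        simp
    rw [this, add_zero]
  refine ⟨key, ?_⟩
  unfold W0
  apply Tendsto.limUnder_eq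
  exact tendsto_const_nhds.congr' ((eventually_ge_atTop R).mono fun r hr => (key r hr).symm)

lemma MIn.C2_W0 (h : MIn J f D) (hp : PosOn J f D) : ContDiffOn ℝ 2 (W0 f D) J := by
  intro t ht
  obtain ⟨U, hU, R, hR, hk⟩ := h.Vv_const hp ht
  have h1 : ContDiffAt ℝ 2 (fun t => Vv f D t (pt R)) t :=
    ((h.CJ_Vv hp).slice_t (pt R)).contDiffAt (h.open_.mem_nhds ht)
  refine (h1.congr_of_eventuallyEq ?_).contDiffWithinAt
  filter_upwards [hU] with t' ht' using (hk t' ht').2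

lemma MIn.CJ_Mu (h : MIn J f D) (hp : PosOn J f D) : CJ J (Muf f D) := by
  have hW : CJ J (fun t (_:E3) => W0 f D t) :=
    (h.C2_W0 hp).comp (f := fun p : ℝ × E3 => p.1) contDiffOn_fst (fun p hp => hp.1)
  have h1 : CJ J (fun t x => (-1:ℝ) * Lam f D t x) := (CJ.const (-1)).mul (h.CJ_Lam hp)
  refine ((h1.sub hW).add (h.CJ_Vv hp)).congr ?_
  intro t ht x
  unfold Muf; ring

lemma MIn.rad_Mu (h : MIn J f D) : RadialOn J (Muf f D) := by
  intro t ht x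
  unfold Muf
  rw [h.rad_Lam t ht x, h.rad_Vv t ht x]

lemma MIn.ineq (h : MIn J f D) (hp : PosOn J f D) {t : ℝ} (ht : t ∈ J) {r : ℝ} (hr : 0 ≤ r) :
    Muf f D t (pt r) + Lam f D t (pt r) ≤ 0 ∧ 0 ≤ Lam f D t (pt r) ∧ Muf f D t (pt r) ≤ 0 := by
  have h1 := h.Lam_nonneg hp ht (EVM.pt r)
  have h2 : Muf f D t (pt r) + Lam f D t (pt r) ≤ 0 := by
    obtain ⟨U, hU, R, hR, hk⟩ := h.Vv_const hp ht
    obtain ⟨hk1, hk2⟩ := hk t (mem_of_mem_nhds hU)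
    unfold Muf
    rw [hk2]
    have := h.Vv_mono hp ht (a := r) (b := max r R) hr (le_max_of_le_left hr) (le_max_left _ _)
    simp only at this
    rw [hk1 _ (le_max_right _ _)] at this
    linarith
  exact ⟨h2, h1, by linarith⟩

end Step2

section Step3

variable {J : Set ℝ} {f : ℝ → E3 → E3 → ℝ} {D : ℝ → E3 → ℝ}

/-- The mass is locally uniformly bounded for large radii. -/
lemma MIn.mass_bd (h : MIn J f D) {t : ℝ} (ht : t ∈ J) :
    ∃ U ∈ 𝓝 t, U ⊆ J ∧ ∃ R : ℝ, 0 < R ∧ ∃ C : ℝ, 0 ≤ C ∧ ∀ t' ∈ U, ∀ r, R ≤ r →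
      r ^ 3 * AA f D t' (pt r) ≤ C ∧ |D t' (pt r)| * r ^ 3 ≤ C ∧ Rm f t' (pt r) = 0 ∧ pf f t' r = 0 := by
  obtain ⟨U1, hU1, R1, hR1, hm, hm2⟩ := h.f_.moments_zero ht
  obtain ⟨U2, hU2, R2, hR2, C, hC, hD⟩ := h.ext t ht
  set R := max R1 R2
  have hR : 0 < R := lt_max_of_lt_left hR1
  have hcont : ContinuousAt (fun t' => R ^ 3 * AA f D t' (pt R)) t :=
    continuousAt_const.mul ((h.CJ_AA.slice_t (pt R)).continuousOn.continuousAt (h.open_.mem_nhds ht))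
  have hev := hcont.eventually_lt_const (lt_add_one _)
  set B := R ^ 3 * AA f D t (pt R) + 1
  have hB : 0 ≤ B := by
    have := h.AA_nonneg ht (EVM.pt R)
    positivity
  refine ⟨U1 ∩ U2 ∩ J ∩ {t' | R ^ 3 * AA f D t' (pt R) < B},
    inter_mem (inter_mem (inter_mem hU1 hU2) (h.open_.mem_nhds ht)) hev, fun s hs => hs.1.2, R, hR,
    max C (B + 2 * π * C ^ 2 / R), by positivity, ?_⟩
  rintro t' ⟨⟨⟨h1, h2⟩, hJ⟩, hb⟩ r hr
  have hz : ∀ s, R ≤ s → Rm f t' (pt s) = 0 ∧ pf f t' s = 0 := by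
    intro s hs
    have hs1 : R1 ≤ s := (le_max_left _ _).trans hs
    exact ⟨(hm t' h1 (pt s) (by rw [norm_pt]; exact hs1.trans (le_abs_self s))).1, (hm2 t' h1 s hs1).1⟩
  have hDs : ∀ s, R ≤ s → |D t' (pt s)| * s ^ 3 ≤ C := fun s hs => hD t' h2 s ((le_max_right _ _).trans hs)
  refine ⟨?_, (hDs r hr).trans (le_max_left _ _), hz r hr⟩
  have hder : ∀ s, R ≤ s → HasDerivAt (fun s => s ^ 3 * AA f D t' (pt s) + 2 * π * C ^ 2 * s⁻¹)
      (4 * π * (s ^ 2 * Rho f D t' (pt s)) + 2 * π * C ^ 2 * (-(s ^ 2)⁻¹)) s := by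
    intro s hs
    exact (h.hasDerivAt_mass hJ s).add ((hasDerivAt_inv (hR.trans_le hs).ne').const_mul _)
  have hanti : AntitoneOn (fun s => s ^ 3 * AA f D t' (pt s) + 2 * π * C ^ 2 * s⁻¹) (Set.Ici R) := by
    apply antitoneOn_of_deriv_nonpos (convex_Ici R)
    · exact fun s hs => (hder s hs).continuousAt.continuousWithinAt
    · rw [interior_Ici]
      exact fun s hs => (hder s (le_of_lt hs)).differentiableAt.differentiableWithinAt
    · rw [interior_Ici]
      intro s hs
      have hs' : R ≤ s := le_of_lt hs
      have hs0 : 0 < s := hR.trans_le hs'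
      rw [(hder s hs').deriv]
      unfold Rho
      rw [(hz s hs').1, norm_pt_sq]
      have hd := hDs s hs'
      have hd2 : (D t' (pt s) * s ^ 3) ^ 2 ≤ C ^ 2 := by
        rw [← sq_abs, abs_mul, abs_of_pos (pow_pos hs0 3)]
        gcongr
      have e1 : 4 * π * (s ^ 2 * (0 + 1/2 * (s ^ 2 * (D t' (pt s) * D t' (pt s))))) + 2 * π * C ^ 2 * (-(s ^ 2)⁻¹)
          = 2 * π * (s ^ 2)⁻¹ * ((D t' (pt s) * s ^ 3) ^ 2 - C ^ 2) := by
        field_simp; ring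
      rw [e1]
      apply mul_nonpos_of_nonneg_of_nonpos (by positivity) (by linarith)
  have := hanti (a := R) (b := r) (le_refl R) hr hr
  simp only at this
  have hr0 : 0 < r := hR.trans_le hr
  have hp : 0 ≤ 2 * π * C ^ 2 * r⁻¹ := by positivity
  apply le_max_of_le_right
  rw [div_eq_mul_inv]
  have : R ^ 3 * AA f D t' (pt R) < B := hb
  linarith

lemma tendsto_const_div (C : ℝ) : Tendsto (fun r : ℝ => C * r⁻¹) atTop (𝓝 0) := by
  simpa using tendsto_inv_atTop_zero.const_mul C

lemma MIn.qm_tendsto (h : MIn J f D) {t : ℝ} (ht : t ∈ J) :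
    Tendsto (fun r => r ^ 2 * AA f D t (pt r)) atTop (𝓝 0) := by
  obtain ⟨U, hU, hUJ, R, hR, C, hC, hb⟩ := h.mass_bd ht
  refine squeeze_zero' (Eventually.of_forall fun r => mul_nonneg (sq_nonneg _) (h.AA_nonneg ht _)) ?_
    (tendsto_const_div C)
  filter_upwards [eventually_ge_atTop R] with r hr
  have hr0 := hR.trans_le hr
  rw [← div_eq_mul_inv, le_div_iff₀ hr0]
  have := (hb t (mem_of_mem_nhds hU) r hr).1
  linarith

lemma MIn.Lam_tendsto (h : MIn J f D) {t : ℝ} (ht : t ∈ J) :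
    Tendsto (fun r => Lam f D t (pt r)) atTop (𝓝 0) := by
  have h1 := ((((h.qm_tendsto ht).const_mul 2).const_sub 1).log (by norm_num)).const_mul (-(1/2))
  simp only [mul_zero, sub_zero, Real.log_one] at h1
  refine h1.congr fun r => ?_
  unfold Lam; rw [norm_pt_sq]

lemma MIn.Mu_tendsto (h : MIn J f D) (hp : PosOn J f D) {t : ℝ} (ht : t ∈ J) :
    Tendsto (fun r => Muf f D t (pt r)) atTop (𝓝 0) := by
  obtain ⟨U, hU, R, hR, hk⟩ := h.Vv_const hp ht
  obtain ⟨hk1, hk2⟩ := hk t (mem_of_mem_nhds hU)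
  have h1 := (h.Lam_tendsto ht).neg
  rw [neg_zero] at h1
  refine h1.congr' ?_
  filter_upwards [eventually_ge_atTop R] with r hr
  unfold Muf
  rw [hk2, hk1 r hr]; ring

lemma MIn.muD_bound (h : MIn J f D) (hp : PosOn J f D) {t : ℝ} (ht : t ∈ J) :
    ∃ R : ℝ, 0 < R ∧ ∃ K : ℝ, ∀ r, R ≤ r → |deriv (fun r => Muf f D t (pt r)) r| ≤ K * (r ^ 2)⁻¹ := by
  obtain ⟨U, hU, hUJ, R, hR, C, hC, hb⟩ := h.mass_bd ht
  have hL := (h.Lam_tendsto ht).eventually_lt_const (show (0:ℝ) < 1 by norm_num)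
  obtain ⟨R', hR'⟩ := (hL.and (eventually_ge_atTop (max R 1))).exists_forall_of_atTop
  have hRR : max R 1 ≤ R' := (hR' R' le_rfl).2
  refine ⟨R', lt_of_lt_of_le (lt_max_of_lt_left hR) hRR, Real.exp 2 * (C + 2 * π * C ^ 2), ?_⟩
  intro r hr
  have hr1 : R ≤ r := (le_max_left _ _).trans (hRR.trans hr)
  have hr2 : 1 ≤ r := (le_max_right _ _).trans (hRR.trans hr)
  have hr0 : 0 < r := by linarith
  obtain ⟨h1, h2, h3, h4⟩ := hb t (mem_of_mem_nhds hU) r hr1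
  rw [(h.hasDerivAt_Mu hp ht r).deriv, h4, abs_mul, abs_of_pos (Real.exp_pos _), mul_assoc (Real.exp 2)]
  have hA := h.AA_nonneg ht (EVM.pt r)
  apply mul_le_mul (Real.exp_le_exp.2 (by have := (hR' r hr).1; linarith)) _ (abs_nonneg _) (Real.exp_pos _).le
  · rw [← div_eq_mul_inv, le_div_iff₀ (by positivity)]
    have hd2 : (D t (pt r) * r ^ 3) ^ 2 ≤ C ^ 2 := by
      rw [← sq_abs, abs_mul, abs_of_pos (pow_pos hr0 3)]
      gcongr
    have e1 : |r * AA f D t (pt r) + 4 * π * r * (0 - 1/2 * (r ^ 2 * (D t (pt r) * D t (pt r))))| ≤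
        r * AA f D t (pt r) + 2 * π * r ^ 3 * (D t (pt r)) ^ 2 := by
      rw [abs_le]
      have a1 : 0 ≤ r * AA f D t (pt r) := by positivity
      have a2 : 0 ≤ 2 * π * r ^ 3 * (D t (pt r)) ^ 2 := by positivity
      constructor <;> linarith
    calc _ ≤ (r * AA f D t (pt r) + 2 * π * r ^ 3 * (D t (pt r)) ^ 2) * r ^ 2 := by gcongr
      _ = r ^ 3 * AA f D t (pt r) + 2 * π * ((D t (pt r) * r ^ 3) ^ 2 * r⁻¹) := by field_simp
      _ ≤ C + 2 * π * (C ^ 2 * 1) := by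
        have : r⁻¹ ≤ 1 := inv_le_one_of_one_le₀ hr2
        gcongr
      _ = C + 2 * π * C ^ 2 := by ring

lemma MIn.mu_integral (h : MIn J f D) (hp : PosOn J f D) {t : ℝ} (ht : t ∈ J) (r : ℝ) :
    Muf f D t (pt r) = -∫ s in Set.Ioi r, deriv (fun r => Muf f D t (pt r)) s := by
  have hC2 := (h.CJ_Mu hp).slice_pt ht
  have hcd : Continuous (deriv (fun r => Muf f D t (pt r))) := hC2.continuous_deriv (by norm_num)
  have hd : ∀ s ∈ Set.Ioi r, HasDerivAt (fun r => Muf f D t (pt r)) (deriv (fun r => Muf f D t (pt r)) s) s :=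
    fun s _ => (hC2.differentiable (by norm_num) s).hasDerivAt
  obtain ⟨R, hR, K, hK⟩ := h.muD_bound hp ht
  have hIntg : IntegrableOn (deriv (fun r => Muf f D t (pt r))) (Set.Ioi r) := by
    have h1 : IntegrableOn (deriv (fun r => Muf f D t (pt r))) (Set.Ioi (max r R)) := by
      have h2 : IntegrableOn (fun s : ℝ => K * (s ^ 2)⁻¹) (Set.Ioi (max r R)) := by
        have : IntegrableOn (fun s : ℝ => K * s ^ (-2:ℝ)) (Set.Ioi (max r R)) := (integrableOn_Ioi_rpow_of_lt (a := -2) (by norm_num) (lt_max_of_lt_right hR : 0 < max r R)).const_mul K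
        refine this.congr_fun (fun s hs => ?_) measurableSet_Ioi
        have hs0 : 0 < s := (lt_max_of_lt_right hR).trans hs
        simp only
        rw [Real.rpow_neg hs0.le, Real.rpow_two]
      refine Integrable.mono' h2 hcd.aestronglyMeasurable ?_
      refine (ae_restrict_iff' measurableSet_Ioi).2 (Eventually.of_forall fun s hs => ?_)
      exact hK s ((le_max_right _ _).trans (le_of_lt hs))
    rw [← Set.Ioc_union_Ioi_eq_Ioi (le_max_left r R)]
    exact ((hcd.integrableOn_Icc).mono_set Set.Ioc_subset_Icc_self).union h1
  rw [integral_Ioi_of_hasDerivAt_of_tendsto hC2.continuous.continuousWithinAt hd hIntg (h.Mu_tendsto hp ht)]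
  ring

/-- next Maxwell variable -/
def DN (q : ℝ) (f : ℝ → E3 → E3 → ℝ) (D : ℝ → E3 → ℝ) (t : ℝ) (x : E3) : ℝ :=
  q * avg (fun t x => Real.exp (Lam f D t x) * Mm f t x) t x
def eN (q : ℝ) (f : ℝ → E3 → E3 → ℝ) (D : ℝ → E3 → ℝ) (t r : ℝ) : ℝ :=
  Real.exp (-Lam f D t (pt r)) * (r * DN q f D t (pt r))
def GvN (f : ℝ → E3 → E3 → ℝ) (D : ℝ → E3 → ℝ) (t : ℝ) (x : E3) : E3 :=
  Real.exp (2 * Lam f D t x) • (AA f D t x • x + (4 * π) • Pv f t x - ((2 * π) * (‖x‖ ^ 2 * (D t x * D t x))) • x)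

lemma MIn.CJ_DN (h : MIn J f D) (hp : PosOn J f D) (q : ℝ) : CJ J (DN q f D) :=
  (CJ.const q).mul (((h.CJ_Lam hp).exp.mul (h.f_.CJ_Mm h.open_)).avg h.open_)

lemma MIn.rad_DN (h : MIn J f D) (q : ℝ) : RadialOn J (DN q f D) := by
  have h1 : RadialOn J (fun t x => Real.exp (Lam f D t x) * Mm f t x) := by
    intro t ht x
    simp only
    rw [h.rad_Lam t ht x, h.f_.Mm_inv ht]
  intro t ht x
  unfold DN
  rw [h1.avg t ht x]

lemma MIn.ext_DN (h : MIn J f D) (hp : PosOn J f D) (q : ℝ) : ExtBd J (DN q f D) := by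
  have h1 := avg_ext h.open_ ((h.CJ_Lam hp).exp.mul (h.f_.CJ_Mm h.open_)) (by
    intro t ht
    obtain ⟨U, hU, R, hR, hm, -⟩ := h.f_.moments_zero ht
    refine ⟨U, hU, R, hR, fun t' ht' r hr => ?_⟩
    rw [(hm t' ht' (pt r) (by rw [norm_pt]; exact hr.trans (le_abs_self r))).2.1, mul_zero])
  intro t ht
  obtain ⟨U, hU, R, hR, C, hC, hb⟩ := h1 t ht
  refine ⟨U, hU, R, hR, |q| * C, by positivity, fun t' ht' r hr => ?_⟩
  unfold DN
  rw [abs_mul, mul_assoc]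
  gcongr
  exact hb t' ht' r hr

lemma MIn.CJ_GvN (h : MIn J f D) (hp : PosOn J f D) : CJ J (GvN f D) :=
  ((CJ.const 2).mul (h.CJ_Lam hp)).exp.smul (((h.CJ_AA.smul CJ.id).add
    ((CJ.const (4*π)).smul (h.f_.CJ_Pv h.open_))).sub
      (((CJ.const (2*π)).mul (CJ.normSq.mul (h.D_.mul h.D_))).smul CJ.id))

lemma MIn.GvN_eq (h : MIn J f D) (hp : PosOn J f D) {t : ℝ} (ht : t ∈ J) (x : E3) :
    GvN f D t x = (deriv (fun r => Muf f D t (pt r)) ‖x‖ / ‖x‖) • x := by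
  by_cases hx : x = 0
  · subst hx; simp [GvN, Pv]
  have hn : ‖x‖ ≠ 0 := norm_ne_zero_iff.2 hx
  unfold GvN
  rw [(h.hasDerivAt_Mu hp ht _).deriv, h.f_.Pv_radial ht, h.rad_AA t ht x, h.rad_Lam t ht x, h.rad t ht x,
    smul_smul, ← add_smul, ← sub_smul, smul_smul]
  congr 1
  field_simp
  ring

/-- state of the iteration -/
structure GoodS (J : Set ℝ) (lam mu e : ℝ → ℝ → ℝ) (f : ℝ → E3 → E3 → ℝ) : Prop where
  open_ : IsOpen J
  f_ : GoodF J f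
  lam_ : CJ J (fun t x => lam t ‖x‖)
  mu_ : CJ J (fun t x => mu t ‖x‖)
  lam2 : ContDiffOn ℝ 2 (fun p : ℝ × ℝ => lam p.1 p.2) (J ×ˢ Set.univ)
  mu2 : ContDiffOn ℝ 2 (fun p : ℝ × ℝ => mu p.1 p.2) (J ×ˢ Set.univ)
  e2 : ContDiffOn ℝ 2 (fun p : ℝ × ℝ => e p.1 p.2) (J ×ˢ Set.univ)
  field : ∃ D, CJ J D ∧ RadialOn J D ∧ ExtBd J D ∧
    ∀ t ∈ J, ∀ r, 0 ≤ r → Real.exp (lam t r) * e t r = r * D t (pt r)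
  grad : ∃ Gv : ℝ → E3 → E3, CJ J Gv ∧ ∀ t ∈ J, ∀ x, Gv t x = (deriv (mu t) ‖x‖ / ‖x‖) • x
  ineq : ∀ t ∈ J, ∀ r, 0 ≤ r → mu t r + lam t r ≤ 0 ∧ 0 ≤ lam t r ∧ mu t r ≤ 0
  lamZ : ∀ t ∈ J, lam t 0 = 0
  dlamZ : ∀ t ∈ J, deriv (lam t) 0 = 0
  dmuZ : ∀ t ∈ J, deriv (mu t) 0 = 0
  eZ : ∀ t ∈ J, e t 0 = 0
  lamI : ∀ t ∈ J, Tendsto (lam t) atTop (𝓝 0)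
  muI : ∀ t ∈ J, Tendsto (mu t) atTop (𝓝 0)
  eI : ∀ t ∈ J, Tendsto (e t) atTop (𝓝 0)

lemma MIn.goodS (h : MIn J f D) (hp : PosOn J f D) (q : ℝ) :
    GoodS J (fun t r => Lam f D t (pt r)) (fun t r => Muf f D t (pt r)) (eN q f D) f where
  open_ := h.open_
  f_ := h.f_
  lam_ := (h.CJ_Lam hp).congr (fun t ht x => (h.rad_Lam t ht x).symm)
  mu_ := (h.CJ_Mu hp).congr (fun t ht x => (h.rad_Mu t ht x).symm)
  lam2 := (h.CJ_Lam hp).pt2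
  mu2 := (h.CJ_Mu hp).pt2
  e2 := ((h.CJ_Lam hp).pt2.neg.exp).mul (contDiffOn_snd.mul (h.CJ_DN hp q).pt2)
  field := ⟨DN q f D, h.CJ_DN hp q, h.rad_DN q, h.ext_DN hp q, fun t ht r hr => by
    unfold eN; rw [← mul_assoc, ← Real.exp_add, add_neg_cancel, Real.exp_zero, one_mul]⟩
  grad := ⟨GvN f D, h.CJ_GvN hp, fun t ht x => h.GvN_eq hp ht x⟩
  ineq := fun t ht r hr => h.ineq hp ht hr
  lamZ := fun t ht => by rw [pt_zero, Lam_zero]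
  dlamZ := fun t ht => by rw [(h.hasDerivAt_Lam hp ht 0).deriv]; simp
  dmuZ := fun t ht => by rw [(h.hasDerivAt_Mu hp ht 0).deriv]; simp
  eZ := fun t ht => by simp [eN]
  lamI := fun t ht => h.Lam_tendsto ht
  muI := fun t ht => h.Mu_tendsto hp ht
  eI := fun t ht => by
    obtain ⟨U, hU, R, hR, C, hC, hb⟩ := h.ext_DN hp q t ht
    refine squeeze_zero_norm' ?_ (tendsto_const_div C)
    filter_upwards [eventually_ge_atTop (max R 1)] with r hr
    have hr1 : R ≤ r := (le_max_left _ _).trans hr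
    have hr2 : 1 ≤ r := (le_max_right _ _).trans hr
    have hr0 : 0 < r := by linarith
    have hbb := hb t (mem_of_mem_nhds hU) r hr1
    have hL := h.Lam_nonneg hp ht (EVM.pt r)
    unfold eN
    rw [norm_mul, Real.norm_eq_abs, abs_of_pos (Real.exp_pos _), Real.norm_eq_abs, abs_mul, abs_of_pos hr0]
    have h1 : Real.exp (-Lam f D t (pt r)) ≤ 1 := Real.exp_le_one_iff.2 (by linarith)
    calc _ ≤ 1 * (r * |DN q f D t (pt r)|) := by gcongr
      _ = (|DN q f D t (pt r)| * r ^ 2) * r⁻¹ := by field_simp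
      _ ≤ (|DN q f D t (pt r)| * r ^ 3) * r⁻¹ := by gcongr; norm_num
      _ ≤ C * r⁻¹ := by gcongr

lemma deriv_snd_continuousOn {g : ℝ → ℝ → ℝ} (hJ : IsOpen J)
    (hg : ContDiffOn ℝ 2 (fun p : ℝ × ℝ => g p.1 p.2) (J ×ˢ Set.univ)) :
    ContinuousOn (fun p : ℝ × ℝ => deriv (g p.1) p.2) (J ×ˢ Set.univ) := by
  have ho : IsOpen (J ×ˢ (Set.univ : Set ℝ)) := hJ.prod isOpen_univ
  have h1 := (hg.continuousOn_fderiv_of_isOpen ho (by norm_num)).clm_apply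
    (continuousOn_const (c := ((0:ℝ), (1:ℝ))))
  refine h1.congr ?_
  rintro ⟨t, r⟩ hp
  have h2 : HasFDerivAt (fun p : ℝ × ℝ => g p.1 p.2) (fderiv ℝ (fun p : ℝ × ℝ => g p.1 p.2) (t, r)) (t, r) :=
    ((hg.contDiffAt (ho.mem_nhds hp)).differentiableAt (by norm_num)).hasFDerivAt
  have h3 : HasDerivAt (fun s : ℝ => (t, s)) ((0:ℝ), (1:ℝ)) r := (hasDerivAt_const r t).prodMk (hasDerivAt_id r)
  exact (h2.comp_hasDerivAt r h3).deriv

lemma GoodS.regField {lam mu e : ℝ → ℝ → ℝ} (h : GoodS J lam mu e f) {I : Set ℝ} (hI : I ⊆ J) : RegField I e := by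
  have hs : I ×ˢ Set.Ici (0:ℝ) ⊆ J ×ˢ Set.univ := Set.prod_mono hI (Set.subset_univ _)
  exact ⟨h.e2.continuousOn.mono hs, (deriv_snd_continuousOn h.open_ h.e2).mono hs,
    fun t ht => h.eZ t (hI ht), fun t ht => h.eI t (hI ht)⟩

lemma GoodS.regMetric3 {lam mu e : ℝ → ℝ → ℝ} (h : GoodS J lam mu e f) {I : Set ℝ} (hI : I ⊆ J) :
    RegMetric3 I lam mu (fun t r => -(4 * π) * r * Real.exp (lam t r + mu t r) * kk f t r) := by
  have hs : I ×ˢ Set.Ici (0:ℝ) ⊆ J ×ˢ Set.univ := Set.prod_mono hI (Set.subset_univ _)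
  have hkk : ContDiffOn ℝ 2 (fun p : ℝ × ℝ => kk f p.1 p.2) (J ×ˢ Set.univ) := by
    have := (EuclideanSpace.proj (0 : Fin 3) : E3 →L[ℝ] ℝ).contDiff.comp_contDiffOn (h.f_.CJ_Kv h.open_).pt2
    refine this.congr ?_
    rintro ⟨t, r⟩ hp
    exact (h.f_.Kv_pt hp.1 r).symm
  have hh : ContDiffOn ℝ 2 (fun p : ℝ × ℝ => -(4 * π) * Real.exp (lam p.1 p.2 + mu p.1 p.2) * kk f p.1 p.2)
      (J ×ˢ Set.univ) := (contDiffOn_const.mul (h.lam2.add h.mu2).exp).mul hkk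
  refine ⟨⟨h.lam2.mono hs, h.mu2.mono hs, fun t ht => h.lamI t (hI ht), fun t ht => h.muI t (hI ht),
    fun t ht => h.lamZ t (hI ht), fun t ht => ?_, fun t ht => h.dlamZ t (hI ht), fun t ht => h.dmuZ t (hI ht)⟩,
    ?_, fun t ht => ?_⟩
  · have : (fun s => lam s 0) =ᶠ[𝓝 t] fun _ => 0 := by
      filter_upwards [h.open_.mem_nhds (hI ht)] with s hs using h.lamZ s hs
    rw [this.deriv_eq]; simp
  · refine ((contDiffOn_snd.mul hh).mono hs).congr ?_
    rintro ⟨t, r⟩ hp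
    simp only; ring
  · have htJ := hI ht
    have hd : ContDiff ℝ 2 (fun r => -(4 * π) * Real.exp (lam t r + mu t r) * kk f t r) := by
      rw [← contDiffOn_univ]
      exact hh.comp (f := fun r : ℝ => (t, r)) (by fun_prop) (fun r _ => ⟨htJ, trivial⟩)
    have h1 := (hasDerivAt_id (0:ℝ)).mul (hd.differentiable (by norm_num) 0).hasDerivAt
    have h0 : kk f t 0 = 0 := by
      have := h.f_.kk_neg htJ 0
      rw [neg_zero] at this; linarith
    have h2 : (fun r => -(4 * π) * r * Real.exp (lam t r + mu t r) * kk f t r) =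
        (id * fun r => -(4 * π) * Real.exp (lam t r + mu t r) * kk f t r) := by
      funext r; simp; ring
    show deriv (fun r => -(4 * π) * r * Real.exp (lam t r + mu t r) * kk f t r) 0 = 0
    rw [h2, h1.deriv]; simp [h0]

end Step3

section Vlasov

variable {J : Set ℝ} {f : ℝ → E3 → E3 → ℝ} {lam mu e : ℝ → ℝ → ℝ}

def lamTf (lam mu : ℝ → ℝ → ℝ) (f : ℝ → E3 → E3 → ℝ) (t r : ℝ) : ℝ :=
  -(4 * π) * r * Real.exp (lam t r + mu t r) * kk f t r

def act2 (A : Matrix (Fin 3) (Fin 3) ℝ) (z : E3 × E3) : E3 × E3 := (act A z.1, act A z.2)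

lemma Fchar_eqv (q : ℝ) (lam mu lamT e : ℝ → ℝ → ℝ) (s : ℝ) {A : Matrix (Fin 3) (Fin 3) ℝ} (hA : SO3 A)
    (z : E3 × E3) : Fchar q lam mu lamT e s (act2 A z) = act2 A (Fchar q lam mu lamT e s z) := by
  unfold Fchar act2 F1 F2
  ext1
  · simp only [act_norm hA, w_act hA, act_smul]
  · simp only [act_norm hA, w_act hA, act_eq_zero hA, act_inner hA]
    split_ifs with h
    · rw [act_zero]
    · rw [act_smul]

lemma F2_eq {q : ℝ} (hf : GoodF J f) {s : ℝ} (hs : s ∈ J) {D : ℝ → E3 → ℝ} {Gv : ℝ → E3 → E3}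
    (hr : RadialOn J D)
    (hD : ∀ t ∈ J, ∀ r, 0 ≤ r → Real.exp (lam t r) * e t r = r * D t (pt r))
    (hG : ∀ t ∈ J, ∀ x, Gv t x = (deriv (mu t) ‖x‖ / ‖x‖) • x) (x v : E3) :
    F2 q lam mu (lamTf lam mu f) e s x v =
      (4 * π * Real.exp (lam s ‖x‖ + mu s ‖x‖) * (inner ℝ (Kv f s x) v : ℝ)) • x
      - (Real.exp (mu s ‖x‖ - lam s ‖x‖) * w v) • Gv s x
      + (q * Real.exp (mu s ‖x‖) * D s x) • x := by
  unfold F2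
  split_ifs with hx
  · rw [hG s hs, hx]; simp
  · have hn : ‖x‖ ≠ 0 := norm_ne_zero_iff.2 hx
    rw [hG s hs, hf.Kv_radial hs, inner_smul_left, smul_smul, ← sub_smul, ← add_smul, hr s hs x]
    congr 1
    have h1 := hD s hs ‖x‖ (norm_nonneg x)
    rw [show D s (pt ‖x‖) = Real.exp (lam s ‖x‖) * e s ‖x‖ / ‖x‖ by rw [h1]; field_simp]
    unfold lamTf
    rw [Real.exp_add (mu s ‖x‖)]
    simp only [conj_trivial]
    field_simp
    ring

lemma contDiffOn_pull {F : Type} [NormedAddCommGroup F] [NormedSpace ℝ F] {g : ℝ → E3 → F} (hg : CJ J g) :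
    ContDiffOn ℝ 2 (fun p : ℝ × (E3 × E3) => g p.1 p.2.1) (J ×ˢ Set.univ) :=
  ContDiffOn.comp hg (f := fun p : ℝ × (E3 × E3) => (p.1, p.2.1)) (by fun_prop) (fun p hp => ⟨hp.1, trivial⟩)

lemma GoodS.smooth_field (h : GoodS J lam mu e f) (q : ℝ) :
    ContDiffOn ℝ 2 (fun p : ℝ × (E3 × E3) => Fchar q lam mu (lamTf lam mu f) e p.1 p.2) (J ×ˢ Set.univ) := by
  obtain ⟨D, hD1, hD2, hD3, hD4⟩ := h.field
  obtain ⟨Gv, hG1, hG2⟩ := h.grad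
  have hw : ContDiffOn ℝ 2 (fun p : ℝ × (E3 × E3) => w p.2.2) (J ×ˢ Set.univ) :=
    (w_contDiff.comp (contDiff_snd.comp contDiff_snd)).contDiffOn
  have hl := contDiffOn_pull h.lam_
  have hm := contDiffOn_pull h.mu_
  refine ContDiffOn.prodMk ?_ ?_
  · exact ((hm.sub hl).exp.div hw (fun p _ => (w_pos _).ne')).smul
      (contDiff_snd.comp contDiff_snd).contDiffOn
  · have hx : ContDiffOn ℝ 2 (fun p : ℝ × (E3 × E3) => p.2.1) (J ×ˢ Set.univ) :=
      (contDiff_fst.comp contDiff_snd).contDiffOn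
    have hv : ContDiffOn ℝ 2 (fun p : ℝ × (E3 × E3) => p.2.2) (J ×ˢ Set.univ) :=
      (contDiff_snd.comp contDiff_snd).contDiffOn
    have hK := contDiffOn_pull (h.f_.CJ_Kv h.open_)
    refine ContDiffOn.congr (((((contDiffOn_const (c := 4*π)).mul (hl.add hm).exp).mul (hK.inner ℝ hv)).smul hx).sub
      (((hm.sub hl).exp.mul hw).smul (contDiffOn_pull hG1)) |>.add
      (((contDiffOn_const (c := q)).mul hm.exp).mul (contDiffOn_pull hD1) |>.smul hx)) ?_
    rintro ⟨s, x, v⟩ ⟨hs, -⟩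
    exact F2_eq h.f_ hs hD2 hD4 hG2 x v

lemma gronwall_fwd {E : Type} [NormedAddCommGroup E] [NormedSpace ℝ E] {γ γ' : ℝ → E} {a b r K : ℝ} (hK : 0 < K) (hr : 0 ≤ r)
    (hd : ∀ s ∈ Set.Icc a b, HasDerivAt γ (γ' s) s) (hb : ∀ s ∈ Set.Icc a b, ‖γ' s‖ ≤ K * (1 + ‖γ s‖))
    (h0 : ‖γ a‖ ≤ r) : ∀ s ∈ Set.Icc a b, ‖γ s‖ ≤ (r + 1) * Real.exp (K * (b - a)) := by
  intro s hs
  have h1 := norm_le_gronwallBound_of_norm_deriv_right_le (f := γ) (f' := γ') (δ := r) (K := K) (ε := K)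
    (a := a) (b := b)
    (fun s hs => (hd s hs).continuousAt.continuousWithinAt)
    (fun s hs => (hd s (Set.Ico_subset_Icc_self hs)).hasDerivWithinAt) h0
    (fun s hs => (hb s (Set.Ico_subset_Icc_self hs)).trans (by linarith)) s hs
  refine h1.trans ?_
  rw [gronwallBound_of_K_ne_0 hK.ne', div_self hK.ne']
  have h2 : Real.exp (K * (s - a)) ≤ Real.exp (K * (b - a)) := by
    apply Real.exp_le_exp.2; have := hs.2; gcongr
  nlinarith [Real.exp_pos (K * (s - a))]

lemma gronwall_two {E : Type} [NormedAddCommGroup E] [NormedSpace ℝ E] {γ γ' : ℝ → E} {a b r K t : ℝ} (hK : 0 < K) (hr : 0 ≤ r)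
    (hd : ∀ s ∈ Set.Icc a b, HasDerivAt γ (γ' s) s) (hb : ∀ s ∈ Set.Icc a b, ‖γ' s‖ ≤ K * (1 + ‖γ s‖))
    (ht : t ∈ Set.Icc a b) (h0 : ‖γ t‖ ≤ r) : ∀ s ∈ Set.Icc a b, ‖γ s‖ ≤ (r + 1) * Real.exp (K * (b - a)) := by
  intro s hs
  rcases le_total t s with hts | hts
  · have := gronwall_fwd (γ := γ) (γ' := γ') (a := t) (b := b) hK hr
      (fun u hu => hd u ⟨ht.1.trans hu.1, hu.2⟩) (fun u hu => hb u ⟨ht.1.trans hu.1, hu.2⟩) h0 s ⟨hts, hs.2⟩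
    refine this.trans ?_
    have := ht.1
    gcongr
  · have hm : ∀ u ∈ Set.Icc (-t) (-a), -u ∈ Set.Icc a b := fun u hu =>
      ⟨by linarith [hu.2], by linarith [hu.1, ht.2]⟩
    have := gronwall_fwd (γ := fun u => γ (-u)) (γ' := fun u => -γ' (-u)) (a := -t) (b := -a) hK hr
      (fun u hu => by
        have h1 := (hd (-u) (hm u hu)).scomp u (hasDerivAt_neg u)
        rw [neg_one_smul] at h1
        exact h1)
      (fun u hu => by simpa using hb (-u) (hm u hu)) (by simpa using h0) (-s) ⟨by linarith, by linarith [hs.1]⟩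
    rw [neg_neg] at this
    refine this.trans ?_
    have h5 := ht.2
    have h6 : -a - -t ≤ b - a := by linarith
    gcongr

lemma GoodS.apriori (h : GoodS J lam mu e f) (hJc : J.OrdConnected) (q : ℝ) :
    APriori J (Fchar q lam mu (lamTf lam mu f) e) := by
  obtain ⟨D, hD1, hD2, hD3, hD4⟩ := h.field
  obtain ⟨Gv, hG1, hG2⟩ := h.grad
  intro a ha b hb r
  set X := |r| + |b - a|
  set Φ : ℝ × E3 → ℝ := fun p =>
    4 * π * Real.exp (lam p.1 ‖p.2‖ + mu p.1 ‖p.2‖) * ‖Kv f p.1 p.2‖ * ‖p.2‖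
     + Real.exp (mu p.1 ‖p.2‖ - lam p.1 ‖p.2‖) * ‖Gv p.1 p.2‖
     + |q * Real.exp (mu p.1 ‖p.2‖) * D p.1 p.2| * ‖p.2‖ with hΦ
  have hsub : Set.Icc a b ×ˢ Metric.closedBall (0:E3) X ⊆ J ×ˢ Set.univ :=
    Set.prod_mono (hJc.out ha hb) (Set.subset_univ _)
  have hΦc : ContinuousOn Φ (Set.Icc a b ×ˢ Metric.closedBall (0:E3) X) := by
    have hl := h.lam_.continuousOn.mono hsub
    have hm := h.mu_.continuousOn.mono hsub
    have hk := (h.f_.CJ_Kv h.open_).continuousOn.mono hsub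
    have hg := hG1.continuousOn.mono hsub
    have hd := hD1.continuousOn.mono hsub
    have hx : ContinuousOn (fun p : ℝ × E3 => ‖p.2‖) (Set.Icc a b ×ˢ Metric.closedBall (0:E3) X) :=
      (continuous_snd.norm).continuousOn
    exact ((((continuousOn_const (c := 4 * π)).mul (hl.add hm).rexp).mul hk.norm).mul hx).add
      ((hm.sub hl).rexp.mul hg.norm) |>.add ((((continuousOn_const (c := q)).mul hm.rexp).mul hd).abs.mul hx)
  obtain ⟨C, hC⟩ := (isCompact_Icc.prod (isCompact_closedBall (0:E3) X)).exists_bound_of_continuousOn hΦc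
  refine ⟨(|r| + 1) * Real.exp ((|C| + 1) * (b - a)), ?_⟩
  intro γ c t₀ ht₀ hγ hr
  have hr0 : 0 ≤ |r| := abs_nonneg r
  -- position bound
  have hF1 : ∀ s ∈ Set.Icc a b, ∀ x v, ‖F1 lam mu s x v‖ ≤ 1 := by
    intro s hs x v
    have hsJ := hJc.out ha hb hs
    unfold F1
    obtain ⟨i1, i2, i3⟩ := h.ineq s hsJ ‖x‖ (norm_nonneg x)
    rw [norm_smul, Real.norm_eq_abs, abs_of_nonneg (div_nonneg (Real.exp_pos _).le (w_pos v).le), div_mul_eq_mul_div,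
      div_le_one (w_pos v)]
    have : Real.exp (mu s ‖x‖ - lam s ‖x‖) ≤ 1 := Real.exp_le_one_iff.2 (by linarith)
    calc _ ≤ 1 * ‖v‖ := by gcongr
      _ ≤ w v := by rw [one_mul]; exact norm_le_w v
  have hx1 : ∀ s ∈ Set.Icc a b, HasDerivAt (fun s => (γ s).1) (c s • F1 lam mu s (γ s).1 (γ s).2) s := by
    intro s hs
    exact ((ContinuousLinearMap.fst ℝ E3 E3).hasFDerivAt.comp_hasDerivAt s (hγ s hs).2.2)
  have hxb : ∀ s ∈ Set.Icc a b, ‖(γ s).1‖ ≤ X := by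
    intro s hs
    have := (convex_Icc a b).norm_image_sub_le_of_norm_hasDerivWithin_le (C := 1)
      (fun s hs => (hx1 s hs).hasDerivWithinAt) (fun s hs => by
        rw [norm_smul, Real.norm_eq_abs, abs_of_nonneg (hγ s hs).1]
        have := (hγ s hs).2.1
        have h2 := hF1 s hs (γ s).1 (γ s).2
        have h3 := (hγ s hs).1
        nlinarith [norm_nonneg (F1 lam mu s (γ s).1 (γ s).2)]) ht₀ hs
    have h1 : ‖(γ t₀).1‖ ≤ |r| := (norm_fst_le _).trans (hr.trans (le_abs_self r))
    have h2 : ‖s - t₀‖ ≤ |b - a| := by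
      rw [Real.norm_eq_abs, abs_le]
      have := le_abs_self (b - a)
      constructor <;> linarith [hs.1, hs.2, ht₀.1, ht₀.2]
    have h3 : ‖(γ s).1‖ ≤ ‖(γ s).1 - (γ t₀).1‖ + ‖(γ t₀).1‖ := by
      simpa using norm_add_le ((γ s).1 - (γ t₀).1) (γ t₀).1
    show _ ≤ |r| + |b - a|
    linarith
  refine gronwall_two (γ' := fun s => c s • Fchar q lam mu (lamTf lam mu f) e s (γ s)) (by positivity) hr0
    (fun s hs => (hγ s hs).2.2) ?_ ht₀ (hr.trans (le_abs_self r))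
  intro s hs
  have hsJ := hJc.out ha hb hs
  have h2 : ‖F2 q lam mu (lamTf lam mu f) e s (γ s).1 (γ s).2‖ ≤ |C| * (1 + ‖(γ s).2‖) := by
    set x := (γ s).1
    set v := (γ s).2
    have hΦb : Φ (s, x) ≤ |C| := (le_abs_self _).trans
      ((hC (s, x) ⟨hs, by simpa using hxb s hs⟩).trans (le_abs_self C))
    rw [F2_eq h.f_ hsJ hD2 hD4 hG2]
    have e1 := norm_add_le
      ((4 * π * Real.exp (lam s ‖x‖ + mu s ‖x‖) * (inner ℝ (Kv f s x) v : ℝ)) • x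
      - (Real.exp (mu s ‖x‖ - lam s ‖x‖) * w v) • Gv s x) ((q * Real.exp (mu s ‖x‖) * D s x) • x)
    have e2 := norm_sub_le
      ((4 * π * Real.exp (lam s ‖x‖ + mu s ‖x‖) * (inner ℝ (Kv f s x) v : ℝ)) • x)
      ((Real.exp (mu s ‖x‖ - lam s ‖x‖) * w v) • Gv s x)
    refine (e1.trans (add_le_add_left e2 _)).trans ?_
    rw [norm_smul, norm_smul, norm_smul]
    have f1 : ‖4 * π * Real.exp (lam s ‖x‖ + mu s ‖x‖) * (inner ℝ (Kv f s x) v : ℝ)‖ ≤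
        4 * π * Real.exp (lam s ‖x‖ + mu s ‖x‖) * (‖Kv f s x‖ * (1 + ‖v‖)) := by
      rw [norm_mul, Real.norm_eq_abs, abs_of_pos (by positivity : 0 < 4 * π * Real.exp (lam s ‖x‖ + mu s ‖x‖))]
      gcongr
      refine (norm_inner_le_norm _ _).trans ?_
      gcongr; linarith
    have f2 : ‖Real.exp (mu s ‖x‖ - lam s ‖x‖) * w v‖ ≤ Real.exp (mu s ‖x‖ - lam s ‖x‖) * (1 + ‖v‖) := by
      rw [norm_mul, Real.norm_eq_abs, abs_of_pos (Real.exp_pos _), Real.norm_eq_abs, abs_of_pos (w_pos v)]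
      gcongr
      exact w_le v
    have f3 : ‖q * Real.exp (mu s ‖x‖) * D s x‖ ≤ |q * Real.exp (mu s ‖x‖) * D s x| * (1 + ‖v‖) := by
      rw [Real.norm_eq_abs]
      exact le_mul_of_one_le_right (abs_nonneg _) (by linarith [norm_nonneg v])
    calc _ ≤ 4 * π * Real.exp (lam s ‖x‖ + mu s ‖x‖) * (‖Kv f s x‖ * (1 + ‖v‖)) * ‖x‖
          + Real.exp (mu s ‖x‖ - lam s ‖x‖) * (1 + ‖v‖) * ‖Gv s x‖
          + |q * Real.exp (mu s ‖x‖) * D s x| * (1 + ‖v‖) * ‖x‖ := by gcongr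
      _ = Φ (s, x) * (1 + ‖v‖) := by rw [hΦ]; ring
      _ ≤ |C| * (1 + ‖v‖) := by gcongr
  have h3 : ‖Fchar q lam mu (lamTf lam mu f) e s (γ s)‖ ≤ (|C| + 1) * (1 + ‖γ s‖) := by
    rw [Prod.norm_def]
    refine max_le ?_ ?_
    · refine (hF1 s hs _ _).trans ?_
      nlinarith [abs_nonneg C, norm_nonneg (γ s)]
    · refine h2.trans ?_
      have := norm_snd_le (γ s)
      nlinarith [abs_nonneg C, norm_nonneg (γ s), norm_nonneg (γ s).2]
  rw [norm_smul, Real.norm_eq_abs, abs_of_nonneg (hγ s hs).1]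
  have := (hγ s hs).2.1
  have h4 := (hγ s hs).1
  nlinarith [norm_nonneg (Fchar q lam mu (lamTf lam mu f) e s (γ s))]

/-- The Vlasov step. -/
lemma GoodS.vlasov (h : GoodS J lam mu e f) (hJc : J.OrdConnected) (h0 : (0:ℝ) ∈ J) (q : ℝ) {f0 : E3 → E3 → ℝ}
    (hf0 : ContDiff ℝ 2 (fun z : E3 × E3 => f0 z.1 z.2)) (hn : ∀ x v, 0 ≤ f0 x v)
    (hc : HasCompactSupport (fun z : E3 × E3 => f0 z.1 z.2)) (hsym : SphSymm f0) :
    ∃ Z : ℝ → ℝ → E3 × E3 → E3 × E3, (∀ t z, Z t t z = z) ∧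
      (∀ t ∈ J, ∀ z, ∀ s ∈ J, HasDerivAt (fun τ => Z τ t z) (Fchar q lam mu (lamTf lam mu f) e s (Z s t z)) s) ∧
      GoodF J (fun t x v => f0 (Z 0 t (x, v)).1 (Z 0 t (x, v)).2) := by
  obtain ⟨Z, hZ1, hZ2, hZ3⟩ := exists_td_flow h.open_ hJc (h.smooth_field q) (h.apriori hJc q)
  refine ⟨Z, hZ1, hZ2, ⟨?_, fun t ht x v => hn _ _, ?_, ?_⟩⟩
  · exact hf0.comp_contDiffOn (hZ3 0 h0)
  · intro t ht A hA x v
    have hm : min 0 t ∈ J := by rcases min_choice 0 t with h | h <;> rw [h] <;> assumption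
    have hM : max 0 t ∈ J := by rcases max_choice 0 t with h | h <;> rw [h] <;> assumption
    have key := curve_unique h.open_ hJc (h.smooth_field q) hm hM (t := t) ⟨min_le_right _ _, le_max_right _ _⟩
      (f := fun τ => Z τ t (act A x, act A v)) (g := fun τ => act2 A (Z τ t (x, v)))
      (fun s hs => hZ2 t ht _ s (hJc.out hm hM hs))
      (fun s hs => by
        rw [Fchar_eqv _ _ _ _ _ _ hA]
        have hd := hZ2 t ht (x, v) s (hJc.out hm hM hs)
        have L := ((rot A hA).toContinuousLinearEquiv : E3 →L[ℝ] E3).prodMap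
          ((rot A hA).toContinuousLinearEquiv : E3 →L[ℝ] E3)
        have := (((rot A hA).toContinuousLinearEquiv : E3 →L[ℝ] E3).prodMap
          ((rot A hA).toContinuousLinearEquiv : E3 →L[ℝ] E3)).hasFDerivAt.comp_hasDerivAt s hd
        exact this)
      (by simp only [hZ1]; rfl) 0 ⟨min_le_left _ _, le_max_left _ _⟩
    simp only at key ⊢
    rw [key]
    exact hsym A hA _ _
  · intro t ht
    obtain ⟨r, hr⟩ := hc.isCompact.isBounded.subset_closedBall (0 : E3 × E3)
    obtain ⟨ε, hε, hεJ⟩ := Metric.isOpen_iff.1 h.open_ t ht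
    have h1 : t - ε / 2 ∈ J := hεJ (by rw [Metric.mem_ball, Real.dist_eq, abs_lt]; constructor <;> linarith)
    have h2 : t + ε / 2 ∈ J := hεJ (by rw [Metric.mem_ball, Real.dist_eq, abs_lt]; constructor <;> linarith)
    have hm : min 0 (t - ε/2) ∈ J := by rcases min_choice 0 (t - ε/2) with h | h <;> rw [h] <;> assumption
    have hM : max 0 (t + ε/2) ∈ J := by rcases max_choice 0 (t + ε/2) with h | h <;> rw [h] <;> assumption
    obtain ⟨R, hR⟩ := h.apriori hJc q _ hm _ hM r
    refine ⟨Set.Ioo (t - ε/2) (t + ε/2), Ioo_mem_nhds (by linarith) (by linarith), |R| + 1, by positivity, ?_⟩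
    intro t' ht' x v hxv
    by_contra hne
    have hz : ‖Z 0 t' (x, v)‖ ≤ r := by
      have := hr (subset_closure (Function.mem_support.2 hne))
      simpa using this
    have ht'' : t' ∈ Set.Icc (min 0 (t - ε/2)) (max 0 (t + ε/2)) :=
      ⟨(min_le_right _ _).trans ht'.1.le, ht'.2.le.trans (le_max_right _ _)⟩
    have := hR (fun τ => Z τ t' (x, v)) (fun _ => 1) 0 ⟨min_le_left _ _, le_max_left _ _⟩
      (fun s hs => ⟨zero_le_one, le_rfl, by
        rw [one_smul]; exact hZ2 t' (hJc.out hm hM ht'') _ s (hJc.out hm hM hs)⟩) hz t' ht''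
    simp only [hZ1] at this
    have a1 := (norm_fst_le (x, v)).trans this
    have a2 := (norm_snd_le (x, v)).trans this
    simp only at a1 a2
    have := le_abs_self R
    rcases hxv with h | h <;> linarith

end Vlasov

section Radial

lemma deriv_unique_right {f g : ℝ → ℝ} {a b x : ℝ} (hf : HasDerivAt f a x) (hg : HasDerivAt g b x)
    (h : ∀ y, x ≤ y → f y = g y) : a = b := by
  have u : UniqueDiffWithinAt ℝ (Set.Ici x) x := uniqueDiffOn_Ici x x Set.self_mem_Ici
  have h1 := hf.hasDerivWithinAt (s := Set.Ici x)
  have h2 := (hg.hasDerivWithinAt (s := Set.Ici x)).congr (f₁ := f) (fun y hy => h y hy) (h x le_rfl)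
  rw [← h1.derivWithin u, ← h2.derivWithin u]

lemma hasFDerivAt_norm_ne {x : E3} (hx : x ≠ 0) : HasFDerivAt (fun y : E3 => ‖y‖) (‖x‖⁻¹ • innerSL ℝ x) x := by
  have h1 : HasFDerivAt (fun y : E3 => ‖y‖ ^ 2) (2 • innerSL ℝ x) x := (hasStrictFDerivAt_norm_sq x).hasFDerivAt
  have hn : ‖x‖ ≠ 0 := norm_ne_zero_iff.2 hx
  have h2 := h1.sqrt (pow_ne_zero 2 hn)
  simp only [Real.sqrt_sq (norm_nonneg _)] at h2
  refine h2.congr_fderiv ?_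
  ext v
  simp
  field_simp

def Bx (x : E3) : E3 →L[ℝ] E3 := ‖x‖⁻¹ • (innerSL ℝ x).smulRight x

lemma Bx_norm (x : E3) : ‖Bx x‖ ≤ ‖x‖ := by
  unfold Bx
  rw [norm_smul, ContinuousLinearMap.norm_smulRight_apply, innerSL_apply_norm, norm_inv, norm_norm]
  by_cases hx : ‖x‖ = 0
  · simp [hx]
  · field_simp; exact le_rfl

lemma Bx_continuous : Continuous Bx := by
  rw [continuous_iff_continuousAt]
  intro x
  by_cases hx : x = 0
  · subst hx
    unfold ContinuousAt
    have h0 : Bx 0 = 0 := by simp [Bx]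
    rw [h0]
    refine squeeze_zero_norm Bx_norm ?_
    simpa using (continuous_norm (E := E3)).tendsto 0
  · unfold Bx
    have hn : ‖x‖ ≠ 0 := norm_ne_zero_iff.2 hx
    refine ContinuousAt.smul (continuous_norm.continuousAt.inv₀ hn) ?_
    have : Continuous fun x : E3 => (innerSL ℝ x).smulRight x := by fun_prop
    exact this.continuousAt

lemma radial_vec_C1 {χ : ℝ → ℝ} (hχ : ContDiff ℝ 2 χ) : ContDiff ℝ 1 (fun x : E3 => χ ‖x‖ • x) := by
  have key : ∀ x : E3, HasFDerivAt (fun x : E3 => χ ‖x‖ • x)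
      (χ ‖x‖ • ContinuousLinearMap.id ℝ E3 + deriv χ ‖x‖ • Bx x) x := by
    intro x
    by_cases hx : x = 0
    · subst hx
      rw [hasFDerivAt_iff_isLittleO_nhds_zero]
      have h0 : Bx 0 = 0 := by simp [Bx]
      simp only [h0, norm_zero, smul_zero, add_zero, zero_add, sub_zero]
      have h1 : Tendsto (fun y : E3 => χ ‖y‖ - χ 0) (𝓝 0) (𝓝 0) := by
        have : Tendsto (fun y : E3 => χ ‖y‖ - χ 0) (𝓝 0) (𝓝 (χ ‖(0:E3)‖ - χ 0)) := ((hχ.continuous.comp (continuous_norm (E := E3))).sub (continuous_const (y := χ 0))).tendsto 0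
        simpa using this
      have h2 : (fun y : E3 => (χ ‖y‖ - χ 0) • y) =o[𝓝 0] fun y => y := by
        have := ((Asymptotics.isLittleO_one_iff ℝ).2 h1).smul_isBigO (Asymptotics.isBigO_refl (fun y : E3 => y) (𝓝 0))
        simpa using this
      refine h2.congr_left ?_
      intro y
      simp [sub_smul]
    · have hd : HasDerivAt χ (deriv χ ‖x‖) ‖x‖ := (hχ.differentiable (by norm_num) _).hasDerivAt
      have h1 := (hd.comp_hasFDerivAt x (hasFDerivAt_norm_ne hx)).smul (hasFDerivAt_id x)
      have h2 : HasFDerivAt (fun x : E3 => χ ‖x‖ • x) _ x := h1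
      refine h2.congr_fderiv ?_
      ext1 v
      simp [Bx, smul_smul, mul_assoc]
  rw [contDiff_one_iff_fderiv]
  refine ⟨fun x => (key x).differentiableAt, ?_⟩
  have : fderiv ℝ (fun x : E3 => χ ‖x‖ • x) = fun x => χ ‖x‖ • ContinuousLinearMap.id ℝ E3 + deriv χ ‖x‖ • Bx x :=
    funext fun x => (key x).fderiv
  rw [this]
  have hc : Continuous (deriv χ) := hχ.continuous_deriv (by norm_num)
  exact ((hχ.continuous.comp continuous_norm).smul continuous_const).add
    ((hc.comp continuous_norm).smul Bx_continuous)

lemma radial_C2 {φ : ℝ → ℝ} (hφ : ContDiff ℝ (⊤ : ℕ∞) φ) (h0 : deriv φ 0 = 0) :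
    ContDiff ℝ 2 (fun x : E3 => φ ‖x‖) := by
  have hφ1 : ContDiff ℝ (⊤ : ℕ∞) (deriv φ) := by
    have := (contDiff_infty_iff_deriv (𝕜 := ℝ) (f := φ)).1 hφ
    exact this.2
  have hφ2 : ContDiff ℝ (⊤ : ℕ∞) (deriv (deriv φ)) := by
    have := (contDiff_infty_iff_deriv (𝕜 := ℝ) (f := deriv φ)).1 hφ1
    exact this.2
  set χ : ℝ → ℝ := fun r => ∫ σ in (0:ℝ)..1, deriv (deriv φ) (r * σ) with hχdef
  have hχ : ContDiff ℝ 2 χ := by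
    rw [← contDiffOn_univ]
    refine contDiffOn_unit_integral (g := fun r σ => deriv (deriv φ) (r * σ)) isOpen_univ ?_
    have : ContDiff ℝ 2 (deriv (deriv φ)) := contDiff_infty.1 hφ2 2
    exact (this.comp (contDiff_fst.mul contDiff_snd)).contDiffOn
  have hrχ : ∀ r, r * χ r = deriv φ r := by
    intro r
    rw [hχdef, unit_integral_pt (deriv (deriv φ)) r]
    rw [intervalIntegral.integral_deriv_eq_sub (fun x _ => hφ1.differentiable (by norm_num) x)
      (hφ2.continuous.intervalIntegrable _ _), h0, sub_zero]
  have hd : ∀ r, HasDerivAt φ (deriv φ r) r := fun r => (hφ.differentiable (by norm_num) r).hasDerivAt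
  have key : ∀ x : E3, HasFDerivAt (fun x : E3 => φ ‖x‖) (innerSL ℝ (χ ‖x‖ • x)) x := by
    intro x
    by_cases hx : x = 0
    · subst hx
      rw [hasFDerivAt_iff_isLittleO_nhds_zero]
      have h1 := hd 0
      rw [h0, hasDerivAt_iff_isLittleO_nhds_zero] at h1
      simp only [zero_add, smul_zero, sub_zero, map_zero, norm_zero, ContinuousLinearMap.zero_apply] at h1 ⊢
      have h2 := h1.comp_tendsto (k := fun y : E3 => ‖y‖) (l' := 𝓝 0) (by
        simpa using (continuous_norm (E := E3)).tendsto 0)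
      exact h2.norm_right.congr_right (by intro y; simp) |>.of_norm_right
    · have hn : ‖x‖ ≠ 0 := norm_ne_zero_iff.2 hx
      have h1 := (hd ‖x‖).comp_hasFDerivAt x (hasFDerivAt_norm_ne hx)
      refine HasFDerivAt.congr_fderiv h1 ?_
      rw [← hrχ]
      ext v
      simp [inner_smul_left]
      field_simp
  have e2 : (2 : WithTop ℕ∞) = 1 + 1 := by norm_num
  rw [e2, contDiff_succ_iff_fderiv]
  refine ⟨fun x => (key x).differentiableAt, by simp, ?_⟩
  rw [show fderiv ℝ (fun x : E3 => φ ‖x‖) = fun x => innerSL ℝ (χ ‖x‖ • x) from funext fun x => (key x).fderiv]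
  exact (innerSL ℝ (E := E3)).contDiff.comp (radial_vec_C1 hχ)

end Radial

section Step
variable {J : Set ℝ} {f : ℝ → E3 → E3 → ℝ} {D : ℝ → E3 → ℝ}

lemma GoodF.mono (hf : GoodF J f) {J' : Set ℝ} (h : J' ⊆ J) : GoodF J' f :=
  ⟨hf.smooth.mono (Set.prod_mono_left h), fun t ht => hf.nonneg t (h ht), fun t ht => hf.sym t (h ht),
    fun t ht => hf.supp t (h ht)⟩

lemma MIn.mono (hm : MIn J f D) {J' : Set ℝ} (ho : IsOpen J') (h : J' ⊆ J) : MIn J' f D :=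
  ⟨ho, hm.f_.mono h, hm.D_.mono h, fun t ht => hm.rad t (h ht), fun t ht => hm.ext t (h ht)⟩

def PSet (J : Set ℝ) (f : ℝ → E3 → E3 → ℝ) (D : ℝ → E3 → ℝ) : Set ℝ :=
  {t | t ∈ J ∧ ∀ x, 2 * (‖x‖ ^ 2 * AA f D t x) < 1}

lemma MIn.isOpen_PSet (h : MIn J f D) : IsOpen (PSet J f D) := by
  rw [isOpen_iff_mem_nhds]
  rintro t ⟨ht, hpos⟩
  obtain ⟨U, hU, hUJ, R, hR, C, hC, hb⟩ := h.mass_bd ht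
  set K := max R (2 * C + 1)
  have hc : ContinuousOn (fun p : ℝ × E3 => 2 * (‖p.2‖ ^ 2 * AA f D p.1 p.2)) (J ×ˢ Set.univ) :=
    ((CJ.const (2:ℝ)).mul (CJ.normSq.mul h.CJ_AA)).continuousOn
  have hS := hc.isOpen_inter_preimage (h.open_.prod isOpen_univ) (isOpen_Iio (a := (1:ℝ)))
  obtain ⟨u, v, hu, hv, htu, hKv, huv⟩ := generalized_tube_lemma (isCompact_singleton (x := t))
    (isCompact_closedBall (0 : E3) K) hS (by
      rintro ⟨s, x⟩ ⟨hs, hx⟩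
      obtain rfl : s = t := hs
      exact ⟨⟨ht, trivial⟩, hpos x⟩)
  filter_upwards [hU, hu.mem_nhds (htu rfl)] with s hs hsu
  refine ⟨hUJ hs, fun x => ?_⟩
  by_cases hx : x ∈ Metric.closedBall (0 : E3) K
  · exact (huv (Set.mk_mem_prod hsu (hKv hx))).2
  · have hx : K < ‖x‖ := by simpa using hx
    have h1 : R ≤ ‖x‖ := (le_max_left _ _).trans hx.le
    have h2 : 2 * C + 1 < ‖x‖ := (le_max_right _ _).trans_lt hx
    have h3 := (hb s hs ‖x‖ h1).1
    rw [← h.rad_AA s (hUJ hs) x] at h3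
    have h4 : 0 < ‖x‖ := hR.trans_le h1
    by_contra hcon
    push Not at hcon
    nlinarith

lemma mqm_eq {lam e : ℝ → ℝ → ℝ} {t : ℝ}
    (h : ∀ r, 0 ≤ r → Real.exp (lam t r) * e t r = r * D t (pt r)) {r : ℝ} (hr : 0 ≤ r) :
    mqm lam e f t r = r ^ 3 * AA f D t (pt r) := by
  rw [mass_eq]
  unfold mqm
  congr 1
  apply intervalIntegral.integral_congr
  intro s hs
  rw [Set.uIcc_of_le hr] at hs
  simp only
  rw [rho_eq]
  unfold Rho
  rw [norm_pt_sq]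
  have h1 := h s hs.1
  have h2 : Real.exp (2 * lam t s) = Real.exp (lam t s) * Real.exp (lam t s) := by rw [← Real.exp_add]; ring_nf
  rw [h2]
  have : 1/2 * (Real.exp (lam t s) * Real.exp (lam t s)) * e t s ^ 2 = 1/2 * (Real.exp (lam t s) * e t s) ^ 2 := by ring
  rw [this, h1]; ring

lemma prs_eq' {lam e : ℝ → ℝ → ℝ} {t : ℝ}
    (h : ∀ r, 0 ≤ r → Real.exp (lam t r) * e t r = r * D t (pt r)) {r : ℝ} (hr : 0 ≤ r) :
    prs lam e f t r = pf f t r - 1/2 * (r ^ 2 * (D t (pt r) * D t (pt r))) := by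
  rw [prs_eq]
  have h1 := h r hr
  have h2 : Real.exp (2 * lam t r) = Real.exp (lam t r) * Real.exp (lam t r) := by rw [← Real.exp_add]; ring_nf
  rw [h2]
  have : 1/2 * (Real.exp (lam t r) * Real.exp (lam t r)) * e t r ^ 2 = 1/2 * (Real.exp (lam t r) * e t r) ^ 2 := by ring
  rw [this, h1]; ring

/-- facts on the initial data used by the time step -/
structure Base (q : ℝ) (f0 : E3 → E3 → ℝ) (lam0 e0 : ℝ → ℝ) : Prop where
  smooth : ContDiff ℝ 2 (fun z : E3 × E3 => f0 z.1 z.2)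
  nonneg : ∀ x v, 0 ≤ f0 x v
  supp : HasCompactSupport (fun z : E3 × E3 => f0 z.1 z.2)
  sym : SphSymm f0
  lamZ : lam0 0 = 0
  eZ : e0 0 = 0
  b1 : ∀ r, 0 ≤ r → r ^ 2 * (Real.exp (lam0 r) * e0 r)
    = q * ∫ s in (0:ℝ)..r, s ^ 2 * (Real.exp (lam0 s) * ∫ v, f0 (pt s) v)
  b2 : ∀ r, 0 ≤ r → r * (1 - Real.exp (-2 * lam0 r)) = 2 * mqm (fun _ => lam0) (fun _ => e0) (fun _ => f0) 0 r

structure Inv (q : ℝ) (f0 : E3 → E3 → ℝ) (lam0 e0 : ℝ → ℝ) (f : ℝ → E3 → E3 → ℝ)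
    (lam mu e : ℝ → ℝ → ℝ) (T : ℝ≥0∞) : Prop where
  ex : ∃ J, GoodS J lam mu e f ∧ J.OrdConnected ∧ (0:ℝ) ∈ J ∧ Iv T ⊆ J
  pos : 0 < T
  lam_eq : ∀ r, 0 ≤ r → lam 0 r = lam0 r
  e_eq : ∀ r, 0 ≤ r → e 0 r = e0 r

structure StepRel (q : ℝ) (f0 : E3 → E3 → ℝ) (f : ℝ → E3 → E3 → ℝ)
    (lam mu e : ℝ → ℝ → ℝ) (T : ℝ≥0∞) (f' : ℝ → E3 → E3 → ℝ)
    (lam' mu' e' : ℝ → ℝ → ℝ) (T' : ℝ≥0∞) (Z : ℝ → ℝ → E3 × E3 → E3 × E3) : Prop where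
  flow0 : ∀ t ∈ Iv T, ∀ z : E3 × E3, Z t t z = z
  flow1 : ∀ t ∈ Iv T, ∀ z : E3 × E3, ∀ s ∈ Iv T,
    HasDerivAt (fun τ => Z τ t z) (Fchar q lam mu (lamTf lam mu f) e s (Z s t z)) s
  f_ : ∀ t ∈ Iv T, ∀ x v : E3, f' t x v = f0 (Z 0 t (x, v)).1 (Z 0 t (x, v)).2
  T_ : T' = sSup {τ : ℝ≥0∞ | ∃ t : ℝ, τ = ENNReal.ofReal t ∧
      t ∈ Iv T ∧ ∀ s ∈ Set.Icc (0:ℝ) t, ∀ r : ℝ, 0 < r → 2 * mqm lam e f' s r < r}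
  l1 : ∀ t ∈ Iv T', ∀ r : ℝ, 0 < r → Real.exp (-2 * lam' t r) = 1 - 2 * mqm lam e f' t r / r
  l2 : ∀ t ∈ Iv T', lam' t 0 = 0
  m1 : ∀ t ∈ Iv T', ∀ r : ℝ, 0 < r → deriv (mu' t) r = Real.exp (2 * lam' t r) *
      (mqm lam e f' t r / r ^ 2 + 4 * π * r * prs lam e f' t r)
  m2 : ∀ t ∈ Iv T', ∀ r : ℝ, 0 ≤ r → mu' t r = -∫ s in Set.Ioi r, deriv (mu' t) s
  e1 : ∀ t ∈ Iv T', ∀ r : ℝ, 0 < r → e' t r = q / r ^ 2 * Real.exp (-(lam' t r)) *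
      ∫ s in (0:ℝ)..r, s ^ 2 * Real.exp (lam' t s) * Mch f' t s
  e2 : ∀ t ∈ Iv T', e' t 0 = 0

lemma isOpen_occ {P : Set ℝ} (hP : IsOpen P) (x : ℝ) : IsOpen (Set.ordConnectedComponent P x) := by
  rw [isOpen_iff_mem_nhds]
  intro y hy
  have hyP : y ∈ P := Set.ordConnectedComponent_subset hy
  rw [Set.ordConnectedComponent_eq hy]
  exact Set.ordConnectedComponent_mem_nhds.2 (hP.mem_nhds hyP)

lemma Lam_base {q : ℝ} {f0 : E3 → E3 → ℝ} {lam0 e0 : ℝ → ℝ} (hb : Base q f0 lam0 e0)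
    {lam e : ℝ → ℝ → ℝ} (hD : ∀ r, 0 ≤ r → Real.exp (lam 0 r) * e 0 r = r * D 0 (pt r))
    (hl : ∀ r, 0 ≤ r → lam 0 r = lam0 r) (he : ∀ r, 0 ≤ r → e 0 r = e0 r)
    (hf : ∀ x v, f 0 x v = f0 x v) {r : ℝ} (hr : 0 ≤ r) :
    1 - 2 * (r ^ 2 * AA f D 0 (pt r)) = Real.exp (-2 * lam0 r) := by
  have h1 : mqm lam e f 0 r = mqm (fun _ => lam0) (fun _ => e0) (fun _ => f0) 0 r := by
    unfold mqm
    congr 1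
    apply intervalIntegral.integral_congr
    intro s hs
    rw [Set.uIcc_of_le hr] at hs
    simp only [rho]
    rw [hl s hs.1, he s hs.1]
    simp only [hf]
  rw [mqm_eq hD hr] at h1
  have h2 := hb.b2 r hr
  rw [← h1] at h2
  rcases hr.eq_or_lt with rfl | hr
  · simp [hb.lamZ]
  · have : r * (1 - 2 * (r ^ 2 * AA f D 0 (pt r)) - Real.exp (-2 * lam0 r)) = 0 := by linear_combination h2
    rcases mul_eq_zero.1 this with h | h
    · linarith
    · linarith

lemma eN_base {q : ℝ} {f0 : E3 → E3 → ℝ} {lam0 e0 : ℝ → ℝ} (hb : Base q f0 lam0 e0)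
    (hl : ∀ r, 0 ≤ r → Lam f D 0 (pt r) = lam0 r)
    (hf : ∀ x v, f 0 x v = f0 x v) {r : ℝ} (hr : 0 ≤ r) : eN q f D 0 r = e0 r := by
  rcases hr.eq_or_lt with rfl | hr
  · simp [eN, hb.eZ]
  have h1 := avg_pt (fun t x => Real.exp (Lam f D t x) * Mm f t x) 0 r
  have h2 : ∫ s in (0:ℝ)..r, s ^ 2 * (Real.exp (Lam f D 0 (pt s)) * Mm f 0 (pt s))
      = ∫ s in (0:ℝ)..r, s ^ 2 * (Real.exp (lam0 s) * ∫ v, f0 (pt s) v) := by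
    apply intervalIntegral.integral_congr
    intro s hs
    rw [Set.uIcc_of_le hr.le] at hs
    simp only [Mm, hf, smul_eq_mul, mul_one]
    rw [hl s hs.1]
  rw [h2] at h1
  have h3 := hb.b1 r hr.le
  rw [← h1] at h3
  have h4 : r * DN q f D 0 (pt r) = Real.exp (lam0 r) * e0 r := by
    have : r ^ 2 * (r * DN q f D 0 (pt r) - Real.exp (lam0 r) * e0 r) = 0 := by
      unfold DN; linear_combination -h3
    rcases mul_eq_zero.1 this with h | h
    · exact absurd h (by positivity)
    · linarith
  unfold eN
  rw [h4, hl r hr.le, ← mul_assoc, ← Real.exp_add]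
  simp

lemma step {q : ℝ} {f0 : E3 → E3 → ℝ} {lam0 e0 : ℝ → ℝ} (hb : Base q f0 lam0 e0)
    {lam mu e : ℝ → ℝ → ℝ} {T : ℝ≥0∞} (hI : Inv q f0 lam0 e0 f lam mu e T) :
    ∃ f' lam' mu' e' T' Z, Inv q f0 lam0 e0 f' lam' mu' e' T' ∧
      StepRel q f0 f lam mu e T f' lam' mu' e' T' Z := by
  obtain ⟨J, hG, hJc, h0, hIv⟩ := hI.ex
  obtain ⟨Z, hZ0, hZ1, hgood⟩ := hG.vlasov hJc h0 q hb.smooth hb.nonneg hb.supp hb.sym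
  obtain ⟨D, hD1, hD2, hD3, hD⟩ := hG.field
  set g : ℝ → E3 → E3 → ℝ := fun t x v => f0 (Z 0 t (x,v)).1 (Z 0 t (x,v)).2 with hg
  have hM : MIn J g D := ⟨hG.open_, hgood, hD1, hD2, hD3⟩
  have hg0 : ∀ x v, g 0 x v = f0 x v := by intro x v; simp only [hg]; rw [hZ0]
  have hL0 : ∀ r, 0 ≤ r → 1 - 2 * (r ^ 2 * AA g D 0 (pt r)) = Real.exp (-2 * lam0 r) := fun r hr =>
    Lam_base hb (hD 0 h0) hI.lam_eq hI.e_eq hg0 hr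
  set P := PSet J g D with hP
  have hPo : IsOpen P := hM.isOpen_PSet
  have h0P : (0:ℝ) ∈ P := by
    refine ⟨h0, fun x => ?_⟩
    have := hL0 ‖x‖ (norm_nonneg x)
    rw [← hM.rad_AA 0 h0 x] at this
    have h2 := Real.exp_pos (-2 * lam0 ‖x‖)
    linarith
  set J' := Set.ordConnectedComponent P 0 with hJ'
  have hJ'o : IsOpen J' := isOpen_occ hPo 0
  have hJ'P : J' ⊆ P := Set.ordConnectedComponent_subset
  have hJ'J : J' ⊆ J := fun t ht => (hJ'P ht).1
  have h0J' : (0:ℝ) ∈ J' := Set.self_mem_ordConnectedComponent.2 h0P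
  have hM' : MIn J' g D := hM.mono hJ'o hJ'J
  have hp : PosOn J' g D := fun t ht => (hJ'P ht).2
  have hLam0 : ∀ r, 0 ≤ r → Lam g D 0 (pt r) = lam0 r := by
    intro r hr
    have h1 := hp.exp_Lam h0J' r
    rw [hL0 r hr] at h1
    have := Real.exp_injective h1
    linarith
  set T' : ℝ≥0∞ := sSup {τ : ℝ≥0∞ | ∃ t : ℝ, τ = ENNReal.ofReal t ∧
      t ∈ Iv T ∧ ∀ s ∈ Set.Icc (0:ℝ) t, ∀ r : ℝ, 0 < r → 2 * mqm lam e g s r < r} with hT'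
  have hIvT : Iv T' ⊆ J' := by
    rintro t ⟨ht0, htT⟩
    obtain ⟨τ, ⟨t', rfl, ht'T, ht'⟩, hlt⟩ := lt_sSup_iff.1 htT
    have htt' : t < t' := (ENNReal.ofReal_lt_ofReal_iff_of_nonneg ht0).1 hlt
    show Set.uIcc 0 t ⊆ P
    rw [Set.uIcc_of_le ht0]
    intro s hs
    have hsJ : s ∈ J := hIv ⟨hs.1, (ENNReal.ofReal_le_ofReal (hs.2.trans htt'.le)).trans_lt ht'T.2⟩
    refine ⟨hsJ, fun x => ?_⟩
    by_cases hx : x = 0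
    · simp [hx]
    have hxp : 0 < ‖x‖ := norm_pos_iff.2 hx
    have h1 := ht' s ⟨hs.1, hs.2.trans htt'.le⟩ ‖x‖ hxp
    rw [mqm_eq (hD s hsJ) hxp.le, ← hM.rad_AA s hsJ x] at h1
    by_contra hcon
    push Not at hcon
    nlinarith
  have hT'pos : 0 < T' := by
    have e1 : ∀ᶠ t in 𝓝 (0:ℝ), ENNReal.ofReal t < T := by
      have : Tendsto ENNReal.ofReal (𝓝 0) (𝓝 0) := by
        simpa using ENNReal.continuous_ofReal.tendsto 0
      exact this.eventually (gt_mem_nhds hI.pos)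
    obtain ⟨ε, hε, hball⟩ := Metric.eventually_nhds_iff.1 (e1.and (hPo.mem_nhds h0P))
    have h1 : ENNReal.ofReal (ε/2) ≤ T' := by
      refine le_sSup ⟨ε/2, rfl, ⟨by positivity, ?_⟩, ?_⟩
      · refine (hball ?_).1
        rw [Real.dist_eq, sub_zero, abs_of_pos (by positivity)]; linarith
      · intro s hs r hr
        have hsP : s ∈ P := by
          refine (hball ?_).2
          rw [Real.dist_eq, sub_zero, abs_of_nonneg hs.1]; linarith [hs.2]
        have h2 := hsP.2 (pt r)
        rw [norm_pt_sq] at h2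
        rw [mqm_eq (hD s hsP.1) hr.le]
        nlinarith
    exact (ENNReal.ofReal_pos.2 (by positivity)).trans_le h1
  have hS := hM'.goodS hp q
  refine ⟨g, fun t r => Lam g D t (pt r), fun t r => Muf g D t (pt r), eN q g D, T', Z,
    ⟨⟨J', hS, inferInstance, h0J', hIvT⟩, hT'pos, hLam0,
      fun r hr => eN_base hb hLam0 hg0 hr⟩, ?_⟩
  refine ⟨fun t _ z => hZ0 t z, fun t ht z s hs => hZ1 t (hIv ht) z s (hIv hs), fun t _ x v => rfl, rfl,
    ?_, fun t ht => hS.lamZ t (hIvT ht), ?_, fun t ht r hr => hM'.mu_integral hp (hIvT ht) r, ?_,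
    fun t ht => hS.eZ t (hIvT ht)⟩
  · intro t ht r hr
    have ht' := hIvT ht
    rw [hp.exp_Lam ht', mqm_eq (hD t (hJ'J ht')) hr.le]
    field_simp
  · intro t ht r hr
    have ht' := hIvT ht
    rw [(hM'.hasDerivAt_Mu hp ht' r).deriv, mqm_eq (hD t (hJ'J ht')) hr.le, prs_eq' (hD t (hJ'J ht')) hr.le]
    congr 2
    field_simp
  · intro t ht r hr
    have h1 := avg_pt (fun t x => Real.exp (Lam g D t x) * Mm g t x) t r
    have h2 : ∫ s in (0:ℝ)..r, s ^ 2 * Real.exp (Lam g D t (pt s)) * Mch g t s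
      = ∫ s in (0:ℝ)..r, s ^ 2 * (Real.exp (Lam g D t (pt s)) * Mm g t (pt s)) := by
      simp only [Mch_eq, mul_assoc]
    rw [h2, ← h1]
    unfold eN DN
    field_simp

end Step

section BaseSec

lemma hasDerivAt_mq_zero {h : ℝ → ℝ} (hh : DifferentiableAt ℝ h 0) : HasDerivAt (fun r => r ^ 2 * h r) 0 0 := by
  have h1 : HasDerivAt (fun r => r ^ 2 * h r) _ 0 := (hasDerivAt_pow 2 (0:ℝ)).mul hh.hasDerivAt
  refine h1.congr_deriv ?_
  simp

lemma goodF_base {f0 : E3 → E3 → ℝ} (h1 : ContDiff ℝ 2 (fun z : E3 × E3 => f0 z.1 z.2))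
    (h2 : ∀ x v, 0 ≤ f0 x v) (h3 : HasCompactSupport (fun z : E3 × E3 => f0 z.1 z.2)) (h4 : SphSymm f0) :
    GoodF Set.univ (fun _ => f0) where
  smooth := (h1.comp contDiff_snd).contDiffOn
  nonneg := fun _ _ => h2
  sym := fun _ _ => h4
  supp := by
    intro t _
    obtain ⟨R, hR⟩ := h3.isBounded.subset_ball (0 : E3 × E3)
    refine ⟨Set.univ, univ_mem, max R 1, by positivity, ?_⟩
    intro t' _ x v hxv
    by_contra hne
    have hmem : (x, v) ∈ tsupport (fun z : E3 × E3 => f0 z.1 z.2) := subset_tsupport _ hne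
    have h5 := hR hmem
    rw [mem_ball_zero_iff, Prod.norm_mk, max_lt_iff] at h5
    have h6 := le_max_left R 1
    rcases hxv with h | h <;> linarith [h5.1, h5.2]

lemma base_of_data {q : ℝ} {f0 : E3 → E3 → ℝ} {lam0 mu0 e0 : ℝ → ℝ}
    (hd : InitialData q f0 lam0 mu0 e0) : Base q f0 lam0 e0 := by
  obtain ⟨hf, hn, hs, hsym, -, hl, hm, he, hl0, he0, tl, tm, te, c1, c2, c3⟩ := hd
  have hf2 : ContDiff ℝ 2 (fun z : E3 × E3 => f0 z.1 z.2) := contDiff_infty.1 hf 2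
  have hg := goodF_base hf2 hn hs hsym
  have hdl : ∀ r, HasDerivAt lam0 (deriv lam0 r) r := fun r => (hl.differentiable (by norm_num) r).hasDerivAt
  have hM : Continuous (fun s => ∫ v, f0 (pt s) v) := by
    have := ((hg.CJ_Mm isOpen_univ).slice_pt (Set.mem_univ 0)).continuous
    simpa [Mm] using this
  have hR : Continuous (fun s => ∫ v, w v * f0 (pt s) v) := by
    have := ((hg.CJ_Rm isOpen_univ).slice_pt (Set.mem_univ 0)).continuous
    simpa [Rm, mul_comm] using this
  have cl := hl.continuous
  have ce := he.continuous
  refine ⟨hf2, hn, hs, hsym, hl0, he0, ?_, ?_⟩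
  · intro r hr
    have hc : Continuous (fun s => s ^ 2 * Real.exp (lam0 s) * e0 s) := by fun_prop
    have := intervalIntegral.integral_eq_sub_of_hasDerivAt_of_le hr
      (f := fun s => s ^ 2 * Real.exp (lam0 s) * e0 s)
      (f' := fun s => q * (s ^ 2 * (Real.exp (lam0 s) * ∫ v, f0 (pt s) v))) hc.continuousOn (by
        intro s hs
        have h1 : DifferentiableAt ℝ (fun s => s ^ 2 * Real.exp (lam0 s) * e0 s) s :=
          ((differentiableAt_id.pow 2).mul ((hl.differentiable (by norm_num) s).exp)).mul
            (he.differentiable (by norm_num) s)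
        refine h1.hasDerivAt.congr_deriv ?_
        rw [c3 s hs.1]; ring)
      (Continuous.intervalIntegrable (by fun_prop) _ _)
    rw [intervalIntegral.integral_const_mul] at this
    rw [this]; ring
  · intro r hr
    have hc : Continuous (fun s => s * (1 - Real.exp (-2 * lam0 s))) := by fun_prop
    have := intervalIntegral.integral_eq_sub_of_hasDerivAt_of_le hr
      (f := fun s => s * (1 - Real.exp (-2 * lam0 s)))
      (f' := fun s => 8 * π * (s ^ 2 * ((∫ v : E3, w v * f0 (pt s) v)
          + 1/2 * Real.exp (2 * lam0 s) * (e0 s) ^ 2))) hc.continuousOn (by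
        intro s hs
        have h1 : HasDerivAt (fun s => s * (1 - Real.exp (-2 * lam0 s))) _ s :=
          (hasDerivAt_id s).mul ((((hdl s).const_mul (-2)).exp).const_sub 1)
        refine h1.congr_deriv ?_
        have := c1 s hs.1
        simp only [id]
        linear_combination this)
      (Continuous.intervalIntegrable (by fun_prop) _ _)
    rw [intervalIntegral.integral_const_mul] at this
    unfold mqm rho
    linear_combination -this

lemma base_dlam {q : ℝ} {f0 : E3 → E3 → ℝ} {lam0 mu0 e0 : ℝ → ℝ}
    (hd : InitialData q f0 lam0 mu0 e0) : deriv lam0 0 = 0 := by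
  have hb := base_of_data hd
  obtain ⟨hf, hn, hs, hsym, -, hl, hm, he, hl0, he0, tl, tm, te, c1, c2, c3⟩ := hd
  have hg := goodF_base hb.smooth hn hs hsym
  have hdl : ∀ r, HasDerivAt lam0 (deriv lam0 r) r := fun r => (hl.differentiable (by norm_num) r).hasDerivAt
  have hl1 : ContDiff ℝ (⊤ : ℕ∞) (deriv lam0) := ((contDiff_infty_iff_deriv (𝕜 := ℝ) (f := lam0)).1 hl).2
  have hdl1 : HasDerivAt (deriv lam0) (deriv (deriv lam0) 0) 0 := (hl1.differentiable (by norm_num) 0).hasDerivAt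
  have hR : Differentiable ℝ (fun s => ∫ v, w v * f0 (pt s) v) := by
    have := ((hg.CJ_Rm isOpen_univ).slice_pt (Set.mem_univ 0)).differentiable (by norm_num)
    simpa [Rm, mul_comm] using this
  have h1 : HasDerivAt (fun r => Real.exp (-2 * lam0 r) * (2 * r * deriv lam0 r - 1) + 1) _ 0 :=
    ((((hdl 0).const_mul (-2)).exp).mul ((((hasDerivAt_id (0:ℝ)).const_mul 2).mul hdl1).sub_const 1)).add_const 1
  have h2 := hasDerivAt_mq_zero (h := fun r => 8 * π * ((∫ v : E3, w v * f0 (pt r) v)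
          + 1/2 * Real.exp (2 * lam0 r) * (e0 r) ^ 2)) (by
    refine DifferentiableAt.const_mul ((hR 0).add ?_) _
    exact ((((hl.differentiable (by norm_num) 0).const_mul 2).exp).const_mul (1/2)).mul
      ((he.differentiable (by norm_num) 0).pow 2))
  have h3 := deriv_unique_right h1 h2 (by
    intro y hy
    rcases hy.eq_or_lt with rfl | hy
    · simp [hl0]
    · rw [c1 y hy]; ring)
  simp [hl0] at h3
  linarith

lemma base_goodS {q : ℝ} {f0 : E3 → E3 → ℝ} {lam0 mu0 e0 : ℝ → ℝ}
    (hd : InitialData q f0 lam0 mu0 e0) :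
    GoodS Set.univ (fun _ => lam0) (fun _ => mu0) (fun _ => e0) (fun _ => f0) := by
  have hb := base_of_data hd
  have hdl0 := base_dlam hd
  obtain ⟨hf, hn, hs, hsym, -, hl, hm, he, hl0, he0, tl, tm, te, c1, c2, c3⟩ := hd
  have hg := goodF_base hb.smooth hn hs hsym
  set fc : ℝ → E3 → E3 → ℝ := fun _ => f0 with hfc
  have hlC : CJ Set.univ (fun _ (x : E3) => lam0 ‖x‖) := ((radial_C2 hl hdl0).comp contDiff_snd).contDiffOn
  set G : ℝ → E3 → ℝ := fun t x => Real.exp (lam0 ‖x‖) * Mm fc t x with hG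
  have hGC : CJ Set.univ G := hlC.exp.mul (hg.CJ_Mm isOpen_univ)
  have hGr : RadialOn Set.univ G := by
    intro t ht x
    simp only [hG]
    rw [hg.Mm_inv ht x, norm_pt, abs_norm]
  set D : ℝ → E3 → ℝ := fun t x => q * avg G t x with hDd
  have hDC : CJ Set.univ D := (CJ.const q).mul (hGC.avg isOpen_univ)
  have hDr : RadialOn Set.univ D := by
    intro t ht x
    simp only [hDd]
    rw [hGr.avg t ht x]
  have hDe : ExtBd Set.univ D := by
    have h1 := avg_ext isOpen_univ hGC (by
      intro t ht
      obtain ⟨U, hU, R, hR, hm, -⟩ := hg.moments_zero ht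
      refine ⟨U, hU, R, hR, fun t' ht' r hr => ?_⟩
      simp only [hG]
      rw [(hm t' ht' (pt r) (by rw [norm_pt]; exact hr.trans (le_abs_self r))).2.1, mul_zero])
    intro t ht
    obtain ⟨U, hU, R, hR, C, hC, hb⟩ := h1 t ht
    refine ⟨U, hU, R, hR, |q| * C, by positivity, fun t' ht' r hr => ?_⟩
    simp only [hDd]
    rw [abs_mul, mul_assoc]
    gcongr
    exact hb t' ht' r hr
  have hDf : ∀ t r, 0 ≤ r → Real.exp (lam0 r) * e0 r = r * D t (pt r) := by
    intro t r hr
    rcases hr.eq_or_lt with rfl | hr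
    · simp [he0]
    have h1 := avg_pt G t r
    have h2 : ∫ s in (0:ℝ)..r, s ^ 2 * G t (pt s)
        = ∫ s in (0:ℝ)..r, s ^ 2 * (Real.exp (lam0 s) * ∫ v, f0 (pt s) v) := by
      apply intervalIntegral.integral_congr
      intro s hs
      rw [Set.uIcc_of_le hr.le] at hs
      simp only [hG, Mm, hfc, smul_eq_mul, mul_one]
      rw [norm_pt, abs_of_nonneg hs.1]
    rw [h2] at h1
    have h3 := hb.b1 r hr.le
    rw [← h1] at h3
    have : r ^ 2 * (r * D t (pt r) - Real.exp (lam0 r) * e0 r) = 0 := by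
      simp only [hDd]; linear_combination -h3
    rcases mul_eq_zero.1 this with h | h
    · exact absurd h (by positivity)
    · linarith
  have hM : MIn Set.univ fc D := ⟨isOpen_univ, hg, hDC, hDr, hDe⟩
  have hAA : ∀ t r, 0 ≤ r → 1 - 2 * (r ^ 2 * AA fc D t (pt r)) = Real.exp (-2 * lam0 r) := by
    intro t r hr
    have : AA fc D t (pt r) = AA fc D 0 (pt r) := rfl
    rw [this]
    exact Lam_base hb (lam := fun _ => lam0) (e := fun _ => e0) (fun r hr => hDf 0 r hr)
      (fun _ _ => rfl) (fun _ _ => rfl) (fun _ _ => rfl) hr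
  have hp : PosOn Set.univ fc D := by
    intro t ht x
    have h1 := hAA t ‖x‖ (norm_nonneg x)
    rw [← hM.rad_AA t ht x] at h1
    have h2 := Real.exp_pos (-2 * lam0 ‖x‖)
    linarith
  have hLam : ∀ t r, 0 ≤ r → Lam fc D t (pt r) = lam0 r := by
    intro t r hr
    have h1 := hp.exp_Lam (Set.mem_univ t) r
    rw [hAA t r hr] at h1
    have := Real.exp_injective h1
    linarith
  have hdmu : ∀ r, HasDerivAt mu0 (deriv mu0 r) r := fun r => (hm.differentiable (by norm_num) r).hasDerivAt
  have hmud : ∀ t r, 0 < r → deriv (fun r => Muf fc D t (pt r)) r = deriv mu0 r := by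
    intro t r hr
    rw [(hM.hasDerivAt_Mu hp (Set.mem_univ t) r).deriv, hLam t r hr.le]
    have h1 := c2 r hr
    have h2 := prs_eq' (f := fc) (lam := fun _ => lam0) (e := fun _ => e0) (t := t) (fun r hr => hDf t r hr) hr.le
    unfold prs at h2
    simp only [hfc] at h2 
    rw [h2] at h1
    have h3 := hAA t r hr.le
    have h4 : Real.exp (2 * lam0 r) * Real.exp (-2 * lam0 r) = 1 := by
      rw [← Real.exp_add]; simp
    have h5 : 2 * r * (Real.exp (2 * lam0 r) * (r * AA fc D t (pt r) +
        4 * π * r * (pf fc t r - 1/2 * (r ^ 2 * (D t (pt r) * D t (pt r))))) - deriv mu0 r) = 0 := by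
      linear_combination (-Real.exp (2 * lam0 r)) * h1 + (-Real.exp (2 * lam0 r)) * h3 + (2 * r * deriv mu0 r) * h4
    rcases mul_eq_zero.1 h5 with h | h
    · exact absurd h (by positivity)
    · linarith
  have hMu : ∀ t r, 0 ≤ r → Muf fc D t (pt r) = mu0 r := by
    intro t r hr
    have hdM := fun s => hM.hasDerivAt_Mu hp (Set.mem_univ t) s
    set φ : ℝ → ℝ := fun s => Muf fc D t (pt s) - mu0 s with hφ
    have hdφ : Differentiable ℝ φ := fun s => (hdM s).differentiableAt.sub (hdmu s).differentiableAt
    have hφ0 : ∀ s, 0 < s → deriv φ s = 0 := by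
      intro s hs
      have : HasDerivAt φ _ s := (hdM s).differentiableAt.hasDerivAt.sub (hdmu s)
      rw [this.deriv, hmud t s hs, sub_self]
    have hconst : ∀ s, r < s → φ s = φ r := by
      intro s hs
      obtain ⟨c, hc, hc2⟩ := exists_deriv_eq_slope φ hs hdφ.continuous.continuousOn hdφ.differentiableOn
      rw [hφ0 c (hr.trans_lt hc.1)] at hc2
      have := sub_pos.2 hs
      field_simp at hc2
      linarith
    have ht : Tendsto φ atTop (𝓝 0) := by
      simpa using (hM.Mu_tendsto hp (Set.mem_univ t)).sub tm
    have ht2 : Tendsto φ atTop (𝓝 (φ r)) := by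
      refine tendsto_const_nhds.congr' ?_
      filter_upwards [eventually_gt_atTop r] with s hs using (hconst s hs).symm
    have := tendsto_nhds_unique ht ht2
    simp only [hφ] at this
    linarith
  refine ⟨isOpen_univ, hg, hlC, ?_, ?_, ?_, ?_, ⟨D, hDC, hDr, hDe, fun t _ r hr => hDf t r hr⟩,
    ⟨GvN fc D, hM.CJ_GvN hp, ?_⟩, ?_, fun _ _ => hl0, fun _ _ => hdl0, ?_, fun _ _ => he0,
    fun _ _ => tl, fun _ _ => tm, fun _ _ => te⟩
  · refine (hM.CJ_Mu hp).congr (fun t ht x => ?_)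
    rw [hM.rad_Mu t ht x, hMu t _ (norm_nonneg x)]
  · exact ((contDiff_infty.1 hl 2).comp contDiff_snd).contDiffOn
  · exact ((contDiff_infty.1 hm 2).comp contDiff_snd).contDiffOn
  · exact ((contDiff_infty.1 he 2).comp contDiff_snd).contDiffOn
  · intro t ht x
    by_cases hx : x = 0
    · rw [hM.GvN_eq hp ht, hx]; simp
    · rw [hM.GvN_eq hp ht, hmud t _ (norm_pos_iff.2 hx)]
  · intro t ht r hr
    have := hM.ineq hp ht hr
    rwa [hMu t r hr, hLam t r hr] at this
  · intro t ht
    have h1 := deriv_unique_right (hM.hasDerivAt_Mu hp ht 0) (hdmu 0) (fun y hy => hMu t y hy)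
    simpa using h1.symm

end BaseSec

section Assembly

structure Stt where
  f : ℝ → E3 → E3 → ℝ
  lam : ℝ → ℝ → ℝ
  mu : ℝ → ℝ → ℝ
  e : ℝ → ℝ → ℝ
  T : ℝ≥0∞

def Ok (q : ℝ) (f0 : E3 → E3 → ℝ) (lam0 e0 : ℝ → ℝ) (S : Stt) : Prop :=
  Inv q f0 lam0 e0 S.f S.lam S.mu S.e S.T

def Rel (q : ℝ) (f0 : E3 → E3 → ℝ) (S S' : Stt) (Z : ℝ → ℝ → E3 × E3 → E3 × E3) : Prop :=
  StepRel q f0 S.f S.lam S.mu S.e S.T S'.f S'.lam S'.mu S'.e S'.T Z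

theorem main_aux (q : ℝ) (f0 : E3 → E3 → ℝ) (lam0 mu0 e0 : ℝ → ℝ)
    (hdata : InitialData q f0 lam0 mu0 e0) :
    ∃ (fI : ℕ → ℝ → E3 → E3 → ℝ) (lamI muI lamTI eI : ℕ → ℝ → ℝ → ℝ)
      (T : ℕ → ℝ≥0∞) (Z : ℕ → ℝ → ℝ → E3 × E3 → E3 × E3),
      IsScheme q f0 lam0 mu0 e0 fI lamI muI lamTI eI T Z ∧
      ∀ n : ℕ, 0 < T n ∧
        RegMetric3 (Iv (T n)) (lamI n) (muI n) (lamTI n) ∧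
        RegField (Iv (T n)) (eI n) ∧ RegDist (Iv (T n)) (fI n) ∧
        (∀ t ∈ Iv (T n), ∀ r : ℝ, 0 ≤ r →
          muI n t r + lamI n t r ≤ 0 ∧ 0 ≤ lamI n t r ∧ muI n t r ≤ 0) := by
  have hb := base_of_data hdata
  set S0 : Stt := ⟨fun _ => f0, fun _ => lam0, fun _ => mu0, fun _ => e0, ⊤⟩ with hS0
  have hok0 : Ok q f0 lam0 e0 S0 :=
    ⟨⟨Set.univ, base_goodS hdata, Set.ordConnected_univ, trivial, Set.subset_univ _⟩,
      ENNReal.zero_lt_top, fun _ _ => rfl, fun _ _ => rfl⟩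
  have hstep : ∀ S : {S : Stt // Ok q f0 lam0 e0 S}, ∃ (S' : {S : Stt // Ok q f0 lam0 e0 S})
      (Z : ℝ → ℝ → E3 × E3 → E3 × E3), Rel q f0 S.1 S'.1 Z := by
    rintro ⟨S, hS⟩
    obtain ⟨f', lam', mu', e', T', Z, h1, h2⟩ := step hb hS
    exact ⟨⟨⟨f', lam', mu', e', T'⟩, h1⟩, Z, h2⟩
  choose nxt ZZ hrel using hstep
  set seq : ℕ → {S : Stt // Ok q f0 lam0 e0 S} := fun n => Nat.rec ⟨S0, hok0⟩ (fun _ S => nxt S) n with hseq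
  have hsucc : ∀ n, seq (n+1) = nxt (seq n) := fun n => rfl
  have hr : ∀ n, Rel q f0 (seq n).1 (seq (n+1)).1 (ZZ (seq n)) := fun n => hrel (seq n)
  refine ⟨fun n => (seq n).1.f, fun n => (seq n).1.lam, fun n => (seq n).1.mu,
    fun n => lamTf (seq n).1.lam (seq n).1.mu (seq n).1.f, fun n => (seq n).1.e, fun n => (seq n).1.T,
    fun n => ZZ (seq (n - 1)), ?_, ?_⟩
  · exact ⟨fun _ _ _ => rfl, fun _ _ => rfl, fun _ _ => rfl, fun _ _ => rfl, rfl, fun _ _ _ => rfl,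
      fun n => (hr n).flow0, fun n => (hr n).flow1, fun n => (hr n).f_, fun n => (hr n).T_,
      fun n => (hr n).l1, fun n => (hr n).l2, fun n => (hr n).m1, fun n => (hr n).m2,
      fun n => (hr n).e1, fun n => (hr n).e2⟩
  · intro n
    have hI : Inv q f0 lam0 e0 (seq n).1.f (seq n).1.lam (seq n).1.mu (seq n).1.e (seq n).1.T := (seq n).2
    obtain ⟨J, hG, -, -, hJ⟩ := hI.ex
    exact ⟨hI.pos, hG.regMetric3 hJ, hG.regField hJ, hG.f_.regDist hJ, fun t ht r hr => hG.ineq t (hJ ht) r hr⟩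

end Assembly

/-- Proposition 4.1: the iterates of the scheme are well defined
and regular, the times `Tₙ` are strictly positive, and `μₙ + λₙ ≤ 0`, `λₙ ≥ 0`,
`μₙ ≤ 0`. -/
theorem iterates_well_defined
    (q : ℝ) (f0 : E3 → E3 → ℝ) (lam0 mu0 e0 : ℝ → ℝ)
    (hdata : InitialData q f0 lam0 mu0 e0) :
    ∃ (fI : ℕ → ℝ → E3 → E3 → ℝ) (lamI muI lamTI eI : ℕ → ℝ → ℝ → ℝ)
      (T : ℕ → ℝ≥0∞) (Z : ℕ → ℝ → ℝ → E3 × E3 → E3 × E3),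
      IsScheme q f0 lam0 mu0 e0 fI lamI muI lamTI eI T Z ∧
      ∀ n : ℕ, 0 < T n ∧
        RegMetric3 (Iv (T n)) (lamI n) (muI n) (lamTI n) ∧
        RegField (Iv (T n)) (eI n) ∧ RegDist (Iv (T n)) (fI n) ∧
        (∀ t ∈ Iv (T n), ∀ r : ℝ, 0 ≤ r →
          muI n t r + lamI n t r ≤ 0 ∧ 0 ≤ lamI n t r ∧ muI n t r ≤ 0) := by
  exact main_aux q f0 lam0 mu0 e0 hdata

end EVM
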